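/- Every finite simple graph with circumference at most 6 (that is, containing no cycle of length greater than 6) has an outside-obstacle representation. -/

import Mathlib

noncomputable section

/-- The plane ℝ². -/
abbrev Plane : Type := EuclideanSpace ℝ (Fin 2)

/-- A point set is in general position if no three of its points are collinear. -/
def InGenPos (P : Set Plane) : Prop :=
  ∀ p ∈ P, ∀ q ∈ P, ∀ r ∈ P, p ≠ q → p ≠ r → q ≠ r →
    ¬ Collinear ℝ ({p, q, r} : Set Plane)

/-- The union of the closed segments corresponding to the edges of `G`
in the straight-line drawing given by `f`. -/
def edgeUnion {V : Type} (G : SimpleGraph V) (f : V → Plane) : Set Plane :=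
  ⋃ (u : V) (v : V) (_ : G.Adj u v), segment ℝ (f u) (f v)

/-- The unbounded connected component of the complement of the drawing. -/
def outsideRegion {V : Type} (G : SimpleGraph V) (f : V → Plane) : Set Plane :=
  {p | p ∈ (edgeUnion G f)ᶜ ∧
       ¬ Bornology.IsBounded (connectedComponentIn (edgeUnion G f)ᶜ p)}

/-- `(f, C)` is a single-obstacle representation of `G`. -/
def IsObstacleRep {V : Type} (G : SimpleGraph V) (f : V → Plane) (C : Set Plane) : Prop :=
  Function.Injective f ∧ InGenPos (Set.range f) ∧
  IsOpen C ∧ IsConnected C ∧ Disjoint C (Set.range f) ∧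
  ∀ u v : V, u ≠ v → (G.Adj u v ↔ Disjoint (segment ℝ (f u) (f v)) C)

/-- An outside-obstacle representation: the obstacle lies in the unbounded component. -/
def IsOutsideObstacleRep {V : Type} (G : SimpleGraph V) (f : V → Plane) (C : Set Plane) : Prop :=
  IsObstacleRep G f C ∧ C ⊆ outsideRegion G f

/-- An inside-obstacle representation: the obstacle avoids the unbounded component. -/
def IsInsideObstacleRep {V : Type} (G : SimpleGraph V) (f : V → Plane) (C : Set Plane) : Prop :=
  IsObstacleRep G f C ∧ Disjoint C (outsideRegion G f)

/-- An exposed outside-obstacle representation: every vertex lies on the boundary of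
the unbounded component. -/
def IsExposedOutsideObstacleRep {V : Type} (G : SimpleGraph V) (f : V → Plane)
    (C : Set Plane) : Prop :=
  IsOutsideObstacleRep G f C ∧ ∀ v : V, f v ∈ closure (outsideRegion G f)

/-- `p` is an extreme point ("on the convex hull") of the point set `P`. -/
def IsExtremePt (p : Plane) (P : Set Plane) : Prop :=
  p ∉ convexHull ℝ (P \ {p})

/-- `S` has at least `n` connected components. -/
def AtLeastNComponents (S : Set Plane) (n : ℕ) : Prop :=
  ∃ p : Fin n → Plane, (∀ i, p i ∈ S) ∧
    ∀ i j : Fin n, i ≠ j →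
      connectedComponentIn S (p i) ≠ connectedComponentIn S (p j)

/-- `S` has exactly `n` connected components. -/
def ExactlyNComponents (S : Set Plane) (n : ℕ) : Prop :=
  ∃ p : Fin n → Plane, (∀ i, p i ∈ S) ∧
    (∀ i j : Fin n, i ≠ j →
      connectedComponentIn S (p i) ≠ connectedComponentIn S (p j)) ∧
    ∀ q ∈ S, ∃ i : Fin n, connectedComponentIn S q = connectedComponentIn S (p i)

/-- The convex hulls of `A` and `B` are at least `t`-crossing. -/
def AtLeastCrossing (A B : Set Plane) (t : ℕ) : Prop :=
  ((convexHull ℝ A) ∩ (convexHull ℝ B)).Nonempty ∧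
    AtLeastNComponents ((convexHull ℝ A) \ (convexHull ℝ B)) (t + 1)

/-- The convex hulls of `A` and `B` are exactly `t`-crossing. -/
def ExactlyCrossing (A B : Set Plane) (t : ℕ) : Prop :=
  ((convexHull ℝ A) ∩ (convexHull ℝ B)).Nonempty ∧
    ExactlyNComponents ((convexHull ℝ A) \ (convexHull ℝ B)) (t + 1)



section
set_option linter.unusedSectionVars false
set_option linter.unusedVariables false
open Set Filter Topology

/-- Coordinates used internally. -/
abbrev P2 : Type := ℝ × ℝ

/-- Points that can be joined to infinity in the complement of `D`. -/
def OutSet (D : Set P2) : Set P2 :=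
  {p | ∀ R : ℝ, ∃ q, R < ‖q‖ ∧ JoinedIn Dᶜ p q}

/-- The drawing of the graph induced on `S`. -/
def Dr {V : Type} (G : SimpleGraph V) (S : Set V) (f : V → P2) : Set P2 :=
  {p | ∃ u ∈ S, ∃ v ∈ S, (u = v ∨ G.Adj u v) ∧ p ∈ segment ℝ (f u) (f v)}

/-- A cone at `p` lies in the outer region. -/
def Exposed (D : Set P2) (p : P2) : Prop :=
  ∃ d : P2, ∃ c > 0, ∀ s : ℝ, 0 < s → s ≤ c → ∀ e : P2, ‖e - d‖ ≤ c → p + s • e ∈ OutSet D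

structure GoodOn {V : Type} (G : SimpleGraph V) (S : Set V) (r : V) (f : V → P2) : Prop where
  inj : InjOn f S
  acc : ∀ u ∈ S, ∀ v ∈ S, u ≠ v → ¬ G.Adj u v → ∃ X ∈ segment ℝ (f u) (f v), X ∈ OutSet (Dr G S f)
  exp : ∀ v ∈ S, Exposed (Dr G S f) (f v)
  root : ∃ φ : P2 →ₗ[ℝ] ℝ, ∀ x ∈ S, x ≠ r → φ (f r) < φ (f x)

theorem out_not_mem {D : Set P2} {p : P2} (h : p ∈ OutSet D) : p ∉ D := by
  obtain ⟨q, _, hq⟩ := h 0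
  exact hq.source_mem

theorem out_of_joined {D : Set P2} {p q : P2} (h : JoinedIn Dᶜ p q) (hq : q ∈ OutSet D) :
    p ∈ OutSet D := by
  intro R
  obtain ⟨z, hz, hj⟩ := hq R
  exact ⟨z, hz, h.trans hj⟩

theorem joinedIn_of_convex {F C : Set P2} {p q : P2} (hC : Convex ℝ C) (hCF : C ⊆ F) (hp : p ∈ C)
    (hq : q ∈ C) : JoinedIn F p q :=
  (hC.isPathConnected ⟨p, hp⟩ |>.joinedIn p hp q hq).mono hCF

theorem joinedIn_of_segment {F : Set P2} {p q : P2} (h : segment ℝ p q ⊆ F) : JoinedIn F p q :=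
  joinedIn_of_convex (convex_segment p q) h (left_mem_segment _ _ _) (right_mem_segment _ _ _)

theorem out_ray {D : Set P2} {p d : P2} (hd : d ≠ 0) (h : ∀ s : ℝ, 0 ≤ s → p + s • d ∉ D) :
    p ∈ OutSet D := by
  intro R
  have hn : 0 < ‖d‖ := norm_pos_iff.mpr hd
  set s : ℝ := (|R| + 1 + ‖p‖) / ‖d‖ with hs
  have hs0 : 0 ≤ s := by positivity
  refine ⟨p + s • d, ?_, ?_⟩
  · have h1 : ‖s • d‖ = |R| + 1 + ‖p‖ := by
      rw [norm_smul, Real.norm_of_nonneg hs0, hs]; field_simp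
    have h2 := norm_sub_le (p + s • d) p
    have h3 : p + s • d - p = s • d := by abel
    rw [h3, h1] at h2
    have := le_abs_self R
    linarith
  · apply joinedIn_of_segment
    intro x hx
    rw [segment_eq_image'] at hx
    obtain ⟨t, ht, rfl⟩ := hx
    have : p + t • (p + s • d - p) = p + (t * s) • d := by
      rw [mul_smul]; simp
    show p + t • (p + s • d - p) ∉ D
    rw [this]
    exact h _ (mul_nonneg ht.1 hs0)

theorem out_far {D : Set P2} {p q : P2} {R : ℝ} (hD : ∀ x ∈ D, ‖x‖ ≤ R) (hq : R < ‖q‖)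
    (h : JoinedIn Dᶜ p q) : p ∈ OutSet D := by
  refine out_of_joined h ?_
  by_cases hq0 : q = 0
  · subst hq0
    simp only [norm_zero] at hq
    apply out_ray (d := (1, 0)) (by simp)
    intro s _ hx
    have := hD _ hx
    have := norm_nonneg ((0 : P2) + s • ((1 : ℝ), (0 : ℝ)))
    linarith
  · apply out_ray hq0
    intro s hs hx
    have h1 := hD _ hx
    have : q + s • q = (1 + s) • q := by rw [add_smul, one_smul]
    rw [this, norm_smul, Real.norm_of_nonneg (by linarith)] at h1
    nlinarith [norm_nonneg q]

theorem out_mono {D D' : Set P2} (h : D ⊆ D') : OutSet D' ⊆ OutSet D := by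
  intro p hp R
  obtain ⟨q, hq, hj⟩ := hp R
  exact ⟨q, hq, hj.mono (compl_subset_compl.mpr h)⟩

theorem far_joined {R : ℝ} (hR : 0 ≤ R) {p q : P2} (hp : R < ‖p‖) (hq : R < ‖q‖) :
    JoinedIn {x : P2 | R < ‖x‖} p q := by
  have hN : ∀ x : P2, R < ‖x‖ ↔ (R < x.1 ∨ x.1 < -R) ∨ (R < x.2 ∨ x.2 < -R) := by
    intro x
    rw [Prod.norm_def, lt_max_iff, Real.norm_eq_abs, Real.norm_eq_abs, lt_abs, lt_abs]
    constructor
    · rintro ((h | h) | (h | h))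
      · exact Or.inl (Or.inl h)
      · exact Or.inl (Or.inr (by linarith))
      · exact Or.inr (Or.inl h)
      · exact Or.inr (Or.inr (by linarith))
    · rintro ((h | h) | (h | h))
      · exact Or.inl (Or.inl h)
      · exact Or.inl (Or.inr (by linarith))
      · exact Or.inr (Or.inl h)
      · exact Or.inr (Or.inr (by linarith))
  have c1 : Convex ℝ {x : P2 | R < x.1} :=
    convex_halfSpace_gt (f := fun x : P2 => x.1) ⟨fun _ _ => rfl, fun _ _ => rfl⟩ R
  have c2 : Convex ℝ {x : P2 | x.1 < -R} :=
    convex_halfSpace_lt (f := fun x : P2 => x.1) ⟨fun _ _ => rfl, fun _ _ => rfl⟩ (-R)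
  have c3 : Convex ℝ {x : P2 | R < x.2} :=
    convex_halfSpace_gt (f := fun x : P2 => x.2) ⟨fun _ _ => rfl, fun _ _ => rfl⟩ R
  have c4 : Convex ℝ {x : P2 | x.2 < -R} :=
    convex_halfSpace_lt (f := fun x : P2 => x.2) ⟨fun _ _ => rfl, fun _ _ => rfl⟩ (-R)
  have j1 : JoinedIn {x : P2 | R < ‖x‖} (R+1, -R-1) (R+1, R+1) :=
    joinedIn_of_convex c1 (fun x hx => (hN x).2 (Or.inl (Or.inl hx))) (by simp) (by simp)
  have j2 : JoinedIn {x : P2 | R < ‖x‖} (-R-1, -R-1) (R+1, -R-1) :=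
    joinedIn_of_convex c4 (fun x hx => (hN x).2 (Or.inr (Or.inr hx))) (by simp) (by simp)
  have key : ∀ x : P2, R < ‖x‖ → JoinedIn {x : P2 | R < ‖x‖} x (R+1, R+1) := by
    intro x hx
    rcases (hN x).1 hx with (h | h) | (h | h)
    · exact joinedIn_of_convex c1 (fun x hx => (hN x).2 (Or.inl (Or.inl hx))) h (by simp)
    · refine JoinedIn.trans ?_ (j2.trans j1)
      exact joinedIn_of_convex c2 (fun x hx => (hN x).2 (Or.inl (Or.inr hx))) h (by simp)
    · exact joinedIn_of_convex c3 (fun x hx => (hN x).2 (Or.inr (Or.inl hx))) h (by simp)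
    · refine JoinedIn.trans ?_ j1
      exact joinedIn_of_convex c4 (fun x hx => (hN x).2 (Or.inr (Or.inr hx))) h (by simp)
  exact (key p hp).trans (key q hq).symm

theorem out_joined {D : Set P2} {R : ℝ} (hD : ∀ x ∈ D, ‖x‖ ≤ R) {p q : P2} (hp : p ∈ OutSet D)
    (hq : q ∈ OutSet D) : JoinedIn Dᶜ p q := by
  obtain ⟨p', hp', jp⟩ := hp (max R 0)
  obtain ⟨q', hq', jq⟩ := hq (max R 0)
  refine jp.trans (JoinedIn.trans ?_ jq.symm)
  refine (far_joined (le_max_right R 0) hp' hq').mono ?_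
  intro x hx hxD
  have h1 := hD x hxD
  have h2 : max R 0 < ‖x‖ := hx
  exact absurd (lt_of_le_of_lt (le_max_left R 0) h2) (not_lt.mpr h1)

theorem exposed_of_free {D : Set P2} {p d : P2} {c c' : ℝ} (hc : 0 < c) (hc' : 0 < c')
    (hfree : ∀ s : ℝ, 0 < s → s ≤ c → ∀ e : P2, ‖e - d‖ ≤ c' → p + s • e ∉ D)
    (hout : ∃ s : ℝ, 0 < s ∧ s ≤ c ∧ ∃ e : P2, ‖e - d‖ ≤ c' ∧ p + s • e ∈ OutSet D) :
    Exposed D p := by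
  refine ⟨d, min c c', lt_min hc hc', ?_⟩
  intro s hs hsc e he
  obtain ⟨s', hs', hsc', e', he', ho⟩ := hout
  refine out_of_joined (joinedIn_of_segment ?_) ho
  intro x hx
  obtain ⟨a, b, ha, hb, hab, rfl⟩ := hx
  set t := a * s + b * s' with ht
  have hbb : b = 1 - a := by linarith
  have ht0 : 0 < t := by
    rcases ha.eq_or_lt with h | h
    · have : b = 1 := by linarith
      rw [ht, ← h, this]; linarith
    · have h1 : 0 < a * s := mul_pos h hs
      have h2 : 0 ≤ b * s' := mul_nonneg hb hs'.le
      linarith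
  have htc : t ≤ c := by
    have h1 : s ≤ c := hsc.trans (min_le_left _ _)
    nlinarith
  have heq : a • (p + s • e) + b • (p + s' • e') =
      p + t • ((a * s / t) • e + (b * s' / t) • e') := by
    rw [smul_add, smul_add, smul_add, smul_smul, smul_smul, smul_smul, smul_smul,
      mul_div_cancel₀ _ ht0.ne', mul_div_cancel₀ _ ht0.ne']
    have : a • p + b • p = p := by rw [← add_smul, hab, one_smul]
    calc _ = (a • p + b • p) + ((a * s) • e + (b * s') • e') := by abel
      _ = _ := by rw [this]
  rw [heq]
  apply hfree t ht0 htc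
  have h1 : 0 ≤ a * s / t := by positivity
  have h2 : 0 ≤ b * s' / t := by positivity
  have h3 : a * s / t + b * s' / t = 1 := by rw [← add_div, ← ht, div_self ht0.ne']
  have hball := (convex_closedBall d c') (x := e) (y := e')
    (by simpa [dist_eq_norm] using he.trans (min_le_right _ _)) (by simpa [dist_eq_norm] using he') h1 h2 h3
  simpa [dist_eq_norm] using hball

theorem joinedIn_compact {F : Set P2} {p q : P2} (h : JoinedIn F p q) :
    ∃ K, IsCompact K ∧ K ⊆ F ∧ JoinedIn K p q := by
  obtain ⟨γ, hγ⟩ := h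
  refine ⟨range γ, isCompact_range γ.continuous, ?_, γ, fun t => mem_range_self t⟩
  rintro _ ⟨t, rfl⟩
  exact hγ t

section
variable {V : Type} [Finite V] (G : SimpleGraph V) (S : Set V)

theorem mem_Dr_vertex {G : SimpleGraph V} {S : Set V} {f : V → P2} {u : V} (hu : u ∈ S) :
    f u ∈ Dr G S f := ⟨u, hu, u, hu, Or.inl rfl, left_mem_segment _ _ _⟩

theorem isClosed_Dr_pair : IsClosed {x : (V → P2) × P2 | x.2 ∈ Dr G S x.1} := by
  have : {x : (V → P2) × P2 | x.2 ∈ Dr G S x.1} =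
      ⋃ (u : V) (v : V), {x | (u ∈ S ∧ v ∈ S ∧ (u = v ∨ G.Adj u v)) ∧ x.2 ∈ segment ℝ (x.1 u) (x.1 v)} := by
    ext x
    simp only [Dr, mem_ofPred_eq, mem_iUnion]
    constructor
    · rintro ⟨u, hu, v, hv, h, hx⟩
      exact ⟨u, v, ⟨hu, hv, h⟩, hx⟩
    · rintro ⟨u, v, ⟨hu, hv, h⟩, hx⟩
      exact ⟨u, hu, v, hv, h, hx⟩
  rw [this]
  refine isClosed_iUnion_of_finite fun u => isClosed_iUnion_of_finite fun v => ?_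
  by_cases h : u ∈ S ∧ v ∈ S ∧ (u = v ∨ G.Adj u v)
  · simp only [h, true_and]
    have h2 : {x : (V → P2) × P2 | x.2 ∈ segment ℝ (x.1 u) (x.1 v)} =
        Prod.snd '' {y : (Icc (0:ℝ) 1) × ((V → P2) × P2) |
          y.2.1 u + (y.1 : ℝ) • (y.2.1 v - y.2.1 u) = y.2.2} := by
      ext x
      simp only [mem_ofPred_eq, mem_image, segment_eq_image']
      constructor
      · rintro ⟨t, ht, hx⟩
        exact ⟨(⟨t, ht⟩, x), hx, rfl⟩
      · rintro ⟨⟨t, y⟩, hx, rfl⟩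
        exact ⟨t, t.2, hx⟩
    rw [h2]
    apply isClosedMap_snd_of_compactSpace
    apply isClosed_eq
    · fun_prop
    · fun_prop
  · simp [h]

theorem isClosed_Dr (f : V → P2) : IsClosed (Dr G S f) :=
  (isClosed_Dr_pair G S).preimage (f := fun x : P2 => (f, x)) (by fun_prop)

theorem Dr_bound {f : V → P2} {R : ℝ} (h : ∀ u ∈ S, ‖f u‖ ≤ R) : ∀ x ∈ Dr G S f, ‖x‖ ≤ R := by
  rintro x ⟨u, hu, v, hv, _, hx⟩
  have := (convex_closedBall (0 : P2) R).segment_subset (x := f u) (y := f v)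
    (by simpa using h u hu) (by simpa using h v hv) hx
  simpa using this

/-- Outer points are stable under perturbation of the drawing. -/
theorem out_stable {f : V → P2} {X : P2} (hX : X ∈ OutSet (Dr G S f)) :
    ∀ᶠ p : (V → P2) × P2 in 𝓝 (f, X), p.2 ∈ OutSet (Dr G S p.1) := by
  obtain ⟨R, hR⟩ : ∃ R, ∀ u, ‖f u‖ < R := by
    obtain ⟨R, hR⟩ := (Set.finite_range (fun u => ‖f u‖)).bddAbove
    exact ⟨R + 1, fun u => by have := hR (mem_range_self u); linarith⟩
  obtain ⟨q, hq, hj⟩ := hX R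
  obtain ⟨K, hK, hKF, hjK⟩ := joinedIn_compact hj
  have hop : (Dr G S f)ᶜ ∈ 𝓝 X := (isClosed_Dr G S f).isOpen_compl.mem_nhds hj.source_mem
  obtain ⟨δ, hδ, hball⟩ := Metric.nhds_basis_closedBall.mem_iff.1 hop
  set K' := K ∪ Metric.closedBall X δ with hK'
  have hK'c : IsCompact K' := hK.union (isCompact_closedBall X δ)
  have hK'F : K' ⊆ (Dr G S f)ᶜ := union_subset hKF hball
  have h1 : ∀ᶠ g in 𝓝 f, ∀ y ∈ K', y ∉ Dr G S g := by
    apply hK'c.eventually_forall_of_forall_eventually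
    intro y hy
    exact (isClosed_Dr_pair G S).isOpen_compl.mem_nhds (show ((f, y) : (V → P2) × P2) ∈ _ from hK'F hy)
  have h2 : ∀ᶠ g in 𝓝 f, ∀ u, ‖g u‖ < R := by
    rw [eventually_all]
    intro u
    have : Continuous fun g : V → P2 => ‖g u‖ := by fun_prop
    exact this.continuousAt.eventually_lt continuousAt_const (hR u)
  rw [nhds_prod_eq]
  filter_upwards [(h1.and h2).prod_mk (Metric.closedBall_mem_nhds X hδ)]
  rintro ⟨g, Y⟩ ⟨⟨hg1, hg2⟩, hY⟩
  refine out_far (Dr_bound G S (fun u _ => (hg2 u).le)) hq ?_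
  have hsub : K' ⊆ (Dr G S g)ᶜ := hg1
  refine JoinedIn.trans ?_ (hjK.mono (subset_union_left.trans hsub))
  exact joinedIn_of_convex (convex_closedBall X δ) (subset_union_right.trans hsub) hY
    (Metric.mem_closedBall_self hδ.le)

end

/-- Transport along an affine self-map of the plane. -/
theorem goodOn_affine {V : Type} {G : SimpleGraph V} {S : Set V} {r : V} {f : V → P2}
    (T : P2 ≃L[ℝ] P2) (w : P2) (h : GoodOn G S r f) :
    GoodOn G S r (fun x => T (f x - w)) := by
  set A : P2 → P2 := fun x => T (x - w) with hA
  set B : P2 → P2 := fun x => T.symm x + w with hB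
  have hAB : ∀ x, A (B x) = x := fun x => by simp [hA, hB]
  have hBA : ∀ x, B (A x) = x := fun x => by simp [hA, hB]
  have hAc : Continuous A := by fun_prop
  have hseg : ∀ x y z, z ∈ segment ℝ x y → A z ∈ segment ℝ (A x) (A y) := by
    rintro x y z ⟨a, b, ha, hb, hab, rfl⟩
    refine ⟨a, b, ha, hb, hab, ?_⟩
    simp only [hA]
    rw [← map_smul, ← map_smul, ← map_add]
    congr 1
    have : w = a • w + b • w := by rw [← add_smul, hab, one_smul]
    rw [smul_sub, smul_sub]
    nth_rewrite 3 [this]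
    abel
  have hsegB : ∀ x y z, z ∈ segment ℝ (A x) (A y) → B z ∈ segment ℝ x y := by
    rintro x y z ⟨a, b, ha, hb, hab, rfl⟩
    refine ⟨a, b, ha, hb, hab, ?_⟩
    simp only [hA, hB, map_add, map_smul, ContinuousLinearEquiv.symm_apply_apply]
    have : w = a • w + b • w := by rw [← add_smul, hab, one_smul]
    rw [smul_sub, smul_sub]
    nth_rewrite 3 [this]
    abel
  have hD : ∀ x, A x ∈ Dr G S (fun x => T (f x - w)) → x ∈ Dr G S f := by
    rintro x ⟨u, hu, v, hv, h1, h2⟩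
    refine ⟨u, hu, v, hv, h1, ?_⟩
    have := hsegB _ _ _ h2
    rwa [hBA] at this
  have hout : ∀ x, x ∈ OutSet (Dr G S f) → A x ∈ OutSet (Dr G S (fun x => T (f x - w))) := by
    intro x hx R
    have hBb : ∃ R', ∀ y, ‖y‖ ≤ R → ‖B y‖ ≤ R' := by
      have : IsCompact (B '' Metric.closedBall 0 R) :=
        (isCompact_closedBall (0 : P2) R).image (by fun_prop)
      obtain ⟨R', hR'⟩ := this.isBounded.exists_norm_le
      exact ⟨R', fun y hy => hR' _ ⟨y, by simpa using hy, rfl⟩⟩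
    obtain ⟨R', hR'⟩ := hBb
    obtain ⟨q, hq, hj⟩ := hx R'
    refine ⟨A q, ?_, ?_⟩
    · by_contra hcon
      have := hR' _ (not_lt.mp hcon)
      rw [hBA] at this
      linarith
    · obtain ⟨γ, hγ⟩ := hj
      exact ⟨γ.map hAc, fun t hmem => hγ t (hD _ hmem)⟩
  refine ⟨?_, ?_, ?_, ?_⟩
  · intro x hx y hy hxy
    apply h.inj hx hy
    have : A (f x) = A (f y) := hxy
    rw [← hBA (f x), this, hBA]
  · intro u hu v hv huv hadj
    obtain ⟨X, hX, hXo⟩ := h.acc u hu v hv huv hadj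
    exact ⟨A X, hseg _ _ _ hX, hout _ hXo⟩
  · intro v hv
    obtain ⟨d, c, hc, hcone⟩ := h.exp v hv
    have hcont : Continuous fun e => T.symm e := T.symm.continuous
    have h1 : ∀ᶠ e in 𝓝 (T d), ‖T.symm e - d‖ < c := by
      have : Continuous fun e => ‖T.symm e - d‖ := by fun_prop
      apply this.continuousAt.eventually_lt continuousAt_const
      simpa using hc
    obtain ⟨δ, hδ, hb⟩ := Metric.nhds_basis_closedBall.mem_iff.1 h1
    refine ⟨T d, min δ c, lt_min hδ hc, ?_⟩
    intro s hs hsc e he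
    have h2 : ‖T.symm e - d‖ < c := hb (by simpa [dist_eq_norm] using he.trans (min_le_left _ _))
    have h3 := hout _ (hcone s hs (hsc.trans (min_le_right _ _)) _ h2.le)
    convert h3 using 1
    simp only [hA]
    rw [add_sub_right_comm, map_add, map_smul]
    simp
  · obtain ⟨φ, hφ⟩ := h.root
    refine ⟨φ.comp (T.symm : P2 →ₗ[ℝ] P2), ?_⟩
    intro x hx hxr
    have := hφ x hx hxr
    simpa using this

end

section
set_option linter.unusedSectionVars false
set_option linter.unusedVariables false
open Set Filter Topology

/-- Orientation determinant. -/
def ori (p q r : P2) : ℝ := (q.1 - p.1) * (r.2 - p.2) - (q.2 - p.2) * (r.1 - p.1)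

theorem quad_eventually_ne {a b c : ℝ} (hc : c ≠ 0) :
    ∀ᶠ ε : ℝ in 𝓝[>] 0, a + b * ε + c * ε ^ 2 ≠ 0 := by
  by_cases ha : a = 0
  · by_cases hb : b = 0
    · filter_upwards [self_mem_nhdsWithin] with ε hε
      have : ε ≠ 0 := ne_of_gt hε
      simp [ha, hb, hc, this]
    · have h1 : ∀ᶠ ε : ℝ in 𝓝[>] 0, b + c * ε ≠ 0 := by
        have : Continuous fun ε : ℝ => b + c * ε := by fun_prop
        exact (this.continuousAt (x := 0)).eventually_ne (by simpa using hb) |>.filter_mono nhdsWithin_le_nhds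
      filter_upwards [self_mem_nhdsWithin, h1] with ε hε h1
      have h0 : ε ≠ 0 := ne_of_gt hε
      have : a + b * ε + c * ε ^ 2 = ε * (b + c * ε) := by rw [ha]; ring
      rw [this]
      exact mul_ne_zero h0 h1
  · have : Continuous fun ε : ℝ => a + b * ε + c * ε ^ 2 := by fun_prop
    exact (this.continuousAt (x := 0)).eventually_ne (by simpa using ha) |>.filter_mono nhdsWithin_le_nhds

theorem isOpen_OutSet {D : Set P2} (hD : IsClosed D) : IsOpen (OutSet D) := by
  rw [Metric.isOpen_iff]
  intro p hp
  obtain ⟨δ, hδ, hb⟩ := Metric.isOpen_iff.1 hD.isOpen_compl p (out_not_mem hp)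
  refine ⟨δ, hδ, fun q hq => ?_⟩
  exact out_of_joined (joinedIn_of_convex (convex_ball p δ) hb hq (Metric.mem_ball_self hδ)) hp

theorem isPathConnected_OutSet {D : Set P2} {R : ℝ} (hD : ∀ x ∈ D, ‖x‖ ≤ R) :
    IsPathConnected (OutSet D) := by
  have hne : ((|R| + 1, 0) : P2) ∈ OutSet D := by
    have hlt : R < ‖((|R| + 1, 0) : P2)‖ := by
      have h1 : ‖((|R| + 1, 0) : P2)‖ = |R| + 1 := by
        have := abs_nonneg R
        rw [Prod.norm_def]
        simp only [Real.norm_eq_abs, abs_zero]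
        rw [abs_of_nonneg (by linarith : 0 ≤ |R| + 1), max_eq_left (by linarith)]
      rw [h1]
      have := le_abs_self R
      linarith
    refine out_far hD hlt (JoinedIn.refl ?_)
    intro h
    have := hD _ h
    linarith
  refine ⟨_, hne, ?_⟩
  intro q hq
  obtain ⟨γ, hγ⟩ := out_joined hD hne hq
  refine ⟨γ, fun t => ?_⟩
  refine out_of_joined ?_ hq
  have hI : IsPathConnected (γ.extend '' Icc (0:ℝ) 1) :=
    ((convex_Icc (0:ℝ) 1).isPathConnected ⟨0, by simp⟩).image γ.continuous_extend
  have := hI.joinedIn (γ t) ⟨t, t.2, by simp⟩ q ⟨1, by simp, by simp⟩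
  refine this.mono ?_
  rintro _ ⟨s, hs, rfl⟩
  rw [Path.extend_apply _ hs]
  exact hγ _

/-- Coordinates on `Plane`. -/
noncomputable def coordE : Plane ≃L[ℝ] P2 :=
  (EuclideanSpace.equiv (Fin 2) ℝ).trans (ContinuousLinearEquiv.finTwoArrow ℝ ℝ)

theorem ori_eq_zero_of_collinear {p q r : Plane} (h : Collinear ℝ ({p, q, r} : Set Plane)) :
    ori (coordE p) (coordE q) (coordE r) = 0 := by
  rw [collinear_iff_of_mem (p₀ := p) (by simp)] at h
  obtain ⟨v, hv⟩ := h
  obtain ⟨a, ha⟩ := hv q (by simp)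
  obtain ⟨b, hb⟩ := hv r (by simp)
  have hq : coordE q = a • coordE v + coordE p := by rw [ha]; simp
  have hr : coordE r = b • coordE v + coordE p := by rw [hb]; simp
  rw [hq, hr]
  simp [ori]
  ring

theorem outside_of_good_gen {V : Type} [Finite V] (G : SimpleGraph V) {g : V → P2}
    (hinj : Function.Injective g)
    (hgen : ∀ u v w : V, u ≠ v → u ≠ w → v ≠ w → ori (g u) (g v) (g w) ≠ 0)
    (hacc : ∀ u v, u ≠ v → ¬ G.Adj u v → ∃ X ∈ segment ℝ (g u) (g v), X ∈ OutSet (Dr G univ g)) :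
    ∃ (f : V → Plane) (C : Set Plane), IsOutsideObstacleRep G f C := by
  set D := Dr G univ g with hDdef
  obtain ⟨R, hR⟩ : ∃ R, ∀ x ∈ D, ‖x‖ ≤ R := by
    obtain ⟨R, hR⟩ := (Set.finite_range (fun u => ‖g u‖)).bddAbove
    exact ⟨R, Dr_bound G univ (fun u _ => hR (mem_range_self u))⟩
  set F : V → Plane := fun v => coordE.symm (g v) with hF
  have hcF : ∀ v, coordE (F v) = g v := fun v => by simp [hF]
  have hseg : ∀ u v (p : Plane), p ∈ segment ℝ (F u) (F v) ↔ coordE p ∈ segment ℝ (g u) (g v) := by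
    intro u v p
    constructor
    · rintro ⟨a, b, ha, hb, hab, rfl⟩
      exact ⟨a, b, ha, hb, hab, by simp [hcF]⟩
    · rintro ⟨a, b, ha, hb, hab, h⟩
      refine ⟨a, b, ha, hb, hab, ?_⟩
      apply coordE.injective
      rw [← h]; simp [hcF]
  have hEU : ∀ p : Plane, p ∈ edgeUnion G F → coordE p ∈ D := by
    intro p hp
    simp only [edgeUnion, mem_iUnion] at hp
    obtain ⟨u, v, huv, hp⟩ := hp
    exact ⟨u, mem_univ _, v, mem_univ _, Or.inr huv, (hseg u v p).1 hp⟩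
  set C : Set Plane := coordE ⁻¹' (OutSet D) with hC
  have hCim : C = coordE.symm '' (OutSet D) := by
    rw [hC]; exact (coordE.symm.image_eq_preimage_symm (OutSet D)).symm
  refine ⟨F, C, ⟨?_, ?_, ?_, ?_, ?_, ?_⟩, ?_⟩
  · exact coordE.symm.injective.comp hinj
  · rintro _ ⟨u, rfl⟩ _ ⟨v, rfl⟩ _ ⟨w, rfl⟩ h1 h2 h3 hcol
    have := ori_eq_zero_of_collinear hcol
    rw [hcF, hcF, hcF] at this
    exact hgen u v w (fun h => h1 (h ▸ rfl)) (fun h => h2 (h ▸ rfl)) (fun h => h3 (h ▸ rfl)) this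
  · exact (isOpen_OutSet (isClosed_Dr G univ g)).preimage coordE.continuous
  · rw [hCim]
    exact ((isPathConnected_OutSet hR).image coordE.symm.continuous).isConnected
  · rw [Set.disjoint_left]
    rintro p hp ⟨v, rfl⟩
    have : coordE (F v) ∈ OutSet D := hp
    rw [hcF] at this
    exact out_not_mem this (mem_Dr_vertex (mem_univ v))
  · intro u v huv
    constructor
    · intro hadj
      rw [Set.disjoint_left]
      intro p hp hpC
      have : coordE p ∈ OutSet D := hpC
      exact (out_not_mem this) ⟨u, mem_univ _, v, mem_univ _, Or.inr hadj, (hseg u v p).1 hp⟩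
    · intro hdis
      by_contra hadj
      obtain ⟨X, hX, hXo⟩ := hacc u v huv hadj
      rw [Set.disjoint_left] at hdis
      refine hdis (a := coordE.symm X) ?_ ?_
      · rw [hseg]; simpa using hX
      · show coordE (coordE.symm X) ∈ OutSet D
        simpa using hXo
  · intro p hp
    have hpo : coordE p ∈ OutSet D := hp
    refine ⟨fun h => (out_not_mem hpo) (hEU p h), ?_⟩
    intro hb
    obtain ⟨M, hM⟩ := hb.exists_norm_le
    obtain ⟨q, hq, hj⟩ := hpo (‖(coordE : Plane →L[ℝ] P2)‖ * M)
    have hmem : coordE.symm q ∈ connectedComponentIn (edgeUnion G F)ᶜ p := by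
      obtain ⟨γ, hγ⟩ := hj
      have hpc : IsPreconnected (range fun t => coordE.symm (γ t)) :=
        isPreconnected_range (coordE.symm.continuous.comp γ.continuous)
      refine hpc.subset_connectedComponentIn ⟨0, by simp⟩ ?_ ⟨1, by simp⟩
      rintro _ ⟨t, rfl⟩ ht
      have := hEU _ ht
      simp only [ContinuousLinearEquiv.apply_symm_apply] at this
      exact hγ t this
    have h1 := hM _ hmem
    have h2 := (coordE : Plane →L[ℝ] P2).le_opNorm (coordE.symm q)
    have h3 : (coordE : Plane →L[ℝ] P2) (coordE.symm q) = q := by simp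
    rw [h3] at h2
    have := mul_le_mul_of_nonneg_left h1 (norm_nonneg (coordE : Plane →L[ℝ] P2))
    linarith

theorem outside_of_good {V : Type} [Finite V] (G : SimpleGraph V) {f : V → P2} {r : V}
    (h : GoodOn G univ r f) : ∃ (f : V → Plane) (C : Set Plane), IsOutsideObstacleRep G f C := by
  obtain ⟨n, ⟨e⟩⟩ := Finite.exists_equiv_fin V
  set k : V → ℝ := fun v => ((e v : ℕ) : ℝ) with hk
  have hkinj : ∀ u v, u ≠ v → k v - k u ≠ 0 := by
    intro u v huv h0
    apply huv
    have : ((e v : ℕ) : ℝ) = ((e u : ℕ) : ℝ) := by simp only [hk] at h0; linarith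
    have h1 : (e v : ℕ) = e u := by exact_mod_cast this
    exact (e.injective (Fin.ext h1)).symm
  set g : ℝ → V → P2 := fun ε v => f v + ε • ((k v, k v ^ 2) : P2) with hg
  have hgc : Continuous g := by
    apply continuous_pi; intro v; simp only [hg]; fun_prop
  have hg0 : g 0 = f := by ext v <;> simp [hg]
  have E1 : ∀ᶠ ε in 𝓝[>] (0:ℝ), ∀ u v, u ≠ v → g ε u ≠ g ε v := by
    rw [eventually_all]; intro u
    rw [eventually_all]; intro v
    by_cases huv : u = v
    · simp [huv]
    · have hc : Continuous fun ε => g ε u - g ε v := by simp only [hg]; fun_prop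
      have := (hc.continuousAt (x := 0)).eventually_ne (y := 0) (by
        rw [hg0, sub_ne_zero]
        exact fun h' => huv (h.inj (mem_univ _) (mem_univ _) h'))
      filter_upwards [this.filter_mono nhdsWithin_le_nhds] with ε hε _
      exact sub_ne_zero.1 hε
  have E2 : ∀ᶠ ε in 𝓝[>] (0:ℝ), ∀ u v w, u ≠ v → u ≠ w → v ≠ w → ori (g ε u) (g ε v) (g ε w) ≠ 0 := by
    rw [eventually_all]; intro u
    rw [eventually_all]; intro v
    rw [eventually_all]; intro w
    by_cases huv : u = v
    · simp [huv]
    by_cases huw : u = w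
    · simp [huw]
    by_cases hvw : v = w
    · simp [hvw]
    have hc : (k v - k u) * (k w - k u) * (k w - k v) ≠ 0 :=
      mul_ne_zero (mul_ne_zero (hkinj _ _ huv) (hkinj _ _ huw)) (hkinj _ _ hvw)
    have := quad_eventually_ne (a := ori (f u) (f v) (f w))
      (b := ((f v).1 - (f u).1) * (k w ^ 2 - k u ^ 2) + (k v - k u) * ((f w).2 - (f u).2)
        - ((f v).2 - (f u).2) * (k w - k u) - (k v ^ 2 - k u ^ 2) * ((f w).1 - (f u).1)) hc
    filter_upwards [this] with ε hε _ _ _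
    convert hε using 1
    simp [ori, hg]
    ring
  have E3 : ∀ᶠ ε in 𝓝[>] (0:ℝ), ∀ u v, u ≠ v → ¬ G.Adj u v →
      ∃ X ∈ segment ℝ (g ε u) (g ε v), X ∈ OutSet (Dr G univ (g ε)) := by
    rw [eventually_all]; intro u
    rw [eventually_all]; intro v
    by_cases huv : u = v
    · simp [huv]
    by_cases hadj : G.Adj u v
    · simp [hadj]
    obtain ⟨X, ⟨a, b, ha, hb, hab, rfl⟩, hXo⟩ := h.acc u (mem_univ _) v (mem_univ _) huv hadj
    have hc : Continuous fun ε => (g ε, a • g ε u + b • g ε v) := by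
      refine hgc.prodMk ?_
      simp only [hg]; fun_prop
    have ht : Tendsto (fun ε => (g ε, a • g ε u + b • g ε v)) (𝓝[>] 0) (𝓝 (f, a • f u + b • f v)) := by
      have := (hc.tendsto 0).mono_left (nhdsWithin_le_nhds (s := Ioi 0))
      simpa only [hg0] using this
    filter_upwards [ht.eventually (out_stable G univ hXo)] with ε hε _ _
    exact ⟨_, ⟨a, b, ha, hb, hab, rfl⟩, hε⟩
  obtain ⟨ε, h1, h2, h3⟩ := (E1.and (E2.and E3)).exists
  exact outside_of_good_gen G (g := g ε) (fun u v huv => by_contra fun hne => h1 u v hne huv) h2 h3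

end

section
set_option linter.unusedSectionVars false
set_option linter.unusedVariables false
open Set Filter Topology

theorem lin_coord (φ : P2 →ₗ[ℝ] ℝ) (p : P2) : φ p = p.1 * φ (1, 0) + p.2 * φ (0, 1) := by
  have : p = p.1 • ((1, 0) : P2) + p.2 • ((0, 1) : P2) := by ext <;> simp
  nth_rewrite 1 [this]
  rw [map_add, map_smul, map_smul, smul_eq_mul, smul_eq_mul]

/-- The linear functional with given coefficients. -/
noncomputable def linF (a b : ℝ) : P2 →ₗ[ℝ] ℝ :=
  a • LinearMap.fst ℝ ℝ ℝ + b • LinearMap.snd ℝ ℝ ℝ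

theorem linF_apply (a b : ℝ) (p : P2) : linF a b p = a * p.1 + b * p.2 := by
  simp [linF]

section
variable {V : Type} [Finite V] {G : SimpleGraph V} {S : Set V} {f : V → P2}

theorem local_access {φ : P2 →ₗ[ℝ] ℝ} {u v : V} (hu : u ∈ S) (hv : v ∈ S) (huv : u ≠ v)
    (hφ : ∀ x ∈ S, x ≠ u → φ (f u) < φ (f x)) {σ : ℝ}
    (hσ : σ ≠ 0) (h : ∀ w ∈ S, G.Adj u w → 0 < σ * ori (f u) (f v) (f w)) :
    ∃ X ∈ segment ℝ (f u) (f v), X ∈ OutSet (Dr G S f) := by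
  obtain ⟨m, hm0, hm⟩ : ∃ m > 0, ∀ x ∈ S, x ≠ u → m ≤ φ (f x) - φ (f u) := by
    have hfin : (S \ {u}).Finite := Set.toFinite _
    obtain ⟨x0, hx0, hmin⟩ := Set.exists_min_image (S \ {u}) (fun x => φ (f x) - φ (f u)) hfin
      ⟨v, hv, huv.symm⟩
    exact ⟨_, sub_pos.2 (hφ x0 hx0.1 hx0.2), fun x hx hxu => hmin x ⟨hx, hxu⟩⟩
  set H := φ (f v) - φ (f u) with hH
  have hHm : m ≤ H := hm v hv huv.symm
  have hHpos : 0 < H := by linarith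
  set η := m / (2 * H) with hη
  have hη0 : 0 < η := by positivity
  have hηH : η * H = m / 2 := by rw [hη]; field_simp
  have hη1 : η ≤ 1 := by
    rw [hη, div_le_one (by positivity)]; linarith
  set a := φ (1, 0) with ha
  set b := φ (0, 1) with hb
  have hco : ∀ p, φ p = p.1 * a + p.2 * b := lin_coord φ
  set X := f u + η • (f v - f u) with hX
  refine ⟨X, ?_, ?_⟩
  · rw [segment_eq_image']; exact ⟨η, ⟨hη0.le, hη1⟩, rfl⟩
  · have hab : ¬ (a = 0 ∧ b = 0) := by
      rintro ⟨h1, h2⟩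
      rw [hH, hco, hco, h1, h2] at hHpos
      simp at hHpos
    apply out_ray (d := ((σ * b, -(σ * a)) : P2))
    · intro h0
      rw [Prod.ext_iff] at h0
      simp only [Prod.fst_zero, Prod.snd_zero, neg_eq_zero, mul_eq_zero, hσ, false_or] at h0
      exact hab ⟨h0.2, h0.1⟩
    · intro s hs hmem
      set Y := X + s • ((σ * b, -(σ * a)) : P2) with hY
      have hY1 : Y.1 = (f u).1 + η * ((f v).1 - (f u).1) + s * (σ * b) := by simp [hY, hX]
      have hY2 : Y.2 = (f u).2 + η * ((f v).2 - (f u).2) - s * (σ * a) := by simp [hY, hX]; ring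
      have hφY : φ Y = φ (f u) + m / 2 := by
        rw [← hηH, hH, hco, hco, hco, hY1, hY2]; ring
      have horiY : σ * ori (f u) (f v) Y ≤ 0 := by
        have : σ * ori (f u) (f v) Y = - (σ ^ 2 * s * H) := by
          rw [hH, hco, hco, ori, hY1, hY2]; ring
        rw [this]
        have : 0 ≤ σ ^ 2 * s * H := by positivity
        linarith
      obtain ⟨x, hx, y, hy, hxy, α, β, hα, hβ, hαβ, hYeq⟩ := hmem
      have hφ2 : φ Y = α * φ (f x) + β * φ (f y) := by
        rw [← hYeq, map_add, map_smul, map_smul]; rfl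
      have hα' : α = 1 - β := by linarith
      -- one endpoint is `u`
      have key : ∀ (w : V) (t : ℝ), w ∈ S → G.Adj u w → 0 ≤ t → Y = f u + t • (f w - f u) → False := by
        intro w t hw hadj ht hYw
        have h1 : φ Y = φ (f u) + t * (φ (f w) - φ (f u)) := by
          rw [hYw, map_add, map_smul, map_sub]; rfl
        have h2 : 0 < φ (f w) - φ (f u) := sub_pos.2 (hφ w hw hadj.ne')
        have ht0 : 0 < t := by
          rcases ht.eq_or_lt with h0 | h0
          · rw [← h0] at h1; linarith
          · exact h0
        have h3 : σ * ori (f u) (f v) Y = t * (σ * ori (f u) (f v) (f w)) := by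
          rw [hYw]; simp [ori]; ring
        have := mul_pos ht0 (h w hw hadj)
        linarith
      by_cases hxu : x = u
      · by_cases hyu : y = u
        · rw [hxu, hyu, ← add_mul, hαβ] at hφ2
          linarith
        · rcases hxy with rfl | hadj
          · exact hyu hxu
          · subst hxu
            refine key y β hy hadj hβ ?_
            rw [← hYeq, hα']
            ext <;> simp <;> ring
      · by_cases hyu : y = u
        · rcases hxy with rfl | hadj
          · exact hxu hyu
          · subst hyu
            refine key x α hx hadj.symm hα ?_
            have hβ' : β = 1 - α := by linarith
            rw [← hYeq, hβ']
            ext <;> simp <;> ring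
        · have h1 := hm x hx hxu
          have h2 := hm y hy hyu
          have h3 := mul_le_mul_of_nonneg_left h1 hα
          have h4 := mul_le_mul_of_nonneg_left h2 hβ
          rw [hα'] at h3 hφ2
          nlinarith

theorem exposed_of_extreme {φ : P2 →ₗ[ℝ] ℝ} {u : V} 
    (hφ : ∀ x ∈ S, x ≠ u → φ (f u) < φ (f x)) {d : P2} (hd : φ d < 0) :
    ∃ c > 0, ∀ s : ℝ, 0 < s → s ≤ c → ∀ e : P2, ‖e - d‖ ≤ c → f u + s • e ∈ OutSet (Dr G S f) := by
  have hφc : Continuous φ := LinearMap.continuous_of_finiteDimensional φ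
  have h1 : ∀ᶠ e in 𝓝 d, φ e < 0 := hφc.continuousAt.eventually_lt continuousAt_const hd
  obtain ⟨δ, hδ, hb⟩ := Metric.nhds_basis_closedBall.mem_iff.1 h1
  refine ⟨δ, hδ, fun s hs _ e he => ?_⟩
  have he : φ e < 0 := hb (by simpa [dist_eq_norm] using he)
  apply out_ray (d := e)
  · rintro rfl
    simp at he
  · intro t ht hmem
    have h2 : φ (f u + s • e + t • e) < φ (f u) := by
      rw [map_add, map_add, map_smul, map_smul, smul_eq_mul, smul_eq_mul]
      nlinarith
    obtain ⟨x, hx, y, hy, hxy, α, β, hα, hβ, hαβ, hYeq⟩ := hmem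
    rw [← hYeq, map_add, map_smul, map_smul, smul_eq_mul, smul_eq_mul] at h2
    have hx' : φ (f u) ≤ φ (f x) := by
      by_cases h : x = u
      · rw [h]
      · exact (hφ x hx h).le
    have hy' : φ (f u) ≤ φ (f y) := by
      by_cases h : y = u
      · rw [h]
      · exact (hφ y hy h).le
    have hα' : α = 1 - β := by linarith
    have h3 := mul_le_mul_of_nonneg_left hx' hα
    have h4 := mul_le_mul_of_nonneg_left hy' hβ
    rw [hα'] at h3 h2
    nlinarith

/-- Convex position lemma. -/
theorem goodOn_parabola {θ : V → ℝ} (hinj : InjOn θ S)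
    (hacc : ∀ u ∈ S, ∀ v ∈ S, u ≠ v → ¬ G.Adj u v →
      (∃ σ : ℝ, σ ≠ 0 ∧ ∀ w ∈ S, G.Adj u w → 0 < σ * ((θ v - θ u) * (θ w - θ u) * (θ w - θ v))) ∨
      (∃ σ : ℝ, σ ≠ 0 ∧ ∀ w ∈ S, G.Adj v w → 0 < σ * ((θ u - θ v) * (θ w - θ v) * (θ w - θ u))))
    {r : V} (hr : r ∈ S) :
    ∃ f, GoodOn G S r f := by
  set f : V → P2 := fun v => (θ v, θ v ^ 2) with hf
  have hori : ∀ u v w, ori (f u) (f v) (f w) = (θ v - θ u) * (θ w - θ u) * (θ w - θ v) := by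
    intro u v w; simp [ori, hf]; ring
  have hext : ∀ u ∈ S, ∀ x ∈ S, x ≠ u → linF (-2 * θ u) 1 (f u) < linF (-2 * θ u) 1 (f x) := by
    intro u hu x hx hxu
    have h1 : θ x - θ u ≠ 0 := sub_ne_zero.2 fun h => hxu (hinj hx hu h)
    have h2 := sq_pos_of_ne_zero h1
    simp only [linF_apply, hf]
    nlinarith
  refine ⟨f, ?_, ?_, ?_, ?_⟩
  · intro x hx y hy hxy
    exact hinj hx hy (Prod.ext_iff.1 hxy).1
  · intro u hu v hv huv hadj
    rcases hacc u hu v hv huv hadj with ⟨σ, hσ, h⟩ | ⟨σ, hσ, h⟩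
    · exact local_access hu hv huv (hext u hu) hσ (fun w hw hw' => by rw [hori]; exact h w hw hw')
    · rw [segment_symm]
      exact local_access hv hu huv.symm (hext v hv) hσ (fun w hw hw' => by rw [hori]; exact h w hw hw')
  · intro v hv
    obtain ⟨c, hc, h⟩ := exposed_of_extreme (G := G) (hext v hv) (d := (0, -1)) (by simp [linF_apply])
    exact ⟨_, c, hc, h⟩
  · exact ⟨_, hext r hr⟩

/-- Convex position with one vertex pushed inside. -/
theorem goodOn_push {θ : V → ℝ} {z e : V} (hz : z ∈ S) (he : e ∈ S) (hze : z ≠ e)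
    (hinj : InjOn θ (S \ {z})) (hθe : θ e = -1)
    (hθ : ∀ x ∈ S, x ≠ z → x ≠ e → (1/2 ≤ θ x ∧ θ x < 1 ∧ ¬ G.Adj e x) ∨ 3 ≤ θ x)
    (hacc : ∀ u ∈ S, ∀ v ∈ S, u ≠ v → ¬ G.Adj u v → ∀ f : V → P2, f z = (0, 2) →
      (∀ x, x ≠ z → f x = (θ x, θ x ^ 2)) →
      (u ≠ z ∧ ∃ σ : ℝ, σ ≠ 0 ∧ ∀ w ∈ S, G.Adj u w → 0 < σ * ori (f u) (f v) (f w)) ∨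
      (v ≠ z ∧ ∃ σ : ℝ, σ ≠ 0 ∧ ∀ w ∈ S, G.Adj v w → 0 < σ * ori (f v) (f u) (f w)))
    {r : V} (hr : r ∈ S) (hrz : r ≠ z) :
    ∃ f, GoodOn G S r f := by
  classical
  set f : V → P2 := fun v => if v = z then (0, 2) else (θ v, θ v ^ 2) with hf
  have hfz : f z = (0, 2) := by simp [hf]
  have hfx : ∀ x, x ≠ z → f x = (θ x, θ x ^ 2) := fun x hx => by simp [hf, hx]
  have hext : ∀ u ∈ S, u ≠ z → ∀ x ∈ S, x ≠ u →
      linF (-2 * θ u) 1 (f u) < linF (-2 * θ u) 1 (f x) := by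
    intro u hu huz x hx hxu
    by_cases hxz : x = z
    · rw [hxz, hfz, hfx u huz]
      simp only [linF_apply]
      nlinarith [sq_nonneg (θ u)]
    · have h1 : θ x - θ u ≠ 0 := sub_ne_zero.2 fun h => hxu (hinj ⟨hx, hxz⟩ ⟨hu, huz⟩ h)
      have h2 := sq_pos_of_ne_zero h1
      rw [hfx u huz, hfx x hxz]
      simp only [linF_apply]
      nlinarith
  refine ⟨f, ?_, ?_, ?_, ?_⟩
  · intro x hx y hy hxy
    by_contra hne
    by_cases hxz : x = z
    · have := hext y hy (fun h => hne (hxz.trans h.symm)) x hx hne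
      rw [hxy] at this
      exact lt_irrefl _ this
    · have := hext x hx hxz y hy (Ne.symm hne)
      rw [hxy] at this
      exact lt_irrefl _ this
  · intro u hu v hv huv hadj
    rcases hacc u hu v hv huv hadj f hfz hfx with ⟨huz, σ, hσ, h⟩ | ⟨hvz, σ, hσ, h⟩
    · exact local_access hu hv huv (hext u hu huz) hσ h
    · rw [segment_symm]
      exact local_access hv hu huv.symm (hext v hv hvz) hσ h
  · intro v hv
    by_cases hvz : v = z
    · subst hvz
      -- every drawing point below height 2 is outside the cone
      have hcone : ∀ p ∈ Dr G S f, p.2 < 2 → (2 - p.2) / 4 < |p.1| := by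
        have hfe : f e = (-1, 1) := by rw [hfx e hze.symm, hθe]; norm_num
        have half : ∀ x ∈ S, ∀ y ∈ S, (x = y ∨ G.Adj x y) → 
            (x = v ∨ (x = e ∧ y ≠ v) ∨ (x ≠ v ∧ x ≠ e ∧ y ≠ v ∧ y ≠ e)) →
            ∀ p ∈ segment ℝ (f x) (f y), p.2 < 2 → (2 - p.2) / 4 < |p.1| := by
          rintro x hx y hy hxy hcase p ⟨α, β, hα, hβ, hαβ, rfl⟩ hp
          have hα' : α = 1 - β := by linarith
          subst hα'
          rcases hcase with rfl | ⟨rfl, hyv⟩ | ⟨hxv, hxe, hyv, hye⟩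
          · rw [hfz] at hp ⊢
            by_cases hyx : y = x
            · rw [hyx, hfz] at hp
              simp at hp
              linarith
            · by_cases hye : y = e
              · rw [hye, hfe] at hp ⊢
                simp at hp ⊢
                rw [abs_of_nonneg hβ]
                linarith
              · rw [hfx y hyx] at hp ⊢
                simp at hp ⊢
                rcases hθ y hy hyx hye with ⟨h1, h2, -⟩ | h1
                · rw [abs_of_nonneg (by positivity), abs_of_nonneg (by linarith)]
                  have hβ0 : 0 < β := by
                    rcases hβ.eq_or_lt with h0 | h0
                    · rw [← h0] at hp; linarith
                    · exact h0
                  have : 0 < β * (4 * θ y + θ y ^ 2 - 2) := by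
                    apply mul_pos hβ0; nlinarith
                  linarith
                · exfalso
                  nlinarith [mul_nonneg hβ (by nlinarith : (0:ℝ) ≤ θ y ^ 2 - 2)]
          · by_cases hye : y = x
            · rw [hye, hfe] at hp ⊢
              simp at hp ⊢
              rw [show β - 1 + -β = (-1:ℝ) by ring]
              norm_num
            · have hadj : G.Adj x y := hxy.resolve_left (fun h => hye h.symm)
              rcases hθ y hy hyv hye with ⟨h1, h2, h3⟩ | h1
              · exact absurd hadj h3
              · rw [hfe, hfx y hyv] at hp ⊢
                simp at hp ⊢
                rw [lt_abs]
                right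
                have hβ' : β * (θ y ^ 2 - 1) < 1 := by linarith
                have hβ2 : β * (θ y + 1) < 1/2 := by
                  nlinarith [mul_nonneg hβ (by nlinarith : (0:ℝ) ≤ (θ y + 1) * (θ y - 3))]
                nlinarith [mul_nonneg hβ (by nlinarith : (0:ℝ) ≤ θ y ^ 2 - 1)]
          · have hx1 : 1/2 ≤ θ x := by
              rcases hθ x hx hxv hxe with ⟨h1, _, _⟩ | h1 <;> linarith
            have hy1 : 1/2 ≤ θ y := by
              rcases hθ y hy hyv hye with ⟨h1, _, _⟩ | h1 <;> linarith
            rw [hfx x hxv, hfx y hyv] at hp ⊢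
            simp at hp ⊢
            rw [lt_abs]
            left
            have h1 : (0:ℝ) ≤ 1 - β := hα
            have h2 : 1/4 ≤ θ x ^ 2 := by nlinarith
            have h3 : 1/4 ≤ θ y ^ 2 := by nlinarith
            nlinarith
        rintro p ⟨x, hx, y, hy, hxy, hp⟩ hp2
        by_cases hxv : x = v
        · exact half x hx y hy hxy (Or.inl hxv) p hp hp2
        by_cases hyv : y = v
        · rw [segment_symm] at hp
          exact half y hy x hx (hxy.imp Eq.symm G.adj_symm) (Or.inl hyv) p hp hp2
        by_cases hxe : x = e
        · exact half x hx y hy hxy (Or.inr (Or.inl ⟨hxe, hyv⟩)) p hp hp2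
        by_cases hye : y = e
        · rw [segment_symm] at hp
          exact half y hy x hx (hxy.imp Eq.symm G.adj_symm) (Or.inr (Or.inl ⟨hye, hxv⟩)) p hp hp2
        exact half x hx y hy hxy (Or.inr (Or.inr ⟨hxv, hxe, hyv, hye⟩)) p hp hp2
      refine ⟨(0, -1), 1/8, by norm_num, fun s hs _ e' he' => ?_⟩
      have he1 : |e'.1| ≤ 1/8 := by
        have := (norm_fst_le (e' - ((0, -1) : P2))).trans he'
        simpa using this
      have he2 : |e'.2 + 1| ≤ 1/8 := by
        have := (norm_snd_le (e' - ((0, -1) : P2))).trans he'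
        simpa using this
      have he2' := (abs_le.1 he2).2
      apply out_ray (d := (0, -1)) (by simp)
      intro t ht hmem
      have := hcone _ hmem (by rw [hfz]; simp; nlinarith)
      rw [hfz] at this
      simp at this
      rw [abs_of_pos hs] at this
      nlinarith
    · obtain ⟨c, hc, h⟩ := exposed_of_extreme (G := G) (hext v hv hvz) (d := (0, -1)) (by simp [linF_apply])
      exact ⟨_, c, hc, h⟩
  · exact ⟨_, hext r hr hrz⟩
end

end

section
set_option linter.unusedSectionVars false
set_option linter.unusedVariables false
open Set Filter Topology

/-- Orientation sign of positions on a convex curve. -/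
def sgZ (p q w : ℤ) : ℤ := (q - p) * (w - p) * (w - q)

/-- Orientation sign after pushing position 1 across the chord of positions 0 and 2. -/
def sgP (p q w : ℤ) : ℤ := if p ≤ 2 ∧ q ≤ 2 ∧ w ≤ 2 then - sgZ p q w else sgZ p q w

/-- All core neighbours of `p` lie on the same side of the line `p q`. -/
def oneSided {m : ℕ} (M : Fin m → Fin m → Bool) (sg : ℤ → ℤ → ℤ → ℤ) (pos : Fin m → ℤ)
    (p q : Fin m) : Prop :=
  (∀ w, M p w = true → 0 < sg (pos p) (pos q) (pos w)) ∨
  (∀ w, M p w = true → sg (pos p) (pos q) (pos w) < 0)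

instance {m : ℕ} (M : Fin m → Fin m → Bool) (sg : ℤ → ℤ → ℤ → ℤ) (pos : Fin m → ℤ)
    (p q : Fin m) : Decidable (oneSided M sg pos p q) := by
  unfold oneSided; infer_instance

def okL {m : ℕ} (M : Fin m → Fin m → Bool) (pos : Fin m → ℤ) : Prop :=
  (∀ p q, pos p = pos q → p = q) ∧ (∀ p, M p p = false) ∧ 
  ∀ p q, p ≠ q → M p q = false → oneSided M sgZ pos p q ∨ oneSided M sgZ pos q p

instance {m : ℕ} (M : Fin m → Fin m → Bool) (pos : Fin m → ℤ) : Decidable (okL M pos) := by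
  unfold okL; infer_instance

def okP {m : ℕ} (M : Fin m → Fin m → Bool) (pos : Fin m → ℤ) : Prop :=
  (∀ p q, pos p = pos q → p = q) ∧ (∀ p, 0 ≤ pos p) ∧ (∀ p, M p p = false) ∧
  (∀ p q, pos p = 0 → pos q = 2 → M p q = false) ∧
  ∀ p q, p ≠ q → M p q = false →
    (pos p ≠ 1 ∧ oneSided M sgP pos p q) ∨ (pos q ≠ 1 ∧ oneSided M sgP pos q p)

instance {m : ℕ} (M : Fin m → Fin m → Bool) (pos : Fin m → ℤ) : Decidable (okP M pos) := by
  unfold okP; infer_instance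

theorem exists_tie (V : Type) [Finite V] :
    ∃ t : V → ℝ, Function.Injective t ∧ ∀ v, 0 ≤ t v ∧ t v < 1 := by
  obtain ⟨n, ⟨e⟩⟩ := Finite.exists_equiv_fin V
  refine ⟨fun v => ((e v : ℕ) : ℝ) / n, ?_, ?_⟩
  · intro u v huv
    have hn : (0 : ℝ) < n := by
      have := (e u).pos
      exact_mod_cast this
    have h1 : ((e u : ℕ) : ℝ) = ((e v : ℕ) : ℝ) := by
      have := huv
      simp only at this
      field_simp at this
      exact this
    exact e.injective (Fin.ext (by exact_mod_cast h1))
  · intro v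
    have hn : (0 : ℝ) < n := by
      have := (e v).pos
      exact_mod_cast this
    refine ⟨by positivity, ?_⟩
    rw [div_lt_one hn]
    exact_mod_cast (e v).2

theorem ratio_pos {x y : ℝ} {i j : ℤ} (h1 : i < j → x < y) (h2 : j < i → y < x) (hij : i ≠ j) :
    ∃ κ > 0, y - x = κ * ((j : ℝ) - i) := by
  rcases lt_or_gt_of_ne hij with h | h
  · have hh : (i : ℝ) < j := by exact_mod_cast h
    have := h1 h
    exact ⟨(y - x) / (j - i), div_pos (by linarith) (by linarith), by
      rw [div_mul_cancel₀]; linarith⟩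
  · have hh : (j : ℝ) < i := by exact_mod_cast h
    have := h2 h
    exact ⟨(y - x) / (j - i), div_pos_of_neg_of_neg (by linarith) (by linarith), by
      rw [div_mul_cancel₀]; linarith⟩

section
variable {V : Type} [Finite V] {G : SimpleGraph V} {S : Set V} {m : ℕ}

theorem coreL (M : Fin m → Fin m → Bool) (pos : Fin m → ℤ) (hok : okL M pos) (τ : V → Fin m)
    (hadj : ∀ u ∈ S, ∀ v ∈ S, G.Adj u v ↔ M (τ u) (τ v) = true) {r : V} (hr : r ∈ S) :
    ∃ f, GoodOn G S r f := by
  obtain ⟨hpos, hirr, hos⟩ := hok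
  obtain ⟨t, htinj, ht⟩ := exists_tie V
  set θ : V → ℝ := fun v => (pos (τ v) : ℝ) + t v with hθ
  have hmono : ∀ u v, pos (τ u) < pos (τ v) → θ u < θ v := by
    intro u v h
    have : (pos (τ u) : ℝ) + 1 ≤ pos (τ v) := by exact_mod_cast h
    have h1 := (ht u).2
    have h2 := (ht v).1
    simp only [hθ]; linarith
  have hinj : Function.Injective θ := by
    intro u v h
    rcases lt_trichotomy (pos (τ u)) (pos (τ v)) with h1 | h1 | h1
    · exact absurd h (hmono u v h1).ne
    · apply htinj
      simp only [hθ, h1] at h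
      linarith
    · exact absurd h (hmono v u h1).ne'
  have hκ : ∀ u v, τ u ≠ τ v → ∃ κ > 0, θ v - θ u = κ * ((pos (τ v) : ℝ) - pos (τ u)) := 
    fun u v h => ratio_pos (hmono u v) (hmono v u) (fun h' => h (hpos _ _ h'))
  have hone : ∀ u ∈ S, ∀ v ∈ S, ¬ G.Adj u v → τ u ≠ τ v → oneSided M sgZ pos (τ u) (τ v) →
      ∃ σ : ℝ, σ ≠ 0 ∧ ∀ w ∈ S, G.Adj u w → 0 < σ * ((θ v - θ u) * (θ w - θ u) * (θ w - θ v)) := by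
    intro u hu v hv huv hne hh
    have hk : ∀ w ∈ S, G.Adj u w → ∃ κ > 0, (θ v - θ u) * (θ w - θ u) * (θ w - θ v) =
        κ * (sgZ (pos (τ u)) (pos (τ v)) (pos (τ w)) : ℝ) := by
      intro w hw hadjw
      have hM := (hadj u hu w hw).1 hadjw
      have hne1 : τ u ≠ τ w := by intro h; rw [← h, hirr] at hM; simp at hM
      have hne2 : τ v ≠ τ w := by
        intro h
        exact huv ((hadj u hu v hv).2 (by rw [h]; exact hM))
      obtain ⟨κ1, h1, e1⟩ := hκ u v hne
      obtain ⟨κ2, h2, e2⟩ := hκ u w hne1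
      obtain ⟨κ3, h3, e3⟩ := hκ v w hne2
      refine ⟨κ1 * κ2 * κ3, by positivity, ?_⟩
      rw [e1, e2, e3, sgZ]; push_cast; ring
    rcases hh with hh | hh
    · refine ⟨1, one_ne_zero, fun w hw hadjw => ?_⟩
      obtain ⟨κ, hκ0, he⟩ := hk w hw hadjw
      have : (0:ℝ) < sgZ (pos (τ u)) (pos (τ v)) (pos (τ w)) := by
        exact_mod_cast hh _ ((hadj u hu w hw).1 hadjw)
      rw [he]; positivity
    · refine ⟨-1, by norm_num, fun w hw hadjw => ?_⟩
      obtain ⟨κ, hκ0, he⟩ := hk w hw hadjw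
      have : (sgZ (pos (τ u)) (pos (τ v)) (pos (τ w)) : ℝ) < 0 := by
        exact_mod_cast hh _ ((hadj u hu w hw).1 hadjw)
      rw [he]; nlinarith
  refine goodOn_parabola hinj.injOn ?_ hr
  intro u hu v hv huv hnadj
  by_cases hτ : τ u = τ v
  · left
    refine ⟨θ v - θ u, sub_ne_zero.2 fun h => huv (hinj h).symm, ?_⟩
    intro w hw hadjw
    have hM := (hadj u hu w hw).1 hadjw
    have hne1 : τ u ≠ τ w := by intro h; rw [← h, hirr] at hM; simp at hM
    obtain ⟨κ2, h2, e2⟩ := hκ u w hne1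
    obtain ⟨κ3, h3, e3⟩ := hκ v w (hτ ▸ hne1)
    have h0 : θ v - θ u ≠ 0 := sub_ne_zero.2 fun h => huv (hinj h).symm
    have h1 : (pos (τ w) : ℝ) - pos (τ u) ≠ 0 := by
      rw [sub_ne_zero]; intro h; exact hne1 (hpos _ _ (by exact_mod_cast h.symm))
    rw [e2, e3, ← hτ]
    have : (θ v - θ u) * ((θ v - θ u) * (κ2 * (↑(pos (τ w)) - ↑(pos (τ u)))) *
      (κ3 * (↑(pos (τ w)) - ↑(pos (τ u))))) =
      (θ v - θ u) ^ 2 * κ2 * κ3 * ((pos (τ w) : ℝ) - pos (τ u)) ^ 2 := by ring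
    rw [this]
    positivity
  · have hM : M (τ u) (τ v) = false := by
      by_contra h
      exact hnadj ((hadj u hu v hv).2 (by simpa using h))
    rcases hos _ _ hτ hM with h | h
    · exact Or.inl (hone u hu v hv hnadj hτ h)
    · exact Or.inr (hone v hv u hu (fun h => hnadj h.symm) (Ne.symm hτ) h)

theorem sgP_neg_swap (i j k : ℤ) : sgP i k j = - sgP i j k := by
  unfold sgP sgZ
  split_ifs with h1 h2 h2
  · ring
  · exact absurd ⟨h1.1, h1.2.2, h1.2.1⟩ h2
  · exact absurd ⟨h2.1, h2.2.2, h2.2.1⟩ h1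
  · ring

theorem push_sign {x y : ℝ} {i k : ℤ} (hi0 : 0 ≤ i) (hk0 : 0 ≤ k) (hi1 : i ≠ 1) (hk1 : k ≠ 1)
    (hik : i ≠ k) (hxy : i < k → x < y) (hyx : k < i → y < x)
    (hx : (i = 0 → x = -1) ∧ (i = 2 → 1/2 ≤ x ∧ x < 1) ∧ (3 ≤ i → 3 ≤ x))
    (hy : (k = 0 → y = -1) ∧ (k = 2 → 1/2 ≤ y ∧ y < 1) ∧ (3 ≤ k → 3 ≤ y)) :
    0 < (x - y) * (y * x + 2) * (sgP i 1 k : ℝ) := by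
  have hi : i = 0 ∨ i = 2 ∨ 3 ≤ i := by omega
  have hk : k = 0 ∨ k = 2 ∨ 3 ≤ k := by omega
  have big : 2 ≤ i → 2 ≤ k → 0 < x → 0 < y → 3 ≤ i ∨ 3 ≤ k → 0 < (x - y) * (y * x + 2) * (sgP i 1 k : ℝ) := by
    intro h1 h2 h3 h4 h5
    have hs : sgP i 1 k = sgZ i 1 k := by
      unfold sgP; rw [if_neg]; omega
    rw [hs, sgZ]
    have hi' : (2:ℝ) ≤ i := by exact_mod_cast h1
    have hk' : (2:ℝ) ≤ k := by exact_mod_cast h2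
    push_cast
    have hpos : 0 < (y * x + 2) * (((i:ℝ) - 1) * (k - 1)) := by
      apply mul_pos (by positivity)
      apply mul_pos <;> linarith
    have hxk : 0 < (x - y) * ((i:ℝ) - k) := by
      rcases lt_or_gt_of_ne hik with h | h
      · have h' : (i:ℝ) < k := by exact_mod_cast h
        exact mul_pos_of_neg_of_neg (by linarith [hxy h]) (by linarith)
      · have h' : (k:ℝ) < i := by exact_mod_cast h
        exact mul_pos (by linarith [hyx h]) (by linarith)
    have := mul_pos hpos hxk
    nlinarith
  rcases hi with rfl | rfl | hi
  · rcases hk with rfl | rfl | hk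
    · exact absurd rfl hik
    · obtain ⟨h1, h2⟩ := hy.2.1 rfl
      have h3 := hx.1 rfl
      norm_num [sgP, sgZ]
      rw [h3]; nlinarith
    · have h2 := hy.2.2 hk
      have h3 := hx.1 rfl
      have hs : sgP 0 1 k = sgZ 0 1 k := by unfold sgP; rw [if_neg]; omega
      rw [hs, sgZ, h3]
      push_cast
      have hk' : (3:ℝ) ≤ k := by exact_mod_cast hk
      have : 0 < (k:ℝ) * (k - 1) := mul_pos (by linarith) (by linarith)
      have h5 : 0 < (-1 - y) * (y * -1 + 2) := mul_pos_of_neg_of_neg (by linarith) (by linarith)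
      nlinarith [mul_pos h5 this]
  · rcases hk with rfl | rfl | hk
    · obtain ⟨h1, h2⟩ := hx.2.1 rfl
      have h3 := hy.1 rfl
      norm_num [sgP, sgZ]
      rw [h3]; nlinarith
    · exact absurd rfl hik
    · obtain ⟨h1, h2⟩ := hx.2.1 rfl
      have h3 := hy.2.2 hk
      exact big le_rfl (by omega) (by linarith) (by linarith) (Or.inr hk)
  · have hx3 := hx.2.2 hi
    rcases hk with rfl | rfl | hk
    · have h3 := hy.1 rfl
      have hs : sgP i 1 0 = sgZ i 1 0 := by unfold sgP; rw [if_neg]; omega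
      rw [hs, sgZ, h3]
      push_cast
      have hk' : (3:ℝ) ≤ i := by exact_mod_cast hi
      have : 0 < (i:ℝ) * (i - 1) := mul_pos (by linarith) (by linarith)
      have h5 : 0 < (x + 1) * (x - 2) := mul_pos (by linarith) (by linarith)
      nlinarith [mul_pos h5 this]
    · obtain ⟨h1, h2⟩ := hy.2.1 rfl
      exact big (by omega) le_rfl (by linarith) (by linarith) (Or.inl hi)
    · have h3 := hy.2.2 hk
      exact big (by omega) (by omega) (by linarith) (by linarith) (Or.inl hi)

theorem corePush (M : Fin m → Fin m → Bool) (pos : Fin m → ℤ) (hok : okP M pos) (τ : V → Fin m)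
    (hadj : ∀ u ∈ S, ∀ v ∈ S, G.Adj u v ↔ M (τ u) (τ v) = true) {z e : V} (hz : z ∈ S) (he : e ∈ S)
    (hz1 : pos (τ z) = 1) (he0 : pos (τ e) = 0)
    (hzu : ∀ x ∈ S, pos (τ x) = 1 → x = z) (heu : ∀ x ∈ S, pos (τ x) = 0 → x = e)
    {r : V} (hr : r ∈ S) (hrz : r ≠ z) :
    ∃ f, GoodOn G S r f := by
  obtain ⟨hpos, hnn, hirr, h02, hos⟩ := hok
  obtain ⟨t, htinj, ht⟩ := exists_tie V
  set θ : V → ℝ := fun v => if pos (τ v) = 0 then -1 else if pos (τ v) = 1 then 0 else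
    if pos (τ v) = 2 then 1/2 + t v / 2 else (pos (τ v) : ℝ) + t v with hθ
  have hT0 : ∀ v, pos (τ v) = 0 → θ v = -1 := by intro v h; simp [hθ, h]
  have hT2 : ∀ v, pos (τ v) = 2 → θ v = 1/2 + t v / 2 := by intro v h; simp [hθ, h]
  have hT3 : ∀ v, 3 ≤ pos (τ v) → θ v = (pos (τ v) : ℝ) + t v := by
    intro v h
    have h1 : pos (τ v) ≠ 0 := by omega
    have h2 : pos (τ v) ≠ 1 := by omega
    have h3 : pos (τ v) ≠ 2 := by omega
    simp [hθ, h1, h2, h3]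
  have hrange : ∀ v, (pos (τ v) = 0 → θ v = -1) ∧ (pos (τ v) = 2 → 1/2 ≤ θ v ∧ θ v < 1) ∧
      (3 ≤ pos (τ v) → 3 ≤ θ v) := by
    intro v
    obtain ⟨h1, h2⟩ := ht v
    refine ⟨hT0 v, fun h => ?_, fun h => ?_⟩
    · rw [hT2 v h]; constructor <;> linarith
    · rw [hT3 v h]
      have : (3:ℝ) ≤ pos (τ v) := by exact_mod_cast h
      linarith
  have hmono : ∀ u v, pos (τ u) ≠ 1 → pos (τ v) ≠ 1 → pos (τ u) < pos (τ v) → θ u < θ v := by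
    intro u v hu hv h
    have hu0 := hnn (τ u)
    have hv3 : pos (τ v) = 2 ∨ 3 ≤ pos (τ v) := by omega
    have hu3 : pos (τ u) = 0 ∨ pos (τ u) = 2 ∨ 3 ≤ pos (τ u) := by omega
    obtain ⟨a1, a2, a3⟩ := hrange u
    obtain ⟨b1, b2, b3⟩ := hrange v
    rcases hu3 with h1 | h1 | h1
    · rw [a1 h1]
      rcases hv3 with h2 | h2
      · linarith [(b2 h2).1]
      · linarith [b3 h2]
    · rcases hv3 with h2 | h2
      · omega
      · linarith [b3 h2, (a2 h1).2]
    · rw [hT3 u h1, hT3 v (by omega)]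
      have : (pos (τ u) : ℝ) + 1 ≤ pos (τ v) := by exact_mod_cast h
      linarith [(ht u).2, (ht v).1]
  have hp1 : ∀ x ∈ S, x ≠ z → pos (τ x) ≠ 1 := fun x hx hxz h => hxz (hzu x hx h)
  have hinj : InjOn θ (S \ {z}) := by
    rintro u ⟨hu, huz⟩ v ⟨hv, hvz⟩ h
    have hu1 := hp1 u hu huz
    have hv1 := hp1 v hv hvz
    rcases lt_trichotomy (pos (τ u)) (pos (τ v)) with h1 | h1 | h1
    · exact absurd h (hmono u v hu1 hv1 h1).ne
    · have hu0 := hnn (τ u)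
      have hu3 : pos (τ u) = 0 ∨ pos (τ u) = 2 ∨ 3 ≤ pos (τ u) := by omega
      rcases hu3 with h2 | h2 | h2
      · rw [heu u hu h2, heu v hv (h1 ▸ h2)]
      · rw [hT2 u h2, hT2 v (h1 ▸ h2)] at h
        exact htinj (by linarith)
      · rw [hT3 u h2, hT3 v (h1 ▸ h2), h1] at h
        exact htinj (by linarith)
    · exact absurd h (hmono v u hv1 hu1 h1).ne'
  have hze : z ≠ e := by rintro rfl; omega
  refine goodOn_push hz he hze hinj (hT0 e he0) ?_ ?_ hr hrz
  · intro x hx hxz hxe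
    have h1 := hp1 x hx hxz
    have h0 : pos (τ x) ≠ 0 := fun h => hxe (heu x hx h)
    have hu0 := hnn (τ x)
    have hu3 : pos (τ x) = 2 ∨ 3 ≤ pos (τ x) := by omega
    obtain ⟨a1, a2, a3⟩ := hrange x
    rcases hu3 with h2 | h2
    · left
      refine ⟨(a2 h2).1, (a2 h2).2, fun h => ?_⟩
      have := (hadj e he x hx).1 h
      rw [h02 _ _ he0 h2] at this
      simp at this
    · exact Or.inr (a3 h2)
  · intro u hu v hv huv hnadj f hfz hfx
    have horiz1 : ∀ u v : V, u ≠ z → v ≠ z →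
        ori (f u) (f z) (f v) = (θ u - θ v) * (θ v * θ u + 2) := by
      intro u v hu hv; rw [hfx u hu, hfx v hv, hfz]; simp [ori]; ring
    have horiz2 : ∀ u v w : V, ori (f u) (f w) (f v) = - ori (f u) (f v) (f w) := by
      intro u v w; simp only [ori]; ring
    have hori : ∀ u v w : V, u ≠ z → v ≠ z → w ≠ z → 
        ori (f u) (f v) (f w) = (θ v - θ u) * (θ w - θ u) * (θ w - θ v) := by
      intro u v w hu hv hw; rw [hfx u hu, hfx v hv, hfx w hw]; simp [ori]; ring
    have hκ : ∀ u ∈ S, ∀ v ∈ S, u ≠ z → v ≠ z → τ u ≠ τ v →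
        ∃ κ > 0, θ v - θ u = κ * ((pos (τ v) : ℝ) - pos (τ u)) := 
      fun u hu v hv huz hvz h => ratio_pos (hmono u v (hp1 u hu huz) (hp1 v hv hvz))
        (hmono v u (hp1 v hv hvz) (hp1 u hu huz)) (fun h' => h (hpos _ _ h'))
    -- sign agreement when one of the points is the pushed one
    have hsz : ∀ u ∈ S, ∀ v ∈ S, u ≠ z → v ≠ z → τ u ≠ τ v →
        0 < ori (f u) (f z) (f v) * (sgP (pos (τ u)) (pos (τ z)) (pos (τ v)) : ℝ) := by
      intro u hu v hv huz hvz hne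
      rw [horiz1 u v huz hvz, hz1]
      exact push_sign (hnn _) (hnn _) (hp1 u hu huz) (hp1 v hv hvz) (fun h' => hne (hpos _ _ h'))
        (hmono u v (hp1 u hu huz) (hp1 v hv hvz)) (hmono v u (hp1 v hv hvz) (hp1 u hu huz))
        (hrange u) (hrange v)
    have hs : ∀ u ∈ S, ∀ v ∈ S, ∀ w ∈ S, u ≠ z → τ u ≠ τ v → τ u ≠ τ w → τ v ≠ τ w →
        0 < ori (f u) (f v) (f w) * (sgP (pos (τ u)) (pos (τ v)) (pos (τ w)) : ℝ) := by
      intro u hu v hv w hw huz h1 h2 h3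
      by_cases hvz : v = z
      · rw [hvz] at h3 ⊢
        exact hsz u hu w hw huz (fun h => h3 (by rw [h])) h2
      by_cases hwz : w = z
      · rw [hwz, horiz2, sgP_neg_swap]
        have := hsz u hu v hv huz hvz h1
        push_cast
        rw [neg_mul_neg]
        exact this
      obtain ⟨κ1, k1, e1⟩ := hκ u hu v hv huz hvz h1
      obtain ⟨κ2, k2, e2⟩ := hκ u hu w hw huz hwz h2
      obtain ⟨κ3, k3, e3⟩ := hκ v hv w hw hvz hwz h3
      have hi := hp1 u hu huz
      have hj := hp1 v hv hvz
      have hl := hp1 w hw hwz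
      have hij : pos (τ u) ≠ pos (τ v) := fun h => h1 (hpos _ _ h)
      have hil : pos (τ u) ≠ pos (τ w) := fun h => h2 (hpos _ _ h)
      have hjl : pos (τ v) ≠ pos (τ w) := fun h => h3 (hpos _ _ h)
      have n1 := hnn (τ u)
      have n2 := hnn (τ v)
      have n3 := hnn (τ w)
      have hsg : sgP (pos (τ u)) (pos (τ v)) (pos (τ w)) = sgZ (pos (τ u)) (pos (τ v)) (pos (τ w)) := by
        unfold sgP; rw [if_neg]; omega
      rw [hori u v w huz hvz hwz, e1, e2, e3, hsg, sgZ]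
      have q1 : (pos (τ v) : ℝ) - pos (τ u) ≠ 0 := by
        rw [sub_ne_zero]; exact_mod_cast hij.symm
      have q2 : (pos (τ w) : ℝ) - pos (τ u) ≠ 0 := by
        rw [sub_ne_zero]; exact_mod_cast hil.symm
      have q3 : (pos (τ w) : ℝ) - pos (τ v) ≠ 0 := by
        rw [sub_ne_zero]; exact_mod_cast hjl.symm
      push_cast
      set x1 := (pos (τ v) : ℝ) - pos (τ u)
      set x2 := (pos (τ w) : ℝ) - pos (τ u)
      set x3 := (pos (τ w) : ℝ) - pos (τ v)
      have : κ1 * x1 * (κ2 * x2) * (κ3 * x3) * (x1 * x2 * x3) =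
        κ1 * κ2 * κ3 * (x1 ^ 2 * x2 ^ 2 * x3 ^ 2) := by ring
      rw [this]; positivity
    have hone : ∀ u ∈ S, ∀ v ∈ S, ¬ G.Adj u v → τ u ≠ τ v → 
        (pos (τ u) ≠ 1 ∧ oneSided M sgP pos (τ u) (τ v)) →
        u ≠ z ∧ ∃ σ : ℝ, σ ≠ 0 ∧ ∀ w ∈ S, G.Adj u w → 0 < σ * ori (f u) (f v) (f w) := by
      rintro u hu v hv huv hne ⟨hu1, hh⟩
      have huz : u ≠ z := by rintro rfl; exact hu1 hz1
      have hk : ∀ w ∈ S, G.Adj u w →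
          0 < ori (f u) (f v) (f w) * (sgP (pos (τ u)) (pos (τ v)) (pos (τ w)) : ℝ) := by
        intro w hw hadjw
        have hM := (hadj u hu w hw).1 hadjw
        have hne1 : τ u ≠ τ w := by intro h; rw [← h, hirr] at hM; simp at hM
        have hne2 : τ v ≠ τ w := by
          intro h
          exact huv ((hadj u hu v hv).2 (by rw [h]; exact hM))
        exact hs u hu v hv w hw huz hne hne1 hne2
      refine ⟨huz, ?_⟩
      rcases hh with hh | hh
      · refine ⟨1, one_ne_zero, fun w hw hadjw => ?_⟩
        have h1 := hk w hw hadjw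
        have : (0:ℝ) < sgP (pos (τ u)) (pos (τ v)) (pos (τ w)) := by
          exact_mod_cast hh _ ((hadj u hu w hw).1 hadjw)
        rw [one_mul]
        exact (pos_iff_pos_of_mul_pos h1).2 this
      · refine ⟨-1, by norm_num, fun w hw hadjw => ?_⟩
        have h1 := hk w hw hadjw
        have : (sgP (pos (τ u)) (pos (τ v)) (pos (τ w)) : ℝ) < 0 := by
          exact_mod_cast hh _ ((hadj u hu w hw).1 hadjw)
        have := (neg_iff_neg_of_mul_pos h1).2 this
        linarith
    by_cases hτ : τ u = τ v
    · left
      have huz : u ≠ z := by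
        rintro rfl
        exact huv (hzu v hv (hτ ▸ hz1)).symm
      have hvz : v ≠ z := by
        rintro rfl
        exact huv (hzu u hu (hτ ▸ hz1))
      have hu0 : pos (τ u) ≠ 0 := by
        intro h
        exact huv ((heu u hu h).trans (heu v hv (hτ ▸ h)).symm)
      have h0 : θ v - θ u ≠ 0 := sub_ne_zero.2 fun h => huv (hinj ⟨hv, hvz⟩ ⟨hu, huz⟩ h).symm
      have hpv : ∀ x ∈ S, x ≠ z → pos (τ x) ≠ 0 → 0 < θ x := by
        intro x hx hxz hx0
        have h1 := hp1 x hx hxz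
        have h2 := hnn (τ x)
        obtain ⟨a1, a2, a3⟩ := hrange x
        have hu3 : pos (τ x) = 2 ∨ 3 ≤ pos (τ x) := by omega
        rcases hu3 with h | h
        · linarith [(a2 h).1]
        · linarith [a3 h]
      refine ⟨huz, θ v - θ u, h0, ?_⟩
      intro w hw hadjw
      by_cases hwz : w = z
      · rw [hwz, horiz2, horiz1 u v huz hvz]
        have p1 := hpv u hu huz hu0
        have p2 := hpv v hv hvz (hτ ▸ hu0)
        have : (θ v - θ u) * -((θ u - θ v) * (θ v * θ u + 2)) = (θ v - θ u) ^ 2 * (θ v * θ u + 2) := by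
          ring
        rw [this]
        positivity
      have hM := (hadj u hu w hw).1 hadjw
      have hne1 : τ u ≠ τ w := by intro h; rw [← h, hirr] at hM; simp at hM
      obtain ⟨κ2, h2, e2⟩ := hκ u hu w hw huz hwz hne1
      obtain ⟨κ3, h3, e3⟩ := hκ v hv w hw hvz hwz (hτ ▸ hne1)
      have h1 : (pos (τ w) : ℝ) - pos (τ u) ≠ 0 := by
        rw [sub_ne_zero]; intro h; exact hne1 (hpos _ _ (by exact_mod_cast h.symm))
      rw [hori u v w huz hvz hwz, e2, e3, ← hτ]
      have : (θ v - θ u) * ((θ v - θ u) * (κ2 * (↑(pos (τ w)) - ↑(pos (τ u)))) *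
        (κ3 * (↑(pos (τ w)) - ↑(pos (τ u))))) =
        (θ v - θ u) ^ 2 * κ2 * κ3 * ((pos (τ w) : ℝ) - pos (τ u)) ^ 2 := by ring
      rw [this]
      positivity
    · have hM : M (τ u) (τ v) = false := by
        by_contra h
        exact hnadj ((hadj u hu v hv).2 (by simpa using h))
      rcases hos _ _ hτ hM with h | h
      · exact Or.inl (hone u hu v hv hnadj hτ h)
      · exact Or.inr (hone v hv u hu (fun h => hnadj h.symm) (Ne.symm hτ) h)
end

end

section
set_option linter.unusedSectionVars false
set_option linter.unusedVariables false
open Set Filter Topology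

theorem ev_small (C : ℝ) {δ : ℝ} (hδ : 0 < δ) : ∀ᶠ ε in 𝓝[>] (0:ℝ), ε * C < δ := by
  have : Continuous fun ε : ℝ => ε * C := by fun_prop
  exact ((this.continuousAt (x := 0)).eventually_lt continuousAt_const (by simpa using hδ)).filter_mono
    nhdsWithin_le_nhds

theorem ev_pos : ∀ᶠ ε in 𝓝[>] (0:ℝ), 0 < ε := self_mem_nhdsWithin

theorem exit_path {D : Set P2} {K H : ℝ} (hK : 0 ≤ K) (hD0 : (0 : P2) ∈ D)
    (hD : ∀ p ∈ D, 0 ≤ p.1 ∧ p.1 ≤ H ∧ |p.2| ≤ K * p.1) {X : P2} (hX : X ∈ OutSet D) (hX1 : 0 < X.1) :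
    ∃ C, IsCompact C ∧ C ⊆ Dᶜ ∧ (∀ p ∈ C, 0 < p.1) ∧ ∃ q ∈ C, K * q.1 < |q.2| ∧ JoinedIn C X q := by
  obtain ⟨q, hq, γ, hγ⟩ := hX (max H (K * H))
  have hqH : H < ‖q‖ := lt_of_le_of_lt (le_max_left _ _) hq
  have hqKH : K * H < ‖q‖ := lt_of_le_of_lt (le_max_right _ _) hq
  set g : ℝ → P2 := fun t => γ.extend t with hg
  have hgc : Continuous g := γ.extend.continuous
  have hgD : ∀ t ∈ Icc (0:ℝ) 1, g t ∉ D := by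
    intro t ht
    simp only [hg, Path.extend_apply _ ht]
    exact hγ _
  have hg0 : g 0 = X := by simp [hg]
  have hg1 : g 1 = q := by simp [hg]
  set F : Set ℝ := Icc (0:ℝ) 1 ∩ {t | (K + 1) * (g t).1 ≤ |(g t).2|} with hF
  have hFc : IsCompact F := isCompact_Icc.inter_right
    (isClosed_le (by fun_prop) (by fun_prop))
  rcases F.eq_empty_or_nonempty with hFe | hFne
  · have hlt : ∀ t ∈ Icc (0:ℝ) 1, |(g t).2| < (K + 1) * (g t).1 := by
      intro t ht
      by_contra hcon
      have : t ∈ F := ⟨ht, not_lt.1 hcon⟩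
      rw [hFe] at this
      exact this
    have hpos : ∀ t ∈ Icc (0:ℝ) 1, 0 < (g t).1 := by
      intro t ht
      have h1 := hlt t ht
      have h2 := abs_nonneg (g t).2
      by_contra hcon
      nlinarith
    have hI : IsPathConnected (g '' Icc (0:ℝ) 1) :=
      ((convex_Icc (0:ℝ) 1).isPathConnected ⟨0, by simp⟩).image hgc
    have hXm : X ∈ g '' Icc (0:ℝ) 1 := ⟨0, by simp, hg0⟩
    have hqm : q ∈ g '' Icc (0:ℝ) 1 := ⟨1, by simp, hg1⟩
    have hq1 : 0 < q.1 := hg1 ▸ hpos 1 (by simp)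
    by_cases hqH1 : q.1 ≤ H
    · refine ⟨g '' Icc (0:ℝ) 1, isCompact_Icc.image hgc, ?_, ?_, q, hqm, ?_, hI.joinedIn X hXm q hqm⟩
      · rintro _ ⟨t, ht, rfl⟩; exact hgD t ht
      · rintro _ ⟨t, ht, rfl⟩; exact hpos t ht
      · rw [Prod.norm_def, lt_max_iff, Real.norm_eq_abs, Real.norm_eq_abs, abs_of_pos hq1] at hqKH hqH
        have h3 : K * q.1 ≤ K * H := mul_le_mul_of_nonneg_left hqH1 hK
        rcases hqH with h | h
        · linarith
        · rcases hqKH with h' | h'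
          · rw [Prod.norm_def, lt_max_iff, Real.norm_eq_abs, Real.norm_eq_abs, abs_of_pos hq1] at hq
            rcases hq with h4 | h4
            · have := le_max_left H (K * H); linarith
            · have := le_max_right H (K * H); linarith
          · linarith
    · push Not at hqH1
      set q' : P2 := (q.1, K * q.1 + 1) with hq'
      have hseg : ∀ p ∈ segment ℝ q q', p.1 = q.1 := by
        rintro p ⟨a, b, ha, hb, hab, rfl⟩
        simp [hq', ← add_mul, hab]
      refine ⟨g '' Icc (0:ℝ) 1 ∪ segment ℝ q q', (isCompact_Icc.image hgc).union ?_, ?_, ?_, q',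
        Or.inr (right_mem_segment _ _ _), ?_, ?_⟩
      · rw [segment_eq_image']
        exact isCompact_Icc.image (by fun_prop)
      · rintro p (⟨t, ht, rfl⟩ | hp)
        · exact hgD t ht
        · intro hpD
          have := (hD p hpD).2.1
          rw [hseg p hp] at this
          linarith
      · rintro p (⟨t, ht, rfl⟩ | hp)
        · exact hpos t ht
        · rw [hseg p hp]; exact hq1
      · simp only [hq']
        rw [abs_of_nonneg (by positivity)]
        linarith
      · exact ((hI.joinedIn X hXm q hqm).mono subset_union_left).trans
          ((joinedIn_of_segment subset_rfl).mono subset_union_right)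
  · obtain ⟨t0, ht0F, ht0min⟩ := hFc.exists_isLeast hFne
    have ht0 : t0 ∈ Icc (0:ℝ) 1 := ht0F.1
    have hlt : ∀ t ∈ Ico (0:ℝ) t0, |(g t).2| < (K + 1) * (g t).1 := by
      intro t ht
      by_contra hcon
      have : t0 ≤ t := ht0min ⟨⟨ht.1, ht.2.le.trans ht0.2⟩, not_lt.1 hcon⟩
      exact absurd ht.2 (not_lt.2 this)
    have hpos : ∀ t ∈ Ico (0:ℝ) t0, 0 < (g t).1 := by
      intro t ht
      have h1 := hlt t ht
      have h2 := abs_nonneg (g t).2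
      by_contra hcon
      nlinarith
    have ht0pos : 0 < (g t0).1 := by
      rcases ht0.1.eq_or_lt with h | h
      · rw [← h, hg0]; exact hX1
      · have hle : |(g t0).2| ≤ (K + 1) * (g t0).1 := by
          have hcl : t0 ∈ closure (Ico (0:ℝ) t0) := by
            rw [closure_Ico h.ne]; exact ⟨h.le, le_rfl⟩
          have hclosed : IsClosed {t | |(g t).2| ≤ (K + 1) * (g t).1} :=
            isClosed_le (by fun_prop) (by fun_prop)
          exact (closure_minimal (fun t ht => (hlt t ht).le) hclosed) hcl
        have h2 := abs_nonneg (g t0).2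
        have h3 : 0 ≤ (g t0).1 := by
          by_contra hcon
          nlinarith
        rcases h3.eq_or_lt with h4 | h4
        · exfalso
          rw [← h4, mul_zero] at hle
          have h5 : (g t0).2 = 0 := abs_eq_zero.1 (le_antisymm hle h2)
          have h6 : g t0 = 0 := Prod.ext h4.symm h5
          exact hgD t0 ht0 (h6 ▸ hD0)
        · exact h4
    have hI : IsPathConnected (g '' Icc (0:ℝ) t0) :=
      ((convex_Icc (0:ℝ) t0).isPathConnected ⟨0, by simp [ht0.1]⟩).image hgc
    have hXm : X ∈ g '' Icc (0:ℝ) t0 := ⟨0, by simp [ht0.1], hg0⟩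
    have hqm : g t0 ∈ g '' Icc (0:ℝ) t0 := ⟨t0, by simp [ht0.1], rfl⟩
    refine ⟨g '' Icc (0:ℝ) t0, isCompact_Icc.image hgc, ?_, ?_, g t0, hqm, ?_, hI.joinedIn X hXm _ hqm⟩
    · rintro _ ⟨t, ht, rfl⟩; exact hgD t ⟨ht.1, ht.2.trans ht0.2⟩
    · rintro _ ⟨t, ht, rfl⟩
      rcases ht.2.eq_or_lt with h | h
      · rw [h]; exact ht0pos
      · exact hpos t ⟨ht.1, h⟩
    · have h1 : (K + 1) * (g t0).1 ≤ |(g t0).2| := ht0F.2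
      linarith

/-- Squeezing map. -/
def sqz (ε : ℝ) (p : P2) : P2 := (ε * p.1, ε ^ 2 * p.2)

theorem sqz_segment {ε : ℝ} {x y p : P2} (hp : p ∈ segment ℝ (sqz ε x) (sqz ε y)) :
    ∃ q ∈ segment ℝ x y, p = sqz ε q := by
  obtain ⟨a, b, ha, hb, hab, rfl⟩ := hp
  refine ⟨a • x + b • y, ⟨a, b, ha, hb, hab, rfl⟩, ?_⟩
  ext <;> simp [sqz] <;> ring

theorem sqz_mem_segment {ε : ℝ} {x y p : P2} (hp : p ∈ segment ℝ x y) :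
    sqz ε p ∈ segment ℝ (sqz ε x) (sqz ε y) := by
  obtain ⟨a, b, ha, hb, hab, rfl⟩ := hp
  refine ⟨a, b, ha, hb, hab, ?_⟩
  ext <;> simp [sqz] <;> ring

theorem sqz_inj {ε : ℝ} (hε : 0 < ε) {x y : P2} (h : sqz ε x = sqz ε y) : x = y := by
  rw [Prod.ext_iff] at h
  simp only [sqz] at h
  refine Prod.ext (mul_left_cancel₀ hε.ne' h.1) (mul_left_cancel₀ (pow_pos hε 2).ne' h.2)

theorem convex_wedge (a c k σ : ℝ) :
    Convex ℝ {p : P2 | 0 < p.1 ∧ p.1 ≤ c ∧ k * p.1 < σ * p.2 ∧ σ * p.2 ≤ c * p.1} := by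
  have h1 : Convex ℝ {p : P2 | 0 < linF 1 0 p} := convex_halfSpace_gt (linF 1 0).isLinear 0
  have h2 : Convex ℝ {p : P2 | linF 1 0 p ≤ c} := convex_halfSpace_le (linF 1 0).isLinear c
  have h3 : Convex ℝ {p : P2 | 0 < linF (-k) σ p} := convex_halfSpace_gt (linF (-k) σ).isLinear 0
  have h4 : Convex ℝ {p : P2 | 0 ≤ linF c (-σ) p} := convex_halfSpace_ge (linF c (-σ)).isLinear 0
  convert ((h1.inter h2).inter h3).inter h4 using 1
  ext p
  simp only [linF_apply, mem_inter_iff, mem_ofPred_eq]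
  constructor
  · rintro ⟨a, b, c, d⟩
    refine ⟨⟨⟨?_, ?_⟩, ?_⟩, ?_⟩ <;> linarith
  · rintro ⟨⟨⟨a, b⟩, c⟩, d⟩
    refine ⟨?_, ?_, ?_, ?_⟩ <;> linarith

end

section
set_option linter.unusedSectionVars false
set_option linter.unusedVariables false
open Set Filter Topology

structure GlueH {V : Type} (G : SimpleGraph V) (A B : Set V) (v : V) (f1 f2 : V → P2) (c K H : ℝ) :
    Prop where
  vA : v ∈ A
  vB : v ∈ B
  AB : ∀ x, x ∈ A → x ∈ B → x = v
  no : ∀ a ∈ A, ∀ b ∈ B, a ≠ v → b ≠ v → ¬ G.Adj a b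
  f1v : f1 v = 0
  f2v : f2 v = 0
  pos : ∀ y ∈ B, y ≠ v → 0 < (f2 y).1
  c0 : 0 < c
  wedge : ∀ p : P2, 0 < p.1 → p.1 ≤ c → |p.2| ≤ c * p.1 → p ∈ OutSet (Dr G A f1)
  K0 : 0 ≤ K
  H0 : 0 ≤ H
  bd : ∀ p ∈ Dr G B f2, 0 ≤ p.1 ∧ p.1 ≤ H ∧ |p.2| ≤ K * p.1

open Classical in
/-- The glued map. -/
noncomputable def gF {V : Type} (A : Set V) (f1 f2 : V → P2) (ε : ℝ) (x : V) : P2 :=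
  if x ∈ A then f1 x else sqz ε (f2 x)

namespace GlueH
variable {V : Type} [Finite V] {G : SimpleGraph V} {A B : Set V} {v : V} {f1 f2 : V → P2} {c K H : ℝ}

theorem fA {ε : ℝ} {x : V} (hx : x ∈ A) : gF A f1 f2 ε x = f1 x := by simp [gF, hx]

theorem fB (h : GlueH G A B v f1 f2 c K H) {ε : ℝ} {x : V} (hx : x ∈ B) :
    gF A f1 f2 ε x = sqz ε (f2 x) := by
  by_cases hA : x ∈ A
  · have := h.AB x hA hx
    subst this
    rw [fA hA, h.f1v, h.f2v]
    ext <;> simp [sqz]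
  · simp [gF, hA]

theorem dec (h : GlueH G A B v f1 f2 c K H) {ε : ℝ} {p : P2}
    (hp : p ∈ Dr G (A ∪ B) (gF A f1 f2 ε)) :
    p ∈ Dr G A f1 ∨ ∃ q ∈ Dr G B f2, p = sqz ε q := by
  obtain ⟨u, hu, w, hw, huw, hp⟩ := hp
  have cA : u ∈ A → w ∈ A → p ∈ Dr G A f1 ∨ ∃ q ∈ Dr G B f2, p = sqz ε q := by
    intro hu hw
    rw [fA hu, fA hw] at hp
    exact Or.inl ⟨u, hu, w, hw, huw, hp⟩
  have cB : u ∈ B → w ∈ B → p ∈ Dr G A f1 ∨ ∃ q ∈ Dr G B f2, p = sqz ε q := by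
    intro hu hw
    rw [h.fB hu, h.fB hw] at hp
    obtain ⟨q, hq, rfl⟩ := sqz_segment hp
    exact Or.inr ⟨q, ⟨u, hu, w, hw, huw, hq⟩, rfl⟩
  rcases hu with hu | hu <;> rcases hw with hw | hw
  · exact cA hu hw
  · rcases huw with rfl | huw
    · exact cB hw hw
    · by_cases h1 : u = v
      · exact cB (h1 ▸ h.vB) hw
      · by_cases h2 : w = v
        · exact cA hu (h2 ▸ h.vA)
        · exact absurd huw (h.no u hu w hw h1 h2)
  · rcases huw with rfl | huw
    · exact cB hu hu
    · by_cases h1 : u = v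
      · exact cA (h1 ▸ h.vA) hw
      · by_cases h2 : w = v
        · exact cB hu (h2 ▸ h.vB)
        · exact absurd huw.symm (h.no w hw u hu h2 h1)
  · exact cB hu hw

theorem ev0 (h : GlueH G A B v f1 f2 c K H) {X : P2} (hX : X ∈ OutSet (Dr G A f1)) :
    ∀ᶠ ε in 𝓝[>] (0:ℝ), X ∈ OutSet (Dr G (A ∪ B) (gF A f1 f2 ε)) := by
  have h0 : X ∈ OutSet (Dr G (A ∪ B) (gF A f1 f2 0)) := by
    refine out_mono ?_ hX
    intro p hp
    rcases h.dec hp with hp | ⟨q, hq, rfl⟩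
    · exact hp
    · have : sqz 0 q = f1 v := by rw [h.f1v]; simp [sqz]
      rw [this]
      exact mem_Dr_vertex h.vA
  have hs := out_stable G (A ∪ B) h0
  have hc : ContinuousAt (fun ε : ℝ => (gF A f1 f2 ε, X)) 0 := by
    apply Continuous.continuousAt
    refine Continuous.prodMk (continuous_pi fun x => ?_) continuous_const
    by_cases hx : x ∈ A
    · simp only [gF, hx, if_true]; exact continuous_const
    · simp only [gF, hx, if_false, sqz]; fun_prop
  exact (hc.eventually hs).filter_mono nhdsWithin_le_nhds

theorem ev1 (h : GlueH G A B v f1 f2 c K H) :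
    ∀ᶠ ε in 𝓝[>] (0:ℝ), ∀ p : P2, 0 < p.1 → p.1 ≤ c → ε * K * p.1 < |p.2| → |p.2| ≤ c * p.1 →
      p ∈ OutSet (Dr G (A ∪ B) (gF A f1 f2 ε)) := by
  have hc := h.c0
  have hw : ∀ σ : ℝ, |σ| = 1 → ((c, σ * c ^ 2) : P2) ∈ OutSet (Dr G A f1) := by
    intro σ hσ
    refine h.wedge _ hc le_rfl ?_
    simp only
    rw [abs_mul, hσ, abs_of_nonneg (by positivity)]
    nlinarith
  filter_upwards [ev_pos, ev_small K hc, h.ev0 (hw 1 (by simp)), h.ev0 (hw (-1) (by simp))]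
    with ε hε hεK hp1 hm1 p h0 h1 h2 h3
  have key : ∀ σ : ℝ, σ ^ 2 = 1 → σ * p.2 = |p.2| →
      ((c, σ * c ^ 2) : P2) ∈ OutSet (Dr G (A ∪ B) (gF A f1 f2 ε)) →
      p ∈ OutSet (Dr G (A ∪ B) (gF A f1 f2 ε)) := by
    intro σ hσ hσp hout
    have hσ' : |σ| = 1 := by
      exact (pow_eq_one_iff_of_nonneg (abs_nonneg σ) two_ne_zero).1 (by rw [sq_abs, hσ])
    refine out_of_joined (joinedIn_of_convex (convex_wedge 0 c (ε * K) σ) ?_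
      ⟨h0, h1, by rw [hσp]; exact h2, by rw [hσp]; exact h3⟩ ?_) hout
    · rintro z ⟨z0, z1, z2, z3⟩ hz
      have hzabs : |z.2| = σ * z.2 := by
        have : 0 ≤ σ * z.2 := le_trans (by have := h.K0; positivity) z2.le
        rw [← abs_of_nonneg this, abs_mul, hσ', one_mul]
      rcases h.dec hz with hz | ⟨q, hq, rfl⟩
      · exact out_not_mem (h.wedge z z0 z1 (by rw [hzabs]; exact z3)) hz
      · obtain ⟨_, _, q3⟩ := h.bd q hq
        rw [← hzabs] at z2
        simp only [sqz] at z2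
        rw [abs_mul, abs_of_pos (by positivity)] at z2
        have : ε ^ 2 * |q.2| ≤ ε ^ 2 * (K * q.1) := by gcongr
        nlinarith
    · refine ⟨hc, le_rfl, ?_, ?_⟩
      · show ε * K * c < σ * (σ * c ^ 2)
        have : σ * (σ * c ^ 2) = c ^ 2 := by linear_combination c ^ 2 * hσ
        rw [this]; nlinarith
      · show σ * (σ * c ^ 2) ≤ c * c
        have : σ * (σ * c ^ 2) = c ^ 2 := by linear_combination c ^ 2 * hσ
        rw [this]; nlinarith
  rcases le_total 0 p.2 with hp | hp
  · exact key 1 (by norm_num) (by rw [abs_of_nonneg hp]; ring) hp1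
  · exact key (-1) (by norm_num) (by rw [abs_of_nonpos hp]; ring) hm1

theorem evW (h : GlueH G A B v f1 f2 c K H) (H' K' : ℝ) :
    ∀ᶠ ε in 𝓝[>] (0:ℝ), ∀ p : P2, 0 < p.1 → p.1 ≤ H' → |p.2| ≤ K' * p.1 →
      (0 < (sqz ε p).1 ∧ (sqz ε p).1 ≤ c ∧ |(sqz ε p).2| ≤ c * (sqz ε p).1) := by
  filter_upwards [ev_pos, ev_small H' h.c0, ev_small K' h.c0] with ε hε h1 h2 p p0 p1 p2
  have hc := h.c0
  refine ⟨mul_pos hε p0, ?_, ?_⟩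
  · simp only [sqz]; nlinarith
  · simp only [sqz]
    rw [abs_mul, abs_of_pos (by positivity)]
    have h3 : ε * |p.2| ≤ ε * (K' * p.1) := by gcongr
    have h4 : ε * K' * p.1 ≤ c * p.1 := by gcongr
    have : ε * (ε * |p.2|) ≤ ε * (c * p.1) := by
      apply mul_le_mul_of_nonneg_left _ hε.le; linarith
    nlinarith

theorem avoid (h : GlueH G A B v f1 f2 c K H) {ε : ℝ} (hε : 0 < ε) {p : P2} (hp : p ∉ Dr G B f2)
    (hw : 0 < (sqz ε p).1 ∧ (sqz ε p).1 ≤ c ∧ |(sqz ε p).2| ≤ c * (sqz ε p).1) :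
    sqz ε p ∉ Dr G (A ∪ B) (gF A f1 f2 ε) := by
  intro hz
  rcases h.dec hz with hz | ⟨q, hq, hqe⟩
  · exact out_not_mem (h.wedge _ hw.1 hw.2.1 hw.2.2) hz
  · rw [sqz_inj hε hqe] at hp
    exact hp hq

theorem ev6 (h : GlueH G A B v f1 f2 c K H) {X : P2} (hX : X ∈ OutSet (Dr G B f2)) (hX0 : 0 < X.1) :
    ∀ᶠ ε in 𝓝[>] (0:ℝ), sqz ε X ∈ OutSet (Dr G (A ∪ B) (gF A f1 f2 ε)) := by
  obtain ⟨C, hC, hCD, hC0, q, hqC, hq, hj⟩ := exit_path h.K0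
    (by rw [← h.f2v]; exact mem_Dr_vertex h.vB) h.bd hX hX0
  obtain ⟨H', hH'⟩ := hC.bddAbove_image (f := fun p : P2 => p.1) (by fun_prop)
  obtain ⟨K', hK'⟩ := hC.bddAbove_image (f := fun p : P2 => |p.2| / p.1)
    (ContinuousOn.div (by fun_prop) (by fun_prop) fun p hp => (hC0 p hp).ne')
  filter_upwards [ev_pos, h.ev1, h.evW H' K'] with ε hε h1 hW
  have hWC : ∀ p ∈ C, (0 < (sqz ε p).1 ∧ (sqz ε p).1 ≤ c ∧ |(sqz ε p).2| ≤ c * (sqz ε p).1) := by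
    intro p hp
    refine hW p (hC0 p hp) (hH' ⟨p, hp, rfl⟩) ?_
    have := hK' ⟨p, hp, rfl⟩
    simp only at this
    rwa [div_le_iff₀ (hC0 p hp)] at this
  obtain ⟨w0, w1, w2⟩ := hWC q hqC
  have hqo := h1 (sqz ε q) w0 w1 (by
    simp only [sqz]
    rw [abs_mul, abs_of_pos (by positivity)]
    have : ε ^ 2 * (K * q.1) < ε ^ 2 * |q.2| := by gcongr
    linarith) w2
  refine out_of_joined ?_ hqo
  obtain ⟨γ, hγ⟩ := hj
  have hcs : Continuous (sqz ε) := by unfold sqz; fun_prop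
  exact ⟨γ.map hcs, fun t => h.avoid hε (hCD (hγ t)) (hWC _ (hγ t))⟩

end GlueH

end

section
set_option linter.unusedSectionVars false
set_option linter.unusedVariables false
open Set Filter Topology

namespace GlueH
variable {V : Type} [Finite V] {G : SimpleGraph V} {A B : Set V} {v : V} {f1 f2 : V → P2} {c K H : ℝ}

theorem exp_v (h : GlueH G A B v f1 f2 c K H) :
    ∀ᶠ ε in 𝓝[>] (0:ℝ), Exposed (Dr G (A ∪ B) (gF A f1 f2 ε)) (gF A f1 f2 ε v) := by
  have hc := h.c0
  filter_upwards [ev_pos, h.ev1, ev_small K (show 0 < c / 4 by positivity)] with ε hε h1 hK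
  rw [fA h.vA, h.f1v]
  refine ⟨(1, c / 2), min (1/4) (c / 8), by positivity, ?_⟩
  intro s hs hsc e he
  have e1 : |e.1 - 1| ≤ min (1/4) (c / 8) := (norm_fst_le (e - (1, c/2))).trans he
  have e2 : |e.2 - c / 2| ≤ min (1/4) (c / 8) := (norm_snd_le (e - (1, c/2))).trans he
  have m1 := min_le_left (1/4) (c / 8)
  have m2 := min_le_right (1/4) (c / 8)
  rw [abs_le] at e1 e2
  have a1 : 3 / 4 ≤ e.1 := by linarith
  have a2 : e.1 ≤ 5 / 4 := by linarith
  have a3 : 3 * c / 8 ≤ e.2 := by linarith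
  have a4 : e.2 ≤ 5 * c / 8 := by linarith
  have ha : |(s • e).2| = s * e.2 := by
    simp only [Prod.smul_snd, smul_eq_mul]
    exact abs_of_nonneg (mul_nonneg hs.le (by linarith))
  rw [zero_add]
  have hK0 : 0 ≤ ε * K := mul_nonneg hε.le h.K0
  apply h1
  · simp only [Prod.smul_fst, smul_eq_mul]; exact mul_pos hs (by linarith)
  · simp only [Prod.smul_fst, smul_eq_mul]; nlinarith
  · rw [ha]; simp only [Prod.smul_fst, smul_eq_mul]
    have : ε * K * e.1 < e.2 := by nlinarith
    nlinarith
  · rw [ha]; simp only [Prod.smul_fst, smul_eq_mul]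
    have : e.2 ≤ c * e.1 := by nlinarith
    nlinarith

theorem exp_A (h : GlueH G A B v f1 f2 c K H) (hinj : InjOn f1 A) {a : V} (ha : a ∈ A) (hav : a ≠ v)
    (hexp : Exposed (Dr G A f1) (f1 a)) :
    ∀ᶠ ε in 𝓝[>] (0:ℝ), Exposed (Dr G (A ∪ B) (gF A f1 f2 ε)) (gF A f1 f2 ε a) := by
  obtain ⟨d, c2, hc2, hd⟩ := hexp
  have hn : 0 < ‖f1 a‖ := by
    rw [norm_pos_iff, ← h.f1v]
    exact fun h' => hav (hinj ha h.vA h')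
  set c3 := min c2 (‖f1 a‖ / 2 / (‖d‖ + c2)) with hc3
  have hdc : 0 < ‖d‖ + c2 := by positivity
  have hc30 : 0 < c3 := by positivity
  have hc3le : c3 * (‖d‖ + c2) ≤ ‖f1 a‖ / 2 := by
    have := min_le_right c2 (‖f1 a‖ / 2 / (‖d‖ + c2))
    rwa [← hc3, le_div_iff₀ hdc] at this
  have hX := hd c3 hc30 (min_le_left _ _) d (by simp [hc2.le])
  filter_upwards [ev_pos, h.ev0 hX, ev_small H (show 0 < ‖f1 a‖ / 2 by positivity),
    ev_small (K * H) (show 0 < ‖f1 a‖ / 2 by positivity), ev_small 1 (show (0:ℝ) < 1 by norm_num)]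
    with ε hε hXo hεH hεK hε1
  rw [fA ha]
  refine exposed_of_free hc30 hc2 ?_ ⟨c3, hc30, le_rfl, d, by rw [sub_self, norm_zero]; exact hc2.le, hXo⟩
  intro s hs hsc e he hmem
  rcases h.dec hmem with hm | ⟨q, hq, hqe⟩
  · exact out_not_mem (hd s hs (hsc.trans (min_le_left _ _)) e he) hm
  · obtain ⟨q1, q2, q3⟩ := h.bd q hq
    have hen : ‖e‖ ≤ ‖d‖ + c2 := by
      have := norm_sub_norm_le e d; linarith
    have h1 : ‖s • e‖ ≤ ‖f1 a‖ / 2 := by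
      rw [norm_smul, Real.norm_of_nonneg hs.le]
      exact (mul_le_mul hsc hen (norm_nonneg _) hc30.le).trans hc3le
    have h2 : ‖f1 a‖ / 2 ≤ ‖f1 a + s • e‖ := by
      have := norm_sub_le (f1 a + s • e) (s • e)
      rw [add_sub_cancel_right] at this
      linarith
    have h3 : ‖sqz ε q‖ < ‖f1 a‖ / 2 := by
      rw [Prod.norm_def]
      simp only [sqz]
      rw [Real.norm_eq_abs, Real.norm_eq_abs, abs_mul, abs_mul, abs_of_pos hε, abs_of_nonneg q1,
        abs_of_pos (pow_pos hε 2)]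
      apply max_lt
      · nlinarith
      · have : |q.2| ≤ K * H := q3.trans (mul_le_mul_of_nonneg_left q2 h.K0)
        have h0 := abs_nonneg q.2
        have h4 : ε * |q.2| ≤ ε * (K * H) := by gcongr
        have h5 : ε * (ε * |q.2|) ≤ 1 * (ε * |q.2|) := by gcongr; linarith
        nlinarith
    rw [hqe] at h2
    linarith

theorem exp_B (h : GlueH G A B v f1 f2 c K H) {y : V} (hy : y ∈ B) (hyv : y ≠ v)
    (hexp : Exposed (Dr G B f2) (f2 y)) :
    ∀ᶠ ε in 𝓝[>] (0:ℝ), Exposed (Dr G (A ∪ B) (gF A f1 f2 ε)) (gF A f1 f2 ε y) := by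
  obtain ⟨d, c2, hc2, hd⟩ := hexp
  have hn : 0 < (f2 y).1 := h.pos y hy hyv
  set x0 := (f2 y).1 with hx0
  set c3 := min c2 (x0 / 2 / (‖d‖ + c2)) with hc3
  have hdc : 0 < ‖d‖ + c2 := by positivity
  have hc30 : 0 < c3 := by positivity
  have hc3le : c3 * (‖d‖ + c2) ≤ x0 / 2 := by
    have := min_le_right c2 (x0 / 2 / (‖d‖ + c2))
    rwa [← hc3, le_div_iff₀ hdc] at this
  have hX := hd c3 hc30 (min_le_left _ _) d (by simp [hc2.le])
  have hpt : ∀ s : ℝ, 0 < s → s ≤ c3 → ∀ e : P2, ‖e - d‖ ≤ c2 →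
      0 < (f2 y + s • e).1 ∧ (f2 y + s • e).1 ≤ 2 * x0 ∧
      |(f2 y + s • e).2| ≤ (2 * (|(f2 y).2| + x0) / x0) * (f2 y + s • e).1 := by
    intro s hs hsc e he
    have hen : ‖e‖ ≤ ‖d‖ + c2 := by
      have := norm_sub_norm_le e d; linarith
    have h1 : ‖s • e‖ ≤ x0 / 2 := by
      rw [norm_smul, Real.norm_of_nonneg hs.le]
      exact (mul_le_mul hsc hen (norm_nonneg _) hc30.le).trans hc3le
    have h2 : |(s • e).1| ≤ x0 / 2 := (norm_fst_le (s • e)).trans h1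
    have h3 : |(s • e).2| ≤ x0 / 2 := (norm_snd_le (s • e)).trans h1
    rw [abs_le] at h2
    rw [Prod.fst_add, Prod.snd_add, ← hx0]
    refine ⟨by linarith, by linarith, ?_⟩
    have h4 := abs_add_le (f2 y).2 (s • e).2
    have h5 : |(f2 y).2| + x0 = (2 * (|(f2 y).2| + x0) / x0) * (x0 / 2) := by field_simp
    have h6 : (2 * (|(f2 y).2| + x0) / x0) * (x0 / 2) ≤
      (2 * (|(f2 y).2| + x0) / x0) * (x0 + (s • e).1) := by gcongr; linarith
    linarith
  filter_upwards [ev_pos, h.ev6 hX (hpt c3 hc30 le_rfl d (by simp [hc2.le])).1,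
    h.evW (2 * x0) (2 * (|(f2 y).2| + x0) / x0), ev_small 1 (show (0:ℝ) < 1 by norm_num)]
    with ε hε hXo hW hε1
  rw [h.fB hy]
  have hsum : ∀ (s : ℝ) (e : P2), sqz ε (f2 y) + s • sqz ε e = sqz ε (f2 y + s • e) := by
    intro s e
    ext <;> simp [sqz] <;> ring
  refine exposed_of_free (d := sqz ε d) (c' := ε ^ 2 * c2) hc30 (by positivity) ?_
    ⟨c3, hc30, le_rfl, sqz ε d, by simp; positivity, by rw [hsum]; exact hXo⟩
  intro s hs hsc e' he'
  obtain ⟨e, rfl⟩ : ∃ e, e' = sqz ε e := ⟨(e'.1 / ε, e'.2 / ε ^ 2), by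
    ext <;> simp only [sqz] <;> field_simp⟩
  have he : ‖e - d‖ ≤ c2 := by
    have a1 : |ε * e.1 - ε * d.1| ≤ ε ^ 2 * c2 := (norm_fst_le (sqz ε e - sqz ε d)).trans he'
    have a2 : |ε ^ 2 * e.2 - ε ^ 2 * d.2| ≤ ε ^ 2 * c2 :=
      (norm_snd_le (sqz ε e - sqz ε d)).trans he'
    rw [← mul_sub, abs_mul, abs_of_pos hε] at a1
    rw [← mul_sub, abs_mul, abs_of_pos (pow_pos hε 2)] at a2
    rw [Prod.norm_def]
    apply max_le
    · show |e.1 - d.1| ≤ c2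
      have : ε * |e.1 - d.1| ≤ ε * c2 := by
        refine a1.trans ?_
        have : ε * (ε * c2) ≤ 1 * (ε * c2) := by gcongr; linarith
        nlinarith
      exact le_of_mul_le_mul_left this hε
    · exact le_of_mul_le_mul_left a2 (pow_pos hε 2)
  rw [hsum]
  obtain ⟨b1, b2, b3⟩ := hpt s hs hsc e he
  exact h.avoid hε (out_not_mem (hd s hs (hsc.trans (min_le_left _ _)) e he)) (hW _ b1 b2 b3)

theorem cross (h : GlueH G A B v f1 f2 c K H) {a y : V} (ha : a ∈ A) (hq : (f1 a).2 ≠ 0)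
    (hy : y ∈ B) (hyv : y ≠ v) :
    ∀ᶠ ε in 𝓝[>] (0:ℝ), ∃ X ∈ segment ℝ (gF A f1 f2 ε a) (gF A f1 f2 ε y),
      X ∈ OutSet (Dr G (A ∪ B) (gF A f1 f2 ε)) := by
  have hh := h.pos y hy hyv
  have hK := h.K0
  have hc := h.c0
  rcases hqq : f1 a with ⟨q1, q2⟩
  rcases hyy : f2 y with ⟨hx, m⟩
  rw [hyy] at hh
  rw [hqq] at hq
  simp only at hh hq
  have hqp : 0 < |q2| := abs_pos.2 hq
  set M := (|m| + K * hx + 1) / |q2| with hM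
  have hMq : M * |q2| = |m| + K * hx + 1 := by rw [hM]; field_simp
  have hM0 : 0 < M := by positivity
  filter_upwards [ev_pos, h.ev1, ev_small 1 (show (0:ℝ) < 1 by norm_num),
    ev_small M (show (0:ℝ) < 1 / 4 by norm_num),
    ev_small (M * |q1|) (show 0 < hx / 4 by positivity),
    ev_small (M * |q1| * K) (show (0:ℝ) < 1 by positivity),
    ev_small (hx * 2) hc,
    ev_small (|m| + M * |q2|) (show 0 < c * (hx / 2) by positivity)]
    with ε hε h1 hε1 e1 e2 e3 e4 e5
  rw [fA ha, h.fB hy, hqq, hyy]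
  set τ := ε ^ 2 * M with hτ
  have hτ0 : 0 ≤ τ := by positivity
  have hτ1 : τ ≤ 1 / 4 := by nlinarith
  refine ⟨τ • (q1, q2) + (1 - τ) • sqz ε (hx, m), ⟨τ, 1 - τ, hτ0, by linarith, by ring, rfl⟩, ?_⟩
  have hX : τ • (q1, q2) + (1 - τ) • sqz ε (hx, m) =
      (ε * ((1 - τ) * hx + ε * M * q1), ε ^ 2 * ((1 - τ) * m + M * q2)) := by
    ext <;> simp [sqz, hτ] <;> ring
  rw [hX]
  have hq1 := neg_abs_le q1
  have hq1' := le_abs_self q1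
  have b1 : ε * M * q1 ≤ ε * (M * |q1|) := by rw [mul_assoc]; gcongr
  have b2 : -(ε * (M * |q1|)) ≤ ε * M * q1 := by
    have : ε * M * (-|q1|) ≤ ε * M * q1 := by gcongr
    linarith
  have hxlo : hx / 2 ≤ (1 - τ) * hx + ε * M * q1 := by nlinarith
  have hxhi : (1 - τ) * hx + ε * M * q1 ≤ hx * 2 := by nlinarith
  have htri : |(1 - τ) * m| ≤ |m| := by
    rw [abs_mul, abs_of_nonneg (by linarith : 0 ≤ 1 - τ)]
    have := abs_nonneg m
    nlinarith
  have hylo : K * hx + 1 ≤ |(1 - τ) * m + M * q2| := by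
    have := abs_sub_abs_le_abs_sub (M * q2) (-((1 - τ) * m))
    rw [abs_neg, sub_neg_eq_add, abs_mul M, abs_of_pos hM0, add_comm (M * q2)] at this
    linarith
  have hyhi : |(1 - τ) * m + M * q2| ≤ |m| + M * |q2| := by
    have := abs_add_le ((1 - τ) * m) (M * q2)
    rw [abs_mul M, abs_of_pos hM0] at this
    linarith
  have habs : |ε ^ 2 * ((1 - τ) * m + M * q2)| = ε ^ 2 * |(1 - τ) * m + M * q2| := by
    rw [abs_mul, abs_of_pos (by positivity)]
  apply h1
  · show 0 < ε * _
    exact mul_pos hε (by linarith)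
  · show ε * _ ≤ c
    have : ε * ((1 - τ) * hx + ε * M * q1) ≤ ε * (hx * 2) := by gcongr
    linarith
  · show ε * K * (ε * _) < |ε ^ 2 * _|
    rw [habs]
    have : K * ((1 - τ) * hx + ε * M * q1) < K * hx + 1 := by
      have k1 : K * ((1 - τ) * hx + ε * M * q1) ≤ K * (hx + ε * (M * |q1|)) := by
        gcongr; nlinarith
      nlinarith
    have h9 : ε ^ 2 * (K * ((1 - τ) * hx + ε * M * q1)) < ε ^ 2 * |(1 - τ) * m + M * q2| := by
      gcongr; linarith
    nlinarith
  · show |ε ^ 2 * _| ≤ c * (ε * _)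
    rw [habs]
    have k1 : ε * |(1 - τ) * m + M * q2| ≤ ε * (|m| + M * |q2|) := by gcongr
    have k2 : c * (hx / 2) ≤ c * ((1 - τ) * hx + ε * M * q1) := by gcongr
    have k3 : ε * (ε * |(1 - τ) * m + M * q2|) ≤ ε * (c * ((1 - τ) * hx + ε * M * q1)) := by
      exact mul_le_mul_of_nonneg_left (by linarith) hε.le
    nlinarith

end GlueH

end

section
set_option linter.unusedSectionVars false
set_option linter.unusedVariables false
open Set Filter Topology

theorem out_affine {V : Type} {G : SimpleGraph V} {S : Set V} {f : V → P2}
    (T : P2 ≃L[ℝ] P2) (w : P2) {x : P2} (hx : x ∈ OutSet (Dr G S f)) :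
    T (x - w) ∈ OutSet (Dr G S (fun x => T (f x - w))) := by
  set B : P2 → P2 := fun x => T.symm x + w with hB
  have hBA : ∀ x, B (T (x - w)) = x := fun x => by simp [hB]
  have hD : ∀ x, T (x - w) ∈ Dr G S (fun x => T (f x - w)) → x ∈ Dr G S f := by
    rintro x ⟨u, hu, v, hv, h1, a, b, ha, hb, hab, h2⟩
    refine ⟨u, hu, v, hv, h1, a, b, ha, hb, hab, ?_⟩
    simp only at h2
    rw [← map_smul, ← map_smul, ← map_add] at h2
    have h3 := T.injective h2
    have : w = a • w + b • w := by rw [← add_smul, hab, one_smul]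
    have h4 : a • (f u - w) + b • (f v - w) = a • f u + b • f v - w := by
      rw [smul_sub, smul_sub]
      nth_rewrite 3 [this]
      abel
    rw [h4] at h3
    exact sub_left_injective h3
  intro R
  obtain ⟨R', hR'⟩ : ∃ R', ∀ y, ‖y‖ ≤ R → ‖B y‖ ≤ R' := by
    have : IsCompact (B '' Metric.closedBall 0 R) :=
      (isCompact_closedBall (0 : P2) R).image (by fun_prop)
    obtain ⟨R', hR'⟩ := this.isBounded.exists_norm_le
    exact ⟨R', fun y hy => hR' _ ⟨y, by simpa using hy, rfl⟩⟩
  obtain ⟨q, hq, hj⟩ := hx R'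
  refine ⟨T (q - w), ?_, ?_⟩
  · by_contra hcon
    have := hR' _ (not_lt.mp hcon)
    rw [hBA] at this
    linarith
  · obtain ⟨γ, hγ⟩ := hj
    have hAc : Continuous fun x => T (x - w) := by fun_prop
    exact ⟨γ.map hAc, fun t hmem => hγ t (hD _ hmem)⟩

section
variable {V : Type} [Finite V] {G : SimpleGraph V} {A B : Set V} {v r : V} {f1 f2 : V → P2} {c K H : ℝ}

theorem glue_norm (h : GlueH G A B v f1 f2 c K H) (g1 : GoodOn G A r f1) (hr : r ∈ A)
    (g2 : GoodOn G B v f2) (hne : ∀ a ∈ A, a ≠ v → (f1 a).2 ≠ 0)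
    (hroot : r = v → ∃ φ : P2 →ₗ[ℝ] ℝ, (∀ x ∈ A, x ≠ v → φ (f1 v) < φ (f1 x)) ∧ 0 < φ (1, 0)) :
    ∃ f, GoodOn G (A ∪ B) r f := by
  -- injectivity
  have einj : ∀ᶠ ε in 𝓝[>] (0:ℝ), InjOn (gF A f1 f2 ε) (A ∪ B) := by
    have hw : ∀ᶠ ε in 𝓝[>] (0:ℝ), ∀ y, y ∈ B → y ≠ v → sqz ε (f2 y) ∉ Dr G A f1 := by
      rw [eventually_all]; intro y
      by_cases hy : y ∈ B
      · by_cases hyv : y ≠ v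
        · have h0 := h.pos y hy hyv
          filter_upwards [h.evW (f2 y).1 (|(f2 y).2| / (f2 y).1)] with ε hW _ _
          obtain ⟨a, b, c⟩ := hW (f2 y) h0 le_rfl (by rw [div_mul_cancel₀ _ h0.ne'])
          exact out_not_mem (h.wedge _ a b c)
        · exact Eventually.of_forall fun _ _ h => absurd h hyv
      · exact Eventually.of_forall fun _ h => absurd h hy
    filter_upwards [ev_pos, hw] with ε hε hw
    have key : ∀ x ∈ A, ∀ y ∈ B, gF A f1 f2 ε x = gF A f1 f2 ε y → x = y := by
      intro x hx y hy hxy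
      by_cases hyv : y = v
      · rw [hyv] at hxy ⊢
        rw [GlueH.fA hx, GlueH.fA h.vA] at hxy
        exact g1.inj hx h.vA hxy
      · exfalso
        rw [GlueH.fA hx, h.fB hy] at hxy
        exact hw y hy hyv (hxy ▸ mem_Dr_vertex hx)
    intro x hx y hy hxy
    rcases hx with hx | hx <;> rcases hy with hy | hy
    · rw [GlueH.fA hx, GlueH.fA hy] at hxy
      exact g1.inj hx hy hxy
    · exact key x hx y hy hxy
    · exact (key y hy x hx hxy.symm).symm
    · rw [h.fB hx, h.fB hy] at hxy
      exact g2.inj hx hy (sqz_inj hε hxy)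
  have eacc : ∀ᶠ ε in 𝓝[>] (0:ℝ), ∀ u w, u ∈ A ∪ B → w ∈ A ∪ B → u ≠ w → ¬ G.Adj u w →
      ∃ X ∈ segment ℝ (gF A f1 f2 ε u) (gF A f1 f2 ε w), X ∈ OutSet (Dr G (A ∪ B) (gF A f1 f2 ε)) := by
    rw [eventually_all]; intro u
    rw [eventually_all]; intro w
    simp only [eventually_imp_distrib_left]
    intro hu hw huw hadj
    have cA : u ∈ A → w ∈ A → ∀ᶠ ε in 𝓝[>] (0:ℝ), 
        ∃ X ∈ segment ℝ (gF A f1 f2 ε u) (gF A f1 f2 ε w), X ∈ OutSet (Dr G (A ∪ B) (gF A f1 f2 ε)) := by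
      intro hu hw
      obtain ⟨X, hX, hXo⟩ := g1.acc u hu w hw huw hadj
      filter_upwards [h.ev0 hXo] with ε he
      exact ⟨X, by rw [GlueH.fA hu, GlueH.fA hw]; exact hX, he⟩
    have cB : u ∈ B → w ∈ B → ∀ᶠ ε in 𝓝[>] (0:ℝ), 
        ∃ X ∈ segment ℝ (gF A f1 f2 ε u) (gF A f1 f2 ε w), X ∈ OutSet (Dr G (A ∪ B) (gF A f1 f2 ε)) := by
      intro hu hw
      obtain ⟨X, hX, hXo⟩ := g2.acc u hu w hw huw hadj
      have hX0 : 0 < X.1 := by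
        have hnn : ∀ y ∈ B, 0 ≤ (f2 y).1 := fun y hy => (h.bd _ (mem_Dr_vertex hy)).1
        obtain ⟨a, b, ha, hb, hab, rfl⟩ := hX
        have hXD := out_not_mem hXo
        have a0 : 0 < a := by
          rcases ha.eq_or_lt with h0 | h0
          · exfalso; apply hXD
            have : b = 1 := by linarith
            rw [← h0, this]; simpa using mem_Dr_vertex hw
          · exact h0
        have b0 : 0 < b := by
          rcases hb.eq_or_lt with h0 | h0
          · exfalso; apply hXD
            have : a = 1 := by linarith
            rw [← h0, this]; simpa using mem_Dr_vertex hu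
          · exact h0
        simp only [Prod.fst_add, Prod.smul_fst, smul_eq_mul]
        have h1 := hnn u hu
        have h2 := hnn w hw
        by_cases huv : u = v
        · have := h.pos w hw (fun h' => huw (huv.trans h'.symm))
          have := mul_pos b0 this
          nlinarith
        · have := mul_pos a0 (h.pos u hu huv)
          nlinarith
      filter_upwards [h.ev6 hXo hX0] with ε he
      exact ⟨sqz ε X, by rw [h.fB hu, h.fB hw]; exact sqz_mem_segment hX, he⟩
    rcases hu with hu | hu <;> rcases hw with hw | hw
    · exact cA hu hw
    · by_cases hwv : w = v
      · exact cA hu (hwv ▸ h.vA)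
      · by_cases huv : u = v
        · exact cB (huv ▸ h.vB) hw
        · exact h.cross hu (hne u hu huv) hw hwv
    · by_cases hwv : w = v
      · exact cB hu (hwv ▸ h.vB)
      · by_cases huv : u = v
        · exact cA (huv ▸ h.vA) hw
        · filter_upwards [h.cross hw (hne w hw hwv) hu huv] with ε he
          rw [segment_symm]; exact he
    · exact cB hu hw
  have eexp : ∀ᶠ ε in 𝓝[>] (0:ℝ), ∀ x, x ∈ A ∪ B →
      Exposed (Dr G (A ∪ B) (gF A f1 f2 ε)) (gF A f1 f2 ε x) := by
    rw [eventually_all]; intro x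
    simp only [eventually_imp_distrib_left]
    intro hx
    by_cases hxv : x = v
    · subst hxv; exact h.exp_v
    · rcases hx with hx | hx
      · exact h.exp_A g1.inj hx hxv (g1.exp x hx)
      · exact h.exp_B hx hxv (g2.exp x hx)
  have eroot : ∃ φ : P2 →ₗ[ℝ] ℝ, ∀ᶠ ε in 𝓝[>] (0:ℝ), ∀ x, x ∈ A ∪ B → x ≠ r →
      φ (gF A f1 f2 ε r) < φ (gF A f1 f2 ε x) := by
    by_cases hrv : r = v
    · obtain ⟨φ, hφ, hφ0⟩ := hroot hrv
      refine ⟨φ, ?_⟩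
      rw [eventually_all]; intro x
      simp only [eventually_imp_distrib_left]
      intro hx hxr
      subst hrv
      rcases hx with hx | hx
      · refine Eventually.of_forall fun ε => ?_
        rw [GlueH.fA hx, GlueH.fA hr]
        exact hφ x hx hxr
      · have h0 := mul_pos (h.pos x hx hxr) hφ0
        filter_upwards [ev_pos, ev_small (-((f2 x).2 * φ (0, 1))) h0] with ε hε h1
        rw [h.fB hx, h.fB h.vB, h.f2v, lin_coord φ (sqz ε 0), lin_coord φ (sqz ε (f2 x))]
        simp only [sqz, Prod.fst_zero, Prod.snd_zero, mul_zero, zero_mul, add_zero]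
        have : 0 < ε * ((f2 x).1 * φ (1, 0) + ε * ((f2 x).2 * φ (0, 1))) :=
          mul_pos hε (by linarith)
        nlinarith
    · obtain ⟨φ, hφ⟩ := g1.root
      refine ⟨φ, ?_⟩
      rw [eventually_all]; intro x
      simp only [eventually_imp_distrib_left]
      intro hx hxr
      by_cases hxA : x ∈ A
      · refine Eventually.of_forall fun ε => ?_
        rw [GlueH.fA hxA, GlueH.fA hr]
        exact hφ x hxA hxr
      · have hx : x ∈ B := hx.resolve_left hxA
        have h0 := hφ v h.vA (Ne.symm hrv)
        rw [h.f1v, map_zero] at h0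
        have hcont : Continuous fun ε : ℝ => φ (sqz ε (f2 x)) := by
          simp only [sqz]
          fun_prop
        have := (continuousAt_const.eventually_lt (hcont.continuousAt (x := 0)) (by
          have : sqz 0 (f2 x) = 0 := by ext <;> simp [sqz]
          rw [this, map_zero]; exact h0)).filter_mono (nhdsWithin_le_nhds (s := Ioi 0))
        filter_upwards [this] with ε he
        rw [GlueH.fA hr, h.fB hx]; exact he
  obtain ⟨φ, hφ⟩ := eroot
  obtain ⟨ε, h1, h2, h3, h4⟩ := (einj.and (eacc.and (eexp.and hφ))).exists
  exact ⟨gF A f1 f2 ε, h1, fun u hu w hw => h2 u w hu hw, fun x hx => h3 x hx, φ,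
    fun x hx => h4 x hx⟩

end

/-- Invertible linear maps of the plane. -/
noncomputable def lin2 (a b c d : ℝ) (h : a * d - b * c ≠ 0) : P2 ≃L[ℝ] P2 :=
  LinearEquiv.toContinuousLinearEquiv
  { toFun := fun p => (a * p.1 + b * p.2, c * p.1 + d * p.2)
    invFun := fun p => ((d * p.1 - b * p.2) / (a * d - b * c), (a * p.2 - c * p.1) / (a * d - b * c))
    map_add' := fun p q => by ext <;> simp <;> ring
    map_smul' := fun p q => by ext <;> simp <;> ring
    left_inv := fun p => by ext <;> simp only <;> rw [div_eq_iff h] <;> ring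
    right_inv := fun p => by
      ext <;> simp only <;> rw [mul_div_assoc', mul_div_assoc', ← add_div, div_eq_iff h] <;> ring }

theorem lin2_apply (a b c d : ℝ) (h : a * d - b * c ≠ 0) (p : P2) :
    lin2 a b c d h p = (a * p.1 + b * p.2, c * p.1 + d * p.2) := rfl

end

section
set_option linter.unusedSectionVars false
set_option linter.unusedVariables false
open Set Filter Topology

section
variable {V : Type} [Finite V] {G : SimpleGraph V} {A B : Set V} {v r : V} {f1 f2 : V → P2} {c K H : ℝ}

/-- Normalisation of the second piece. -/
theorem norm_B (hv : v ∈ B) (hB : ∃ b ∈ B, b ≠ v) (g : GoodOn G B v f2) :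
    ∃ f2', GoodOn G B v f2' ∧ f2' v = 0 ∧ (∀ y ∈ B, y ≠ v → 0 < (f2' y).1) ∧
      ∃ K H : ℝ, 0 ≤ K ∧ 0 ≤ H ∧ ∀ p ∈ Dr G B f2', 0 ≤ p.1 ∧ p.1 ≤ H ∧ |p.2| ≤ K * p.1 := by
  obtain ⟨φ, hφ⟩ := g.root
  set a := φ (1, 0) with ha
  set b := φ (0, 1) with hb
  have hn : a * a - b * (-b) ≠ 0 := by
    intro h0
    have a0 : a = 0 := pow_eq_zero_iff two_ne_zero |>.1 (show a ^ 2 = 0 by nlinarith [sq_nonneg a, sq_nonneg b])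
    have b0 : b = 0 := pow_eq_zero_iff two_ne_zero |>.1 (show b ^ 2 = 0 by nlinarith [sq_nonneg a, sq_nonneg b])
    obtain ⟨y, hy, hyv⟩ := hB
    have := hφ y hy hyv
    rw [lin_coord φ (f2 v), lin_coord φ (f2 y), ← ha, ← hb, a0, b0] at this
    simp at this
  set T := lin2 a b (-b) a hn with hT
  have hg := goodOn_affine T (f2 v) g
  set f := fun x => T (f2 x - f2 v) with hf
  have hfv : f v = 0 := by simp [hf]
  have hpos : ∀ y ∈ B, y ≠ v → 0 < (f y).1 := by
    intro y hy hyv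
    have := hφ y hy hyv
    rw [lin_coord φ (f2 v), lin_coord φ (f2 y), ← ha, ← hb] at this
    simp only [hf, hT, lin2_apply, Prod.fst_sub, Prod.snd_sub]
    linarith
  have hpos' : ∀ y ∈ B, 0 ≤ (f y).1 := by
    intro y hy
    by_cases hyv : y = v
    · rw [hyv, hfv]; simp
    · exact (hpos y hy hyv).le
  refine ⟨f, hg, hfv, hpos, ?_⟩
  obtain ⟨H, hH⟩ := (Set.finite_range (fun u => (f u).1)).bddAbove
  obtain ⟨K, hK⟩ := (Set.finite_range (fun u => |(f u).2| / (f u).1)).bddAbove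
  have hK0 : 0 ≤ K := by
    have := hK ⟨v, rfl⟩
    simpa [hfv] using this
  have hH0 : 0 ≤ H := by
    have := hH ⟨v, rfl⟩
    simpa [hfv] using this
  have hKv : ∀ y ∈ B, |(f y).2| ≤ K * (f y).1 := by
    intro y hy
    by_cases hyv : y = v
    · rw [hyv, hfv]; simp
    · have := hK ⟨y, rfl⟩
      simp only at this
      rwa [div_le_iff₀ (hpos y hy hyv)] at this
  refine ⟨K, H, hK0, hH0, ?_⟩
  rintro p ⟨u, hu, w, hw, -, s, t, hs, ht, hst, rfl⟩
  have h1 := hpos' u hu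
  have h2 := hpos' w hw
  have h3 : (f u).1 ≤ H := hH ⟨u, rfl⟩
  have h4 : (f w).1 ≤ H := hH ⟨w, rfl⟩
  have h5 := hKv u hu
  have h6 := hKv w hw
  simp only [Prod.fst_add, Prod.snd_add, Prod.smul_fst, Prod.smul_snd, smul_eq_mul]
  refine ⟨by positivity, ?_, ?_⟩
  · have : H = s * H + t * H := by rw [← add_mul, hst, one_mul]
    rw [this]; gcongr
  · have := abs_add_le (s * (f u).2) (t * (f w).2)
    rw [abs_mul, abs_mul, abs_of_nonneg hs, abs_of_nonneg ht] at this
    have h7 : s * |(f u).2| ≤ s * (K * (f u).1) := by gcongr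
    have h8 : t * |(f w).2| ≤ t * (K * (f w).1) := by gcongr
    linarith

theorem generic_dir (d : P2) (Q : Set P2) (hQ : Q.Finite) (h0 : ∀ q ∈ Q, q ≠ 0) :
    ∀ᶠ t in 𝓝[>] (0:ℝ), ∀ q ∈ Q, (d.1 + t) * q.2 - (d.2 + t ^ 2) * q.1 ≠ 0 := by
  rw [Set.Finite.eventually_all hQ]
  intro q hq
  by_cases hq1 : q.1 = 0
  · have hq2 : q.2 ≠ 0 := fun h => h0 q hq (Prod.ext hq1 h)
    filter_upwards [ev_pos, quad_eventually_ne (a := 0) (b := d.1 * q.2) hq2] with t ht h2 h3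
    apply h2
    rw [hq1] at h3
    linear_combination t * h3
  · filter_upwards [quad_eventually_ne (a := d.1 * q.2 - d.2 * q.1) (b := q.2) (neg_ne_zero.2 hq1)]
      with t h2 h3
    apply h2
    linear_combination h3

theorem norm_A (hv : v ∈ A) (hA : ∃ a ∈ A, a ≠ v) (hr : r ∈ A) (g : GoodOn G A r f1) :
    ∃ f1', GoodOn G A r f1' ∧ f1' v = 0 ∧ (∀ a ∈ A, a ≠ v → (f1' a).2 ≠ 0) ∧
      (∃ c > 0, ∀ p : P2, 0 < p.1 → p.1 ≤ c → |p.2| ≤ c * p.1 → p ∈ OutSet (Dr G A f1')) ∧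
      (r = v → ∃ φ : P2 →ₗ[ℝ] ℝ, (∀ x ∈ A, x ≠ v → φ (f1' v) < φ (f1' x)) ∧ 0 < φ (1, 0)) := by
  have hcone : ∃ d : P2, (∃ c > 0, ∀ s : ℝ, 0 < s → s ≤ c → ∀ e : P2, ‖e - d‖ ≤ c →
      f1 v + s • e ∈ OutSet (Dr G A f1)) ∧
      (r = v → ∃ φ : P2 →ₗ[ℝ] ℝ, (∀ x ∈ A, x ≠ v → φ (f1 v) < φ (f1 x)) ∧ 0 < φ d) := by
    by_cases hrv : r = v
    · subst hrv
      obtain ⟨φ, hφ⟩ := g.root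
      set a := φ (1, 0) with ha
      set b := φ (0, 1) with hb
      have hn : 0 < a ^ 2 + b ^ 2 := by
        by_contra h0
        have a0 : a = 0 := pow_eq_zero_iff two_ne_zero |>.1 (show a ^ 2 = 0 by nlinarith [sq_nonneg a, sq_nonneg b])
        have b0 : b = 0 := pow_eq_zero_iff two_ne_zero |>.1 (show b ^ 2 = 0 by nlinarith [sq_nonneg a, sq_nonneg b])
        obtain ⟨y, hy, hyv⟩ := hA
        have := hφ y hy hyv
        rw [lin_coord φ (f1 r), lin_coord φ (f1 y), ← ha, ← hb, a0, b0] at this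
        simp at this
      have hκ : ∀ᶠ κ in 𝓝[>] (0:ℝ), ∀ x, x ∈ A → x ≠ r →
          (φ - κ • linF (-b) a) (f1 r) < (φ - κ • linF (-b) a) (f1 x) := by
        rw [eventually_all]; intro x
        simp only [eventually_imp_distrib_left]
        intro hx hxr
        have h1 := hφ x hx hxr
        filter_upwards [ev_small (linF (-b) a (f1 x) - linF (-b) a (f1 r)) (sub_pos.2 h1)] with κ hk
        simp only [LinearMap.sub_apply, LinearMap.smul_apply, smul_eq_mul]
        linarith
      obtain ⟨κ, hκ0, hκ⟩ := (ev_pos.and hκ).exists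
      refine ⟨(-b + κ / 2 * a, a + κ / 2 * b), exposed_of_extreme (φ := φ - κ • linF (-b) a) hκ ?_,
        fun _ => ⟨φ, hφ, ?_⟩⟩
      · simp only [LinearMap.sub_apply, LinearMap.smul_apply, smul_eq_mul, linF_apply]
        rw [lin_coord φ, ← ha, ← hb]
        simp only
        have := mul_pos hκ0 hn
        nlinarith
      · rw [lin_coord φ, ← ha, ← hb]
        simp only
        have := mul_pos hκ0 hn
        nlinarith
    · obtain ⟨d, c, hc, h⟩ := g.exp v hv
      exact ⟨d, ⟨c, hc, h⟩, fun h => absurd h hrv⟩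
  obtain ⟨d, ⟨c, hc, hcone⟩, hroot⟩ := hcone
  have hgen := generic_dir d ((fun x => f1 x - f1 v) '' {x | x ∈ A ∧ x ≠ v}) (Set.toFinite _) (by
    rintro _ ⟨x, ⟨hx, hxv⟩, rfl⟩ h0
    exact hxv (g.inj hx hv (sub_eq_zero.1 h0)))
  have hcont : Continuous fun t : ℝ => ((d.1 + t, d.2 + t ^ 2) : P2) := by fun_prop
  have hclose : ∀ᶠ t in 𝓝[>] (0:ℝ), ‖((d.1 + t, d.2 + t ^ 2) : P2) - d‖ < c / 2 := by
    have : Continuous fun t : ℝ => ‖((d.1 + t, d.2 + t ^ 2) : P2) - d‖ := by fun_prop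
    exact ((this.continuousAt (x := 0)).eventually_lt continuousAt_const (by
      simp; exact hc)).filter_mono nhdsWithin_le_nhds
  have hphi : ∀ᶠ t in 𝓝[>] (0:ℝ), (r = v → ∃ φ : P2 →ₗ[ℝ] ℝ,
      (∀ x ∈ A, x ≠ v → φ (f1 v) < φ (f1 x)) ∧ 0 < φ (d.1 + t, d.2 + t ^ 2)) := by
    simp only [eventually_imp_distrib_left]
    intro hrv
    obtain ⟨φ, hφ, hφd⟩ := hroot hrv
    have hcφ : Continuous φ := LinearMap.continuous_of_finiteDimensional φ
    have := ((continuousAt_const.eventually_lt ((hcφ.comp hcont).continuousAt (x := 0)) (by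
      simpa using hφd)).filter_mono (nhdsWithin_le_nhds (s := Ioi (0:ℝ))))
    filter_upwards [this] with t ht
    exact ⟨φ, hφ, ht⟩
  obtain ⟨t, hgen, hclose, hphi⟩ := (hgen.and (hclose.and hphi)).exists
  set d1 := d.1 + t with hd1
  set d2 := d.2 + t ^ 2 with hd2
  have hn : d1 ^ 2 + d2 ^ 2 ≠ 0 := by
    intro h0
    have a0 : d1 = 0 := pow_eq_zero_iff two_ne_zero |>.1 (show d1 ^ 2 = 0 by nlinarith [sq_nonneg d1, sq_nonneg d2])
    have b0 : d2 = 0 := pow_eq_zero_iff two_ne_zero |>.1 (show d2 ^ 2 = 0 by nlinarith [sq_nonneg d1, sq_nonneg d2])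
    obtain ⟨y, hy, hyv⟩ := hA
    have := hgen _ ⟨y, ⟨hy, hyv⟩, rfl⟩
    rw [a0, b0] at this
    simp at this
  set n := d1 ^ 2 + d2 ^ 2 with hnn
  have hdet : d1 / n * d1 - d2 / n * (-d2) ≠ 0 := by
    have : d1 / n * d1 - d2 / n * (-d2) = 1 := by
      field_simp; rw [hnn]; ring
    rw [this]; exact one_ne_zero
  set T := lin2 (d1 / n) (d2 / n) (-d2) d1 hdet with hT
  have hg := goodOn_affine T (f1 v) g
  have hTd : T (d1, d2) = (1, 0) := by
    rw [hT, lin2_apply]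
    ext
    · simp only; field_simp; rw [hnn]
    · simp only; ring
  have hTo : T (-d2 / n, d1 / n) = (0, 1) := by
    rw [hT, lin2_apply]
    ext
    · simp only; field_simp; ring
    · simp only; field_simp; rw [hnn]; ring
  refine ⟨_, hg, by simp, ?_, ?_, ?_⟩
  · intro a ha hav
    have := hgen _ ⟨a, ⟨ha, hav⟩, rfl⟩
    simp only [hT, lin2_apply]
    intro h0
    apply this
    linear_combination h0
  · set o : P2 := (-d2 / n, d1 / n) with ho
    set c' := min c (c / 2 / (‖o‖ + 1)) with hc'
    have ho0 : 0 < ‖o‖ + 1 := by positivity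
    refine ⟨c', by positivity, ?_⟩
    intro p p0 p1 p2
    set τ := p.2 / p.1 with hτ
    have hτc : |τ| ≤ c' := by
      rw [hτ, abs_div, abs_of_pos p0, div_le_iff₀ p0]; exact p2
    have hτo : |τ| * ‖o‖ ≤ c / 2 := by
      have h1 : |τ| ≤ c / 2 / (‖o‖ + 1) := hτc.trans (min_le_right _ _)
      rw [le_div_iff₀ ho0] at h1
      nlinarith [abs_nonneg τ]
    have he : ‖((d1, d2) : P2) + τ • o - d‖ ≤ c := by
      have h1 := norm_add_le (((d1, d2) : P2) - d) (τ • o)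
      rw [norm_smul, Real.norm_eq_abs] at h1
      have h2 : ((d1, d2) : P2) + τ • o - d = ((d1, d2) : P2) - d + τ • o := by abel
      rw [h2]; linarith
    have h3 := out_affine T (f1 v) (hcone p.1 p0 (p1.trans (min_le_left _ _)) _ he)
    convert h3 using 1
    rw [add_sub_cancel_left, map_smul, map_add, map_smul, hTd, hTo]
    ext
    · simp
    · simp [hτ]; field_simp
  · intro hrv
    obtain ⟨φ, hφ, hφ0⟩ := hphi hrv
    refine ⟨φ.comp (T.symm : P2 →ₗ[ℝ] P2), ?_, ?_⟩
    · intro x hx hxv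
      have := hφ x hx hxv
      simp
      linarith
    · have : (T.symm (1, 0) : P2) = (d1, d2) := by rw [← hTd]; simp
      simp only [LinearMap.comp_apply]
      show 0 < φ (T.symm (1, 0))
      rw [this]; exact hφ0

theorem glue (hvA : v ∈ A) (hvB : v ∈ B) (hAB : ∀ x, x ∈ A → x ∈ B → x = v)
    (hno : ∀ a ∈ A, ∀ b ∈ B, a ≠ v → b ≠ v → ¬ G.Adj a b)
    (hA : ∃ a ∈ A, a ≠ v) (hB : ∃ b ∈ B, b ≠ v) (hr : r ∈ A)
    (h1 : ∃ f, GoodOn G A r f) (h2 : ∃ f, GoodOn G B v f) : ∃ f, GoodOn G (A ∪ B) r f := by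
  obtain ⟨f1, g1⟩ := h1
  obtain ⟨f2, g2⟩ := h2
  obtain ⟨f1, g1, h1v, hne, ⟨c, hc, hw⟩, hroot⟩ := norm_A hvA hA hr g1
  obtain ⟨f2, g2, h2v, hpos, K, H, hK, hH, hbd⟩ := norm_B hvB hB g2
  exact glue_norm ⟨hvA, hvB, hAB, hno, h1v, h2v, hpos, hc, hw, hK, hH, hbd⟩ g1 hr g2 hne hroot

end

end

section
set_option linter.unusedSectionVars false
set_option linter.unusedVariables false
open Set Filter Topology

section
variable {V : Type} {G : SimpleGraph V} {S C O : Set V}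

/-- `S` induces a graph without cut vertices. -/
def TwoC (G : SimpleGraph V) (S : Set V) : Prop :=
  ∀ v ∈ S, ∀ X : Set V, X ⊆ S → v ∉ X → X.Nonempty → (∃ y ∈ S, y ≠ v ∧ y ∉ X) →
    ∃ x ∈ X, ∃ y ∈ S, y ≠ v ∧ y ∉ X ∧ G.Adj x y

theorem main_ind [Finite V] (base : ∀ S r, r ∈ S → TwoC G S → ∃ f, GoodOn G S r f) :
    ∀ n (S : Set V), S.ncard = n → ∀ r ∈ S, ∃ f, GoodOn G S r f := by
  intro n
  induction n using Nat.strong_induction_on with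
  | _ n ih =>
  intro S hS r hr
  by_cases h2 : TwoC G S
  · exact base S r hr h2
  · unfold TwoC at h2
    push Not at h2
    obtain ⟨v, hv, X, hXS, hvX, hXne, ⟨y, hy, hyv, hyX⟩, hno⟩ := h2
    obtain ⟨x, hx⟩ := hXne
    set A : Set V := insert v X with hA
    set B : Set V := S \ X with hB
    have hAB : A ∪ B = S := by
      ext z
      simp only [hA, hB, mem_union, mem_insert_iff, Set.mem_sdiff]
      constructor
      · rintro ((rfl | h) | h)
        · exact hv
        · exact hXS h
        · exact h.1
      · intro h
        by_cases hz : z ∈ X <;> simp [hz, h]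
    have hAS : A ⊂ S := by
      refine ⟨fun z hz => hAB ▸ Or.inl hz, fun h => ?_⟩
      rcases h hy with h | h
      · exact hyv h
      · exact hyX h
    have hBS : B ⊂ S := by
      refine ⟨fun z hz => hz.1, fun h => ?_⟩
      exact (h (hXS hx)).2 hx
    have hvA : v ∈ A := Or.inl rfl
    have hvB : v ∈ B := ⟨hv, hvX⟩
    have hint : ∀ z, z ∈ A → z ∈ B → z = v := by
      rintro z (h | h) h'
      · exact h
      · exact absurd h h'.2
    have hedge : ∀ a ∈ A, ∀ b ∈ B, a ≠ v → b ≠ v → ¬ G.Adj a b := by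
      intro a ha b hb hav hbv
      exact hno a (ha.resolve_left hav) b hb.1 hbv hb.2
    have iA := ih A.ncard (hS ▸ Set.ncard_lt_ncard hAS (Set.toFinite _)) A rfl
    have iB := ih B.ncard (hS ▸ Set.ncard_lt_ncard hBS (Set.toFinite _)) B rfl
    have hA' : ∃ a ∈ A, a ≠ v := ⟨x, Or.inr hx, fun h => hvX (h ▸ hx)⟩
    have hB' : ∃ b ∈ B, b ≠ v := ⟨y, ⟨hy, hyX⟩, hyv⟩
    rw [← hAB] at hr ⊢
    rcases hr with hr | hr
    · exact glue hvA hvB hint hedge hA' hB' hr (iA r hr) (iB v hvB)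
    · rw [union_comm]
      exact glue hvB hvA (fun z h1 h2 => hint z h2 h1)
        (fun a ha b hb hav hbv hadj => hedge b hb a ha hbv hav hadj.symm) hB' hA' hr (iB r hr) (iA v hvA)

/-- Paths inside `O`, as lists. -/
def IsPth (G : SimpleGraph V) (O : Set V) (l : List V) : Prop :=
  l.Nodup ∧ l.IsChain G.Adj ∧ ∀ x ∈ l, x ∈ O

/-- Cycles inside `S`, as lists. -/
def CycL (G : SimpleGraph V) (S : Set V) (l : List V) : Prop :=
  3 ≤ l.length ∧ IsPth G S l ∧ ∀ x y, l.head? = some x → l.getLast? = some y → G.Adj y x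

/-- Reachability inside `O`. -/
def Rch (G : SimpleGraph V) (O : Set V) (x y : V) : Prop :=
  Relation.ReflTransGen (fun a b => G.Adj a b ∧ b ∈ O) x y

theorem Rch.mem {x y : V} (hx : x ∈ O) (h : Rch G O x y) : y ∈ O := by
  induction h with
  | refl => exact hx
  | tail _ h _ => exact h.2

theorem Rch.path {x y : V} (hx : x ∈ O) (h : Rch G O x y) :
    ∃ l, IsPth G O l ∧ l.head? = some x ∧ l.getLast? = some y := by
  induction h using Relation.ReflTransGen.head_induction_on with
  | refl => exact ⟨[y], ⟨by simp, by simp, by simpa using hx⟩, by simp, by simp⟩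
  | @head a c hac _ ih =>
    obtain ⟨l, ⟨h1, h2, h3⟩, h4, h5⟩ := ih hac.2
    by_cases ha : a ∈ l
    · obtain ⟨s, t, rfl⟩ := List.append_of_mem ha
      refine ⟨a :: t, ⟨h1.of_append_right, h2.right_of_append, fun z hz => h3 z (by
        simp only [List.mem_append]; exact Or.inr hz)⟩, by simp, ?_⟩
      rw [List.getLast?_append] at h5
      have : (a :: t).getLast?.isSome := by simp
      obtain ⟨w, hw⟩ := Option.isSome_iff_exists.1 this
      rw [hw] at h5 ⊢
      simpa using h5
    · cases l with
      | nil => simp at h4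
      | cons b t =>
        simp only [List.head?_cons, Option.some.injEq] at h4
        subst h4
        refine ⟨a :: b :: t, ⟨by simp only [List.nodup_cons] at *; exact ⟨ha, h1⟩, ?_, ?_⟩, by simp, ?_⟩
        · rw [List.isChain_cons_cons]; exact ⟨hac.1, h2⟩
        · intro z hz
          rcases List.mem_cons.1 hz with rfl | hz
          · exact hx
          · exact h3 z hz
        · rw [List.getLast?_cons_cons]; exact h5

theorem Rch.symm {x y : V} (hx : x ∈ O) (h : Rch G O x y) : Rch G O y x := by
  induction h with
  | refl => exact Relation.ReflTransGen.refl
  | @tail b c hb hbc ih =>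
    have hbO : b ∈ O := Rch.mem hx hb
    exact Relation.ReflTransGen.head ⟨hbc.1.symm, hbO⟩ ih

/-- If `X` is closed inside `O`, there is an edge leaving to `S \ O` avoiding `v`. -/
theorem TwoC.leave (h2 : TwoC G S) {v x y : V} (hO : O ⊆ S) (hv : v ∈ S) (hvO : v ∉ O) (hx : x ∈ O)
    (hy : y ∈ S) (hyv : y ≠ v) (hyn : ¬ Rch G O x y) :
    ∃ z w, Rch G O x z ∧ w ∈ S ∧ w ∉ O ∧ w ≠ v ∧ G.Adj z w := by
  obtain ⟨z, hz, w, hwS, hwv, hwX, hadj⟩ := h2 v hv {z | Rch G O x z} (fun z hz => hO (Rch.mem hx hz))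
    (fun h => hvO (Rch.mem hx h)) ⟨x, Relation.ReflTransGen.refl⟩ ⟨y, hy, hyv, hyn⟩
  refine ⟨z, w, hz, hwS, fun hwO => hwX ?_, hwv, hadj⟩
  exact Relation.ReflTransGen.tail hz ⟨hadj, hwO⟩

/-- Ears on `C` have at most two inner vertices. -/
def EarTwo (G : SimpleGraph V) (S C : Set V) : Prop :=
  ∀ l, IsPth G (S \ C) l → ∀ x y, l.head? = some x → l.getLast? = some y →
    ∀ c ∈ C, ∀ c' ∈ C, c ≠ c' → G.Adj x c → G.Adj y c' → l.length ≤ 2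

theorem E2 (h2 : TwoC G S) (hCS : C ⊆ S) (hC : C.Nontrivial) (he : EarTwo G S C) {h c : V}
    (hh : h ∈ S) (hhC : h ∉ C) (hc : c ∈ C) (hadj : G.Adj h c) :
    ∃ c' ∈ C, c' ≠ c ∧ (G.Adj h c' ∨ ∃ h' ∈ S, h' ∉ C ∧ G.Adj h h' ∧ G.Adj h' c') := by
  obtain ⟨c1, hc1, hc1c⟩ := hC.exists_ne c
  have hO : h ∈ S \ C := ⟨hh, hhC⟩
  obtain ⟨z, w, hz, hwS, hwO, hwc, hzw⟩ := h2.leave (O := S \ C) sdiff_subset (hCS hc)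
    (fun h => h.2 hc) hO (hCS hc1) hc1c (fun h' => (Rch.mem hO h').2 hc1)
  have hwC : w ∈ C := by
    by_contra h; exact hwO ⟨hwS, h⟩
  refine ⟨w, hwC, hwc, ?_⟩
  obtain ⟨l, hl, hl1, hl2⟩ := Rch.path hO hz
  have hlen := he l hl h z hl1 hl2 c hc w hwC (Ne.symm hwc) hadj hzw
  match l, hl, hl1, hl2, hlen with
  | [a], hl, hl1, hl2, _ =>
    simp at hl1 hl2; subst hl1; subst hl2; exact Or.inl hzw
  | [a, b], hl, hl1, hl2, _ =>
    simp at hl1 hl2; subst hl1; subst hl2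
    refine Or.inr ⟨b, (hl.2.2 b (by simp)).1, (hl.2.2 b (by simp)).2, ?_, hzw⟩
    simpa using hl.2.1

theorem E1 (h2 : TwoC G S) (hCS : C ⊆ S) (hC : C.Nontrivial) (he : EarTwo G S C) {h : V}
    (hh : h ∈ S) (hhC : h ∉ C) : ∃ c ∈ C, G.Adj h c := by
  by_contra hno
  have hO : h ∈ S \ C := ⟨hh, hhC⟩
  obtain ⟨c0, hc0, c1, hc1, hc01⟩ := hC
  -- find the frontier
  obtain ⟨g, g1, hg, hg1, hgg1, hgno, hg1c⟩ : ∃ g g1, g ∈ S \ C ∧ g1 ∈ S \ C ∧ G.Adj g g1 ∧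
      (¬ ∃ c ∈ C, G.Adj g c) ∧ ∃ c ∈ C, G.Adj g1 c := by
    obtain ⟨z, w, hz, hwS, hwO, hwc, hzw⟩ := h2.leave (O := S \ C) sdiff_subset (hCS hc0)
      (fun h => h.2 hc0) hO (hCS hc1) (Ne.symm hc01) (fun h' => (Rch.mem hO h').2 hc1)
    have hwC : w ∈ C := by
      by_contra h; exact hwO ⟨hwS, h⟩
    have hzc : ∃ c ∈ C, G.Adj z c := ⟨w, hwC, hzw⟩
    by_contra hcon
    have : ∀ z, Rch G (S \ C) h z → ¬ ∃ c ∈ C, G.Adj z c := by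
      intro z hz
      induction hz with
      | refl => exact hno
      | @tail a b ha hab ih =>
        intro hb
        exact hcon ⟨a, b, Rch.mem hO ha, hab.2, hab.1, ih, hb⟩
    exact this z hz hzc
  obtain ⟨c, hc, hg1c⟩ := hg1c
  set O' : Set V := (S \ C) \ {g1} with hO'
  have hgO' : g ∈ O' := ⟨hg, fun h => hgg1.ne h⟩
  obtain ⟨x, w, hx, hwS, hwO, hwg1, hxw⟩ := h2.leave (O := O') (fun z hz => hz.1.1) hg1.1
    (fun h => h.2 rfl) hgO' (hCS hc0) (fun h => hg1.2 (h ▸ hc0)) (fun h' => (Rch.mem hgO' h').1.2 hc0)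
  have hwC : w ∈ C := by
    by_contra h; exact hwO ⟨⟨hwS, h⟩, hwg1⟩
  obtain ⟨q, hq, hq1, hq2⟩ := hx.path hgO'
  -- q starts with g
  obtain ⟨t, rfl⟩ : ∃ t, q = g :: t := by
    cases q with
    | nil => simp at hq1
    | cons a t => simp at hq1; exact ⟨t, by rw [hq1]⟩
  have htne : t ≠ [] := by
    rintro rfl
    simp at hq2
    exact hgno ⟨w, hwC, hq2 ▸ hxw⟩
  have hmemO : ∀ z ∈ g :: t, z ∈ S \ C := fun z hz => (hq.2.2 z hz).1
  have hg1n : g1 ∉ g :: t := fun h => (hq.2.2 _ h).2 rfl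
  -- path from g1 along q
  have hpath : IsPth G (S \ C) (g1 :: g :: t) := by
    refine ⟨List.nodup_cons.2 ⟨hg1n, hq.1⟩, List.isChain_cons_cons.2 ⟨hgg1.symm, hq.2.1⟩, ?_⟩
    intro z hz
    rcases List.mem_cons.1 hz with rfl | hz
    · exact hg1
    · exact hmemO z hz
  have hsame : ∀ d ∈ C, G.Adj g1 d → ∀ d' ∈ C, G.Adj x d' → d = d' := by
    intro d hd hd1 d' hd' hd2
    by_contra hne
    have := he _ hpath g1 x (by simp) (by rw [List.getLast?_cons_cons]; exact hq2) d hd d' hd' hne hd1 hd2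
    cases t with
    | nil => exact htne rfl
    | cons => simp at this
  obtain ⟨c', hc', hcc', hE⟩ := E2 h2 hCS ⟨c0, hc0, c1, hc1, hc01⟩ he hg1.1 hg1.2 hc hg1c
  have hcw := hsame c hc hg1c w hwC hxw
  rcases hE with hE | ⟨g', hgSS, hgCC, hg1g', hgcc⟩
  · exact hcc' (by rw [hsame c' hc' hE w hwC hxw, hcw])
  · by_cases hg'q : g' ∈ g :: t
    · have hgng : g' ≠ g := fun h => hgno ⟨c', hc', h ▸ hgcc⟩
      have hg't : g' ∈ t := (List.mem_cons.1 hg'q).resolve_left hgng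
      obtain ⟨s, u, rfl⟩ := List.append_of_mem hg't
      have hp' : IsPth G (S \ C) (g1 :: g :: (s ++ [g'])) := by
        have e : g1 :: g :: (s ++ g' :: u) = (g1 :: g :: (s ++ [g'])) ++ u := by simp
        rw [e] at hpath
        exact ⟨hpath.1.of_append_left, hpath.2.1.left_of_append, fun z hz => hpath.2.2 z (by
          simp only [List.mem_append]; exact Or.inl hz)⟩
      have := he _ hp' g1 g' (by simp) (by simp [List.getLast?_cons_cons, List.getLast?_cons]) c hc c' hc' (Ne.symm hcc') hg1c hgcc
      simp at this
    · have hp' : IsPth G (S \ C) (g' :: g1 :: g :: t) := by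
        refine ⟨List.nodup_cons.2 ⟨?_, hpath.1⟩, List.isChain_cons_cons.2 ⟨hg1g'.symm, hpath.2.1⟩, ?_⟩
        · intro h
          rcases List.mem_cons.1 h with h | h
          · exact hg1g'.ne h.symm
          · exact hg'q h
        · intro z hz
          rcases List.mem_cons.1 hz with rfl | hz
          · exact ⟨hgSS, hgCC⟩
          · exact hpath.2.2 z hz
      have := he _ hp' g' x (by simp) (by rw [List.getLast?_cons_cons, List.getLast?_cons_cons]; exact hq2)
        c' hc' w hwC (fun h => hcc' (h.trans hcw.symm)) hgcc hxw
      simp at this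

end

end

section
set_option linter.unusedSectionVars false
set_option linter.unusedVariables false
open Set Filter Topology

section
open scoped Fin.NatCast Fin.CommRing
variable {V : Type} {G : SimpleGraph V} {S C O : Set V}

theorem walk_close {u v : V} (p : G.Walk u v) (hp : p.IsPath) (hl : 2 ≤ p.length) (h : G.Adj v u) :
    (SimpleGraph.Walk.cons h p).IsCycle := by
  refine (SimpleGraph.Walk.cons_isCycle_iff p h).2 ⟨hp, ?_⟩
  cases p with
  | nil => simp at hl
  | @cons _ w _ huw q =>
    intro hmem
    rw [SimpleGraph.Walk.edges_cons, List.mem_cons] at hmem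
    rw [SimpleGraph.Walk.cons_isPath_iff] at hp
    rcases hmem with hmem | hmem
    · have hl' : v = w := by
        rcases Sym2.eq_iff.1 hmem with h' | h'
        · exact absurd h'.2 huw.ne
        · exact h'.1
      subst hl'
      have := SimpleGraph.Walk.isPath_iff_eq_nil.1 hp.1
      subst this
      simp at hl
    · exact hp.2 (SimpleGraph.Walk.snd_mem_support_of_mem_edges _ hmem)

theorem CycL.walk {l : List V} (h : CycL G S l) : ∃ (v : V) (w : G.Walk v v), w.IsCycle ∧ w.length = l.length := by
  obtain ⟨hlen, ⟨hnd, hch, _⟩, hcl⟩ := h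
  have hne : l ≠ [] := by rintro rfl; simp at hlen
  have hps := SimpleGraph.Walk.support_ofSupport hne hch
  generalize SimpleGraph.Walk.ofSupport l hne hch = p at hps
  have hadj : G.Adj (l.getLast hne) (l.head hne) :=
    hcl _ _ (List.head?_eq_some_head hne) (List.getLast?_eq_some_getLast hne)
  have hl : p.length + 1 = l.length := by rw [← SimpleGraph.Walk.length_support p, hps]
  refine ⟨_, SimpleGraph.Walk.cons hadj p, walk_close p ?_ (by omega) hadj, ?_⟩
  · rw [SimpleGraph.Walk.isPath_def, hps]; exact hnd
  · rw [SimpleGraph.Walk.length_cons, hl]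

/-- Cycles in a set as cyclic sequences. -/
structure CycF (G : SimpleGraph V) (S : Set V) (n : ℕ) [NeZero n] (c : Fin n → V) : Prop where
  three : 3 ≤ n
  inj : Function.Injective c
  mem : ∀ i, c i ∈ S
  adj : ∀ i, G.Adj (c i) (c (i + 1))

theorem CycL.toF {l : List V} (h : CycL G S l) : ∃ (n : ℕ) (_ : NeZero n) (c : Fin n → V), n = l.length ∧ CycF G S n c := by
  obtain ⟨hlen, ⟨hnd, hch, hm⟩, hcl⟩ := h
  have hz : NeZero l.length := ⟨by omega⟩
  refine ⟨l.length, hz, l.get, rfl, hlen, List.nodup_iff_injective_get.1 hnd, fun i => hm _ (List.get_mem _ _), ?_⟩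
  intro i
  by_cases hi : i.val + 1 < l.length
  · have h1 := List.isChain_iff_getElem.1 hch i.val hi
    have : (i + 1 : Fin l.length).val = i.val + 1 := by
      rw [Fin.val_add, Fin.val_one', Nat.mod_eq_of_lt (show 1 < l.length by omega), Nat.mod_eq_of_lt hi]
    simp only [List.get_eq_getElem, this]
    exact h1
  · have hi' : i.val + 1 = l.length := by have := i.2; omega
    have : (i + 1 : Fin l.length).val = 0 := by
      rw [Fin.val_add, Fin.val_one', Nat.mod_eq_of_lt (show 1 < l.length by omega), hi', Nat.mod_self]
    simp only [List.get_eq_getElem, this]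
    apply hcl
    · rw [List.head?_eq_getElem?]; simp
    · rw [List.getLast?_eq_getElem?, List.getElem?_eq_getElem (by omega)]
      congr 2; omega

/-- Existence of a cycle. -/
theorem TwoC.cyc [Finite V] (h2 : TwoC G S) (h3 : 3 ≤ S.ncard) : ∃ l, CycL G S l := by
  obtain ⟨x, y0, z0, hx, hy0, hz0, hxy0, hxz0, hyz0⟩ := (Set.two_lt_ncard_iff (Set.toFinite S)).1 (by omega : 2 < S.ncard)
  obtain ⟨x', hx', y, hy, -, hyx, hxy⟩ := h2 y0 hy0 {x} (by simpa using hx) (by simpa using Ne.symm hxy0) ⟨x, rfl⟩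
    ⟨z0, hz0, Ne.symm hyz0, by simpa using Ne.symm hxz0⟩
  obtain rfl : x' = x := hx'
  have hyx' : y ≠ x' := by simpa using hyx
  obtain ⟨w0, hw0, hw0x, hw0y⟩ : ∃ w ∈ S, w ≠ x' ∧ w ≠ y := by
    by_cases h : y0 = y
    · exact ⟨z0, hz0, Ne.symm hxz0, fun h' => hyz0 (h.trans h'.symm)⟩
    · exact ⟨y0, hy0, Ne.symm hxy0, h⟩
  obtain ⟨x'', hx'', z, hz, hzy, hzx, hxz⟩ := h2 y hy {x'} (by simpa using hx) (by simpa using hyx') ⟨x', rfl⟩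
    ⟨w0, hw0, hw0y, by simpa using hw0x⟩
  obtain rfl : x'' = x' := hx''
  have hzx' : z ≠ x'' := by simpa using hzx
  have hzO : z ∈ S \ {x''} := ⟨hz, hzx'⟩
  have hyO : y ∈ S \ {x''} := ⟨hy, hyx'⟩
  have hR : Rch G (S \ {x''}) z y := by
    by_contra hn
    obtain ⟨a, w, _, hwS, hwO, hwx, _⟩ := h2.leave (O := S \ {x''}) sdiff_subset hx (fun h => h.2 rfl) hzO hy hyx' hn
    exact hwO ⟨hwS, hwx⟩
  obtain ⟨l, ⟨hl1, hl2, hl3⟩, hlh, hll⟩ := Rch.path hzO hR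
  match l, hl1, hl2, hl3, hlh, hll with
  | [a], _, _, _, hlh, hll =>
    simp at hlh hll; exact absurd (hlh.symm.trans hll) hzy
  | a :: b :: t, hl1, hl2, hl3, hlh, hll =>
    simp only [List.head?_cons, Option.some.injEq] at hlh
    subst hlh
    refine ⟨x'' :: a :: b :: t, by simp, ⟨List.nodup_cons.2 ⟨fun h => (hl3 _ h).2 rfl, hl1⟩,
      List.isChain_cons_cons.2 ⟨hxz, hl2⟩, ?_⟩, ?_⟩
    · intro w hw
      rcases List.mem_cons.1 hw with rfl | hw
      · exact hx
      · exact (hl3 w hw).1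
    · intro u v hu hv
      rw [List.getLast?_cons_cons, hll] at hv
      simp only [List.head?_cons, Option.some.injEq] at hu hv
      subst hu; subst hv; exact hxy.symm

theorem CycF.ear {n : ℕ} [NeZero n] {c : Fin n → V} (hc : CycF G S n c)
    (hmax : ∀ l, CycL G S l → l.length ≤ n) {l : List V} (hl : IsPth G (S \ range c) l) {x y : V}
    (hx : l.head? = some x) (hy : l.getLast? = some y) {i : Fin n} {d : ℕ} (hd : 1 ≤ d) (hdn : d < n)
    (hxi : G.Adj x (c i)) (hyj : G.Adj y (c (i + (d : Fin n)))) : l.length + 1 ≤ d := by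
  have hlne : l ≠ [] := by rintro rfl; simp at hx
  have hlpos : 0 < l.length := List.length_pos_iff.2 hlne
  set q : List V := (List.range (n - d + 1)).map (fun t : ℕ => c (i + (d : Fin n) + (t : Fin n))) with hq
  have hqh : q.head? = some (c (i + (d : Fin n))) := by
    rw [hq, List.range_succ_eq_map]; simp
  have hql : q.getLast? = some (c i) := by
    rw [hq, List.range_succ]
    simp only [List.map_append, List.map_cons, List.map_nil, List.getLast?_append_cons, List.getLast?_singleton, Option.some.injEq]
    congr 1
    rw [add_assoc, ← Nat.cast_add, show d + (n - d) = n by omega]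
    simp
  have hcyc : CycL G S (l ++ q) := by
    refine ⟨?_, ⟨?_, ?_, ?_⟩, ?_⟩
    · simp [hq]; omega
    · rw [List.nodup_append]
      refine ⟨hl.1, ?_, ?_⟩
      · rw [hq]
        refine List.Nodup.map_on ?_ List.nodup_range
        intro s hs t ht hst
        have h1 := add_left_cancel (hc.inj hst)
        have h2 := congrArg Fin.val h1
        rw [Fin.val_natCast, Fin.val_natCast] at h2
        simp only [List.mem_range] at hs ht
        rwa [Nat.mod_eq_of_lt (by omega), Nat.mod_eq_of_lt (by omega)] at h2
      · intro a ha b hb hab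
        subst hab
        obtain ⟨t, _, ht⟩ := List.mem_map.1 hb
        exact (hl.2.2 a ha).2 ⟨_, ht⟩
    · rw [List.isChain_append]
      refine ⟨hl.2.1, ?_, ?_⟩
      · rw [hq, List.isChain_map, List.isChain_iff_getElem]
        intro t ht
        simp only [List.getElem_range]
        have := hc.adj (i + (d : Fin n) + (t : Fin n))
        push_cast
        rwa [add_assoc _ _ (1 : Fin n)] at this
      · intro a ha b hb
        rw [hy] at ha; rw [hqh] at hb
        simp only [Option.mem_def, Option.some.injEq] at ha hb
        subst ha; subst hb; exact hyj
    · intro a ha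
      rcases List.mem_append.1 ha with ha | ha
      · exact (hl.2.2 a ha).1
      · obtain ⟨t, _, ht⟩ := List.mem_map.1 ha
        rw [← ht]; exact hc.mem _
    · intro a b ha hb
      rw [List.head?_append, hx] at ha
      rw [List.getLast?_append, hql] at hb
      simp at ha hb
      subst ha; subst hb; exact hxi.symm
  have := hmax _ hcyc
  rw [List.length_append] at this
  simp [hq] at this
  omega

theorem Fin.exists_shift {n : ℕ} [NeZero n] (i j : Fin n) : ∃ d : ℕ, d < n ∧ j = i + (d : Fin n) :=
  ⟨(j - i).val, (j - i).2, by rw [Fin.cast_val_eq_self]; simp⟩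

theorem IsPth.reverse {l : List V} (h : IsPth G O l) : IsPth G O l.reverse := by
  refine ⟨List.nodup_reverse.2 h.1, ?_, fun x hx => h.2.2 x (List.mem_reverse.1 hx)⟩
  rw [List.isChain_reverse]
  exact h.2.1.imp fun _ _ h => h.symm

theorem CycF.ear' {n : ℕ} [NeZero n] {c : Fin n → V} (hc : CycF G S n c)
    (hmax : ∀ l, CycL G S l → l.length ≤ n) {l : List V} (hl : IsPth G (S \ range c) l) {x y : V}
    (hx : l.head? = some x) (hy : l.getLast? = some y) {i : Fin n} {d : ℕ} (hd : 1 ≤ d) (hdn : d < n)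
    (hxi : G.Adj x (c i)) (hyj : G.Adj y (c (i + (d : Fin n)))) : d + l.length + 1 ≤ n := by
  have h := hc.ear hmax hl.reverse (x := y) (y := x) (i := i + (d : Fin n)) (d := n - d) (by simpa using hy)
    (by simpa using hx) (by omega) (by omega) hyj (by
      rw [add_assoc, ← Nat.cast_add, show d + (n - d) = n by omega]; simpa using hxi)
  simp at h; omega

theorem CycF.earTwo {n : ℕ} [NeZero n] {c : Fin n → V} (hc : CycF G S n c) (hn : n ≤ 6)
    (hmax : ∀ l, CycL G S l → l.length ≤ n) : EarTwo G S (range c) := by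
  rintro l hl x y hx hy _ ⟨i, rfl⟩ _ ⟨j, rfl⟩ hne hxi hyj
  obtain ⟨d, hdn, rfl⟩ := Fin.exists_shift i j
  have hd : 1 ≤ d := by
    rcases Nat.eq_zero_or_pos d with rfl | h
    · simp at hne
    · exact h
  have h1 := hc.ear hmax hl hx hy hd hdn hxi hyj
  have h2 := hc.ear' hmax hl hx hy hd hdn hxi hyj
  omega

theorem CycF.nontriv {n : ℕ} [NeZero n] {c : Fin n → V} (hc : CycF G S n c) : (range c).Nontrivial := by
  refine ⟨c 0, ⟨0, rfl⟩, c 1, ⟨1, rfl⟩, fun h => ?_⟩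
  have := hc.adj 0
  simp only [zero_add] at this
  exact this.ne h

theorem CycF.sub {n : ℕ} [NeZero n] {c : Fin n → V} (hc : CycF G S n c) : range c ⊆ S := by
  rintro _ ⟨i, rfl⟩; exact hc.mem i

theorem CycF.rot {n : ℕ} [NeZero n] {c : Fin n → V} (hc : CycF G S n c) (k : Fin n) :
    CycF G S n (fun i => c (i + k)) :=
  ⟨hc.three, fun i j h => add_right_cancel (hc.inj h), fun i => hc.mem _, fun i => by
    have := hc.adj (i + k); rwa [show i + 1 + k = i + k + 1 by abel]⟩

theorem CycF.refl {n : ℕ} [NeZero n] {c : Fin n → V} (hc : CycF G S n c) :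
    CycF G S n (fun i => c (-i)) :=
  ⟨hc.three, fun i j h => neg_injective (hc.inj h), fun i => hc.mem _, fun i => by
    have := (hc.adj (-(i+1))).symm; rwa [show -(i+1) + 1 = -i by abel] at this⟩

end

end

section
set_option linter.unusedSectionVars false
set_option linter.unusedVariables false
open Set Filter Topology

section
variable {V : Type} {G : SimpleGraph V} {S C O : Set V}
open scoped Fin.NatCast Fin.CommRing

/-- Every vertex outside of the cycle is attached exactly at two vertices at distance two. -/
def Att2 (G : SimpleGraph V) (S : Set V) (n : ℕ) [NeZero n] (c : Fin n → V) : Prop :=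
  ∀ h ∈ S, h ∉ range c → ∃ i, ∀ x ∈ S, G.Adj h x ↔ x = c i ∨ x = c (i + 2)

theorem Fin.one_ne_zero' {n : ℕ} [NeZero n] (hn : 3 ≤ n) : (1 : Fin n) ≠ 0 := by
  intro h
  have := congrArg Fin.val h
  rw [Fin.val_one', Nat.mod_eq_of_lt (by omega)] at this
  simp at this

theorem Fin.two_ne_zero' {n : ℕ} [NeZero n] (hn : 3 ≤ n) : (2 : Fin n) ≠ 0 := by
  intro h
  have h2 : ((2 : ℕ) : Fin n) = 0 := by simpa using h
  have := congrArg Fin.val h2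
  rw [Fin.val_natCast, Nat.mod_eq_of_lt (by omega)] at this
  simp at this

theorem CycF.swap {n : ℕ} [NeZero n] {c : Fin n → V} (hc : CycF G S n c) {h : V} (hh : h ∈ S)
    (hhc : h ∉ range c) {i : Fin n} (h1 : G.Adj h (c i)) (h2 : G.Adj h (c (i + 2))) :
    CycF G S n (Function.update c (i + 1) h) := by
  have hn := hc.three
  have e1 : i ≠ i + 1 := fun e => Fin.one_ne_zero' hn (by simpa using e.symm)
  have e2 : i + 2 ≠ i + 1 := fun e => by
    have : (2 : Fin n) = 1 := add_left_cancel e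
    apply Fin.one_ne_zero' hn
    have h3 : (1 : Fin n) + 1 = 1 + 0 := by rw [add_zero]; rw [one_add_one_eq_two]; exact this
    exact add_left_cancel h3
  refine ⟨hn, ?_, ?_, ?_⟩
  · intro a b hab
    by_cases ha : a = i + 1 <;> by_cases hb : b = i + 1
    · rw [ha, hb]
    · subst ha; simp [Function.update_of_ne hb] at hab
      exact absurd ⟨b, hab.symm⟩ hhc
    · subst hb; simp [Function.update_of_ne ha] at hab
      exact absurd ⟨a, hab⟩ hhc
    · rw [Function.update_of_ne ha, Function.update_of_ne hb] at hab
      exact hc.inj hab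
  · intro a
    by_cases ha : a = i + 1
    · subst ha; simpa using hh
    · rw [Function.update_of_ne ha]; exact hc.mem a
  · intro a
    by_cases ha : a = i + 1
    · subst ha
      rw [Function.update_self, show i + 1 + 1 = i + 2 by rw [add_assoc, one_add_one_eq_two],
        Function.update_of_ne e2]
      exact h2
    · rw [Function.update_of_ne ha]
      by_cases hb : a + 1 = i + 1
      · have := add_right_cancel hb
        subst this
        rw [Function.update_self]; exact h1.symm
      · rw [Function.update_of_ne hb]; exact hc.adj a

theorem twin {n : ℕ} [NeZero n] (hD : ∀ c, CycF G S n c → Att2 G S n c) {c : Fin n → V} (hc : CycF G S n c)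
    {h : V} (hh : h ∈ S) (hhc : h ∉ range c) : ∃ i, (∀ x ∈ S, G.Adj h x ↔ G.Adj (c i) x) ∧
      ∀ x ∈ S, G.Adj (c i) x ↔ x = c (i - 1) ∨ x = c (i + 1) := by
  have hn := hc.three
  obtain ⟨i, hi⟩ := hD c hc h hh hhc
  have h1 : G.Adj h (c i) := (hi _ (hc.mem _)).2 (Or.inl rfl)
  have h2 : G.Adj h (c (i + 2)) := (hi _ (hc.mem _)).2 (Or.inr rfl)
  have hc' := hc.swap hh hhc h1 h2
  have hne : c i ≠ c (i + 2) := fun e => Fin.two_ne_zero' hn (by simpa using (hc.inj e).symm)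
  have hout : c (i + 1) ∉ range (Function.update c (i + 1) h) := by
    rintro ⟨j, hj⟩
    by_cases hj1 : j = i + 1
    · subst hj1
      simp at hj; exact hhc ⟨_, hj.symm⟩
    · rw [Function.update_of_ne hj1] at hj
      exact hj1 (hc.inj hj)
  obtain ⟨j, hj⟩ := hD _ hc' (c (i + 1)) (hc.mem _) hout
  have a1 := (hj _ (hc.mem i)).1 (hc.adj i).symm
  have a2 := (hj _ (hc.mem (i + 2))).1 (by
    have := hc.adj (i + 1); rwa [add_assoc, one_add_one_eq_two] at this)
  have key : ∀ x ∈ S, G.Adj (c (i + 1)) x ↔ x = c i ∨ x = c (i + 2) := by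
    intro x hx
    rw [hj x hx]
    generalize Function.update c (i + 1) h j = p at *
    generalize Function.update c (i + 1) h (j + 2) = q at *
    grind
  refine ⟨i + 1, fun x hx => by rw [hi x hx, key x hx], fun x hx => ?_⟩
  rw [key x hx, add_sub_cancel_right, add_assoc, one_add_one_eq_two]

theorem blowup {n : ℕ} [NeZero n] (hD : ∀ c, CycF G S n c → Att2 G S n c) {c : Fin n → V} (hc : CycF G S n c) :
    ∃ τ : V → Fin n, (∀ i, τ (c i) = i) ∧ (∀ u ∈ S, ∀ v ∈ S, G.Adj u v ↔ G.Adj (c (τ u)) (c (τ v))) ∧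
      ∀ u ∈ S, u ≠ c (τ u) → ∀ j, G.Adj (c (τ u)) (c j) → j = τ u - 1 ∨ j = τ u + 1 := by
  have key : ∀ u, ∃ i, (∀ j, c j = u → i = j) ∧ (u ∈ S → (∀ x ∈ S, G.Adj u x ↔ G.Adj (c i) x) ∧
      (u ≠ c i → ∀ j, G.Adj (c i) (c j) → j = i - 1 ∨ j = i + 1)) := by
    intro u
    by_cases hu : u ∈ range c
    · obtain ⟨i, rfl⟩ := hu
      exact ⟨i, fun j hj => (hc.inj hj).symm, fun _ => ⟨fun _ _ => Iff.rfl, fun h => absurd rfl h⟩⟩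
    · by_cases huS : u ∈ S
      · obtain ⟨i, h1, h2⟩ := twin hD hc huS hu
        refine ⟨i, fun j hj => absurd ⟨j, hj⟩ hu, fun _ => ⟨h1, fun _ j hj => ?_⟩⟩
        rcases (h2 _ (hc.mem j)).1 hj with h | h
        · exact Or.inl (hc.inj h)
        · exact Or.inr (hc.inj h)
      · exact ⟨0, fun j hj => absurd ⟨j, hj⟩ hu, fun h => absurd h huS⟩
  choose τ h1 h2 using key
  refine ⟨τ, fun i => h1 _ i rfl, fun u hu v hv => ?_, fun u hu => (h2 u hu).2⟩
  rw [(h2 u hu).1 v hv, G.adj_comm, (h2 v hv).1 _ (hc.mem _), G.adj_comm]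

/-- A position function from a list. -/
def posL {n : ℕ} (l : List ℤ) (i : Fin n) : ℤ := l.getD i.val 0

def mat5 (b02 b03 b13 b14 b24 : Bool) (i j : Fin 5) : Bool :=
  match i.val, j.val with
  | 0, 1 | 1, 0 | 1, 2 | 2, 1 | 2, 3 | 3, 2 | 3, 4 | 4, 3 | 4, 0 | 0, 4 => true
  | 0, 2 | 2, 0 => b02
  | 0, 3 | 3, 0 => b03
  | 1, 3 | 3, 1 => b13
  | 1, 4 | 4, 1 => b14
  | 2, 4 | 4, 2 => b24
  | _, _ => false

def mat4 (b02 b13 : Bool) (i j : Fin 4) : Bool :=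
  match i.val, j.val with
  | 0, 1 | 1, 0 | 1, 2 | 2, 1 | 2, 3 | 3, 2 | 3, 0 | 0, 3 => true
  | 0, 2 | 2, 0 => b02
  | 1, 3 | 3, 1 => b13
  | _, _ => false

def mat6 (b02 b03 b04 b13 b14 b15 b24 b25 b35 : Bool) (i j : Fin 6) : Bool :=
  match i.val, j.val with
  | 0, 1 | 1, 0 | 1, 2 | 2, 1 | 2, 3 | 3, 2 | 3, 4 | 4, 3 | 4, 5 | 5, 4 | 5, 0 | 0, 5 => true
  | 0, 2 | 2, 0 => b02
  | 0, 3 | 3, 0 => b03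
  | 0, 4 | 4, 0 => b04
  | 1, 3 | 3, 1 => b13
  | 1, 4 | 4, 1 => b14
  | 1, 5 | 5, 1 => b15
  | 2, 4 | 4, 2 => b24
  | 2, 5 | 5, 2 => b25
  | 3, 5 | 5, 3 => b35
  | _, _ => false

theorem ok4 : ∀ a b, okL (mat4 a b) (posL [0, 1, 3, 2]) := by decide +kernel
theorem ok5 : ∀ a b c d e, okL (mat5 a b c d e) (posL [0, 3, 1, 4, 2]) := by decide +kernel

def list6 : List (List ℤ) := [[0, 1, 4, 2, 5, 3], [0, 4, 1, 2, 5, 3], [0, 3, 4, 1, 2, 5],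
  [0, 4, 1, 5, 2, 3], [0, 3, 1, 4, 2, 5], [0, 1, 4, 5, 2, 3], [0, 2, 1, 4, 5, 3]]

def list6P : List (List ℤ) := [[0, 1, 2, 5, 3, 4], [0, 3, 5, 2, 1, 4], [1, 0, 3, 2, 5, 4],
  [4, 0, 1, 2, 5, 3], [0, 1, 4, 2, 5, 3], [0, 3, 1, 2, 5, 4], [0, 1, 2, 4, 5, 3], [0, 3, 2, 1, 5, 4],
  [0, 1, 2, 5, 4, 3], [0, 3, 2, 5, 1, 4], [0, 1, 3, 2, 5, 4], [0, 4, 1, 2, 5, 3]]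

/-- A pushed order is usable for root `ρ`. -/
def push6 (M : Fin 6 → Fin 6 → Bool) (ρ : Fin 6) (pos : Fin 6 → ℤ) : Prop :=
  okP M pos ∧ ∃ z e, pos z = 1 ∧ pos e = 0 ∧ z ≠ ρ ∧ (∃ j, M z j = true ∧ j ≠ z - 1 ∧ j ≠ z + 1) ∧
    ∃ j, M e j = true ∧ j ≠ e - 1 ∧ j ≠ e + 1

instance (M : Fin 6 → Fin 6 → Bool) (ρ : Fin 6) (pos : Fin 6 → ℤ) : Decidable (push6 M ρ pos) := by
  unfold push6; infer_instance

theorem ok6 : ∀ a b c d e f g h i, (∃ l ∈ list6, okL (mat6 a b c d e f g h i) (posL l)) ∨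
    ∀ ρ, ∃ l ∈ list6P, push6 (mat6 a b c d e f g h i) ρ (posL l) := by decide +kernel

end

end

section
set_option linter.unusedSectionVars false
set_option linter.unusedVariables false
open Set Filter Topology

section
variable {V : Type} {G : SimpleGraph V} {S C O : Set V}
open scoped Fin.NatCast Fin.CommRing

theorem mat4_eq (M : Fin 4 → Fin 4 → Bool) (h1 : ∀ i, M i i = false) (h2 : ∀ i j, M i j = M j i)
    (h3 : ∀ i, M i (i + 1) = true) : M = mat4 (M 0 2) (M 1 3) := by
  have a0 := h3 0; have a1 := h3 1; have a2 := h3 2; have a3 := h3 3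
  funext i j
  fin_cases i <;> fin_cases j <;> simp [mat4, h1] <;> first | assumption | exact h2 _ _ | (rw [h2]; assumption)

theorem mat5_eq (M : Fin 5 → Fin 5 → Bool) (h1 : ∀ i, M i i = false) (h2 : ∀ i j, M i j = M j i)
    (h3 : ∀ i, M i (i + 1) = true) : M = mat5 (M 0 2) (M 0 3) (M 1 3) (M 1 4) (M 2 4) := by
  have a0 := h3 0; have a1 := h3 1; have a2 := h3 2; have a3 := h3 3; have a4 := h3 4
  funext i j
  fin_cases i <;> fin_cases j <;> simp [mat5, h1] <;> first | assumption | exact h2 _ _ | (rw [h2]; assumption)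

theorem mat6_eq (M : Fin 6 → Fin 6 → Bool) (h1 : ∀ i, M i i = false) (h2 : ∀ i j, M i j = M j i)
    (h3 : ∀ i, M i (i + 1) = true) :
    M = mat6 (M 0 2) (M 0 3) (M 0 4) (M 1 3) (M 1 4) (M 1 5) (M 2 4) (M 2 5) (M 3 5) := by
  have a0 := h3 0; have a1 := h3 1; have a2 := h3 2; have a3 := h3 3; have a4 := h3 4; have a5 := h3 5
  funext i j
  fin_cases i <;> fin_cases j <;> simp [mat6, h1] <;> first | assumption | exact h2 _ _ | (rw [h2]; assumption)

theorem finish [Finite V] {n : ℕ} [NeZero n] (hn : n ≤ 6) (hD : ∀ c, CycF G S n c → Att2 G S n c)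
    {c : Fin n → V} (hc : CycF G S n c) {r : V} (hr : r ∈ S) : ∃ f, GoodOn G S r f := by
  classical
  obtain ⟨τ, hτ, hadj, hfib⟩ := blowup hD hc
  set M : Fin n → Fin n → Bool := fun i j => decide (G.Adj (c i) (c j)) with hM
  have h1 : ∀ i, M i i = false := by intro i; simp [hM]
  have h2 : ∀ i j, M i j = M j i := by intro i j; simp [hM, G.adj_comm]
  have h3 : ∀ i, M i (i + 1) = true := by intro i; simpa [hM] using hc.adj i
  have hadj' : ∀ u ∈ S, ∀ v ∈ S, G.Adj u v ↔ M (τ u) (τ v) = true := by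
    intro u hu v hv; rw [hadj u hu v hv]; simp [hM]
  have hfib' : ∀ u ∈ S, ∀ i, τ u = i → (∃ j, M i j = true ∧ j ≠ i - 1 ∧ j ≠ i + 1) → u = c i := by
    rintro u hu i rfl ⟨j, hj, hj1, hj2⟩
    by_contra hne
    rcases hfib u hu hne j (by simpa [hM] using hj) with h | h
    · exact hj1 h
    · exact hj2 h
  have hinv : ∀ i, c i ∈ S := hc.mem
  have hn3 := hc.three
  clear_value M
  clear hadj hfib hD hc hM
  interval_cases n
  · have : okL M (posL [0, 1, 2]) := by
      have : M = fun i j => decide (i ≠ j) := by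
        have a0 := h3 0; have a1 := h3 1; have a2 := h3 2
        funext i j
        fin_cases i <;> fin_cases j <;> simp [h1] <;> first | assumption | (rw [h2]; assumption)
      rw [this]; decide +kernel
    exact coreL M _ this τ hadj' hr
  · exact coreL M _ (by rw [mat4_eq M h1 h2 h3]; exact ok4 _ _) τ hadj' hr
  · exact coreL M _ (by rw [mat5_eq M h1 h2 h3]; exact ok5 _ _ _ _ _) τ hadj' hr
  · have h := ok6 (M 0 2) (M 0 3) (M 0 4) (M 1 3) (M 1 4) (M 1 5) (M 2 4) (M 2 5) (M 3 5)
    rw [← mat6_eq M h1 h2 h3] at h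
    rcases h with ⟨l, _, h⟩ | h
    · exact coreL M _ h τ hadj' hr
    · obtain ⟨l, _, hok, z, e, hz, he, hzr, hz3, he3⟩ := h (τ r)
      have hpi := hok.1
      refine corePush M _ hok τ hadj' (z := c z) (e := c e) (hinv z) (hinv e) (by rw [hτ]; exact hz)
        (by rw [hτ]; exact he) ?_ ?_ hr ?_
      · intro x hx hx1
        exact hfib' x hx z (hpi _ _ (hx1.trans hz.symm)) hz3
      · intro x hx hx1
        exact hfib' x hx e (hpi _ _ (hx1.trans he.symm)) he3
      · intro h; exact hzr (by rw [h, hτ])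

theorem CycF.ear1 {n : ℕ} [NeZero n] {c : Fin n → V} (hc : CycF G S n c)
    (hmax : ∀ l, CycL G S l → l.length ≤ n) {h : V} (hh : h ∈ S \ range c) {i j : Fin n} (hij : i ≠ j)
    (h1 : G.Adj h (c i)) (h2 : G.Adj h (c j)) : 2 ≤ (j - i).val ∧ (j - i).val + 2 ≤ n := by
  have e : i + ((j - i).val : Fin n) = j := by rw [Fin.cast_val_eq_self]; simp
  have hp : IsPth G (S \ range c) [h] := ⟨by simp, by simp, by simpa using hh⟩
  have hpos : 1 ≤ (j - i).val := by
    rw [Nat.one_le_iff_ne_zero]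
    intro h0
    exact hij (sub_eq_zero.1 (Fin.ext (by simpa using h0))).symm
  have a := hc.ear hmax hp (x := h) (y := h) (by simp) (by simp) hpos (j - i).2 h1 (by rw [e]; exact h2)
  have b := hc.ear' hmax hp (x := h) (y := h) (by simp) (by simp) hpos (j - i).2 h1 (by rw [e]; exact h2)
  simp only [List.length_singleton] at a b
  omega

theorem CycF.ear2 {n : ℕ} [NeZero n] {c : Fin n → V} (hc : CycF G S n c)
    (hmax : ∀ l, CycL G S l → l.length ≤ n) {h h' : V} (hh : h ∈ S \ range c) (hh' : h' ∈ S \ range c)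
    (hhh : G.Adj h h') {i j : Fin n} (hij : i ≠ j)
    (h1 : G.Adj h (c i)) (h2 : G.Adj h' (c j)) : 3 ≤ (j - i).val ∧ (j - i).val + 3 ≤ n := by
  have e : i + ((j - i).val : Fin n) = j := by rw [Fin.cast_val_eq_self]; simp
  have hp : IsPth G (S \ range c) [h, h'] := ⟨by simpa using hhh.ne, by simpa using hhh, by
    intro x hx; simp at hx; rcases hx with rfl | rfl <;> assumption⟩
  have hpos : 1 ≤ (j - i).val := by
    rw [Nat.one_le_iff_ne_zero]
    intro h0
    exact hij (sub_eq_zero.1 (Fin.ext (by simpa using h0))).symm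
  have a := hc.ear hmax hp (x := h) (y := h') (by simp) (by simp) hpos (j - i).2 h1 (by rw [e]; exact h2)
  have b := hc.ear' hmax hp (x := h) (y := h') (by simp) (by simp) hpos (j - i).2 h1 (by rw [e]; exact h2)
  simp only [List.length_cons, List.length_nil] at a b
  omega

theorem CycF.att {n : ℕ} [NeZero n] (h2 : TwoC G S) {c : Fin n → V} (hc : CycF G S n c) (hn : n ≤ 6)
    (hmax : ∀ l, CycL G S l → l.length ≤ n)
    (H1 : ∀ h ∈ S \ range c, ∀ h' ∈ S \ range c, G.Adj h h' → ∀ i j, i ≠ j → G.Adj h (c i) → ¬ G.Adj h' (c j))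
    (H2 : ∀ h ∈ S \ range c, ∀ i j, i ≠ j → G.Adj h (c i) → G.Adj h (c j) → j = i + 2 ∨ i = j + 2)
    (H3 : ∀ h ∈ S \ range c, ∀ i j k, i ≠ j → i ≠ k → j ≠ k → G.Adj h (c i) → G.Adj h (c j) → ¬ G.Adj h (c k)) :
    Att2 G S n c := by
  intro h hh hhc
  have hO : h ∈ S \ range c := ⟨hh, hhc⟩
  have he := hc.earTwo hn hmax
  obtain ⟨_, ⟨i, rfl⟩, hi⟩ := E1 h2 hc.sub hc.nontriv he hh hhc
  have hj : ∃ j, i ≠ j ∧ G.Adj h (c j) := by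
    obtain ⟨_, ⟨j, rfl⟩, hji, hj⟩ := E2 h2 hc.sub hc.nontriv he hh hhc ⟨i, rfl⟩ hi
    have hij : i ≠ j := fun e => hji (by rw [e])
    rcases hj with hj | ⟨h', hh', hh'c, hhh', hj⟩
    · exact ⟨j, hij, hj⟩
    · exact absurd hj (H1 h hO h' ⟨hh', hh'c⟩ hhh' i j hij hi)
  obtain ⟨j, hij, hj⟩ := hj
  have key : ∀ x ∈ S, G.Adj h x → x = c i ∨ x = c j := by
    intro x hx hhx
    by_cases hxc : x ∈ range c
    · obtain ⟨k, rfl⟩ := hxc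
      by_contra hcon
      push Not at hcon
      exact H3 h hO i j k hij (fun e => hcon.1 (by rw [e])) (fun e => hcon.2 (by rw [e])) hi hj hhx
    · obtain ⟨_, ⟨k, rfl⟩, hk⟩ := E1 h2 hc.sub hc.nontriv he hx hxc
      by_cases hik : i = k
      · exact absurd hk (H1 h hO x ⟨hx, hxc⟩ hhx j k (by rw [← hik]; exact Ne.symm hij) hj)
      · exact absurd hk (H1 h hO x ⟨hx, hxc⟩ hhx i k hik hi)
  rcases H2 h hO i j hij hi hj with e | e
  · refine ⟨i, fun x hx => ⟨fun h => e ▸ key x hx h, ?_⟩⟩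
    rintro (rfl | rfl)
    · exact hi
    · rw [← e]; exact hj
  · refine ⟨j, fun x hx => ⟨fun h => e ▸ (key x hx h).symm, ?_⟩⟩
    rintro (rfl | rfl)
    · exact hj
    · rw [← e]; exact hi

theorem dist2_3 : ∀ i j : Fin 3, i ≠ j → 2 ≤ (j - i).val ∧ (j - i).val + 2 ≤ 3 → j = i + 2 ∨ i = j + 2 := by decide

theorem dist2_4 : ∀ i j : Fin 4, i ≠ j → 2 ≤ (j - i).val ∧ (j - i).val + 2 ≤ 4 → j = i + 2 ∨ i = j + 2 := by decide

theorem dist2_5 : ∀ i j : Fin 5, i ≠ j → 2 ≤ (j - i).val ∧ (j - i).val + 2 ≤ 5 → j = i + 2 ∨ i = j + 2 := by decide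

theorem case_small [Finite V] {n : ℕ} [NeZero n] (h2 : TwoC G S) (hn : n ≤ 5)
    (hmax : ∀ l, CycL G S l → l.length ≤ n)
    {c : Fin n → V} (hc : CycF G S n c) {r : V} (hr : r ∈ S) : ∃ f, GoodOn G S r f := by
  refine finish (by omega) ?_ hc hr
  intro c hc
  have hn3 := hc.three
  have e1 := fun h (hh : h ∈ S \ range c) i j => @CycF.ear1 V G S n _ c hc hmax h hh i j
  refine hc.att h2 (by omega) hmax ?_ ?_ ?_
  · intro h hh h' hh' hhh i j hij hi hj
    have := hc.ear2 hmax hh hh' hhh hij hi hj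
    omega
  · intro h hh i j hij hi hj
    have := e1 h hh i j hij hi hj
    clear hi hj e1 hh hc hmax
    clear c
    interval_cases n
    · exact dist2_3 i j hij this
    · exact dist2_4 i j hij this
    · exact dist2_5 i j hij this
  · intro h hh i j k hij hik hjk hi hj hk
    have a1 := e1 h hh i j hij hi hj
    have a2 := e1 h hh i k hik hi hk
    have a3 := e1 h hh j k hjk hj hk
    clear hi hj hk e1 hh hc hmax
    clear c
    interval_cases n <;> revert i j k <;> decide

end

end

section
set_option linter.unusedSectionVars false
set_option linter.unusedVariables false
open Set Filter Topology

section
variable {V : Type} {G : SimpleGraph V} {S C O : Set V}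

/-- Core for independent vertices attached to a triple. -/
def matS (b01 b12 b02 : Bool) (i j : Fin 7) : Bool :=
  match i.val, j.val with
  | 0, 1 | 1, 0 => b01
  | 1, 2 | 2, 1 => b12
  | 0, 2 | 2, 0 => b02
  | 3, 0 | 3, 1 | 3, 2 | 0, 3 | 1, 3 | 2, 3 => true
  | 4, 0 | 4, 1 | 0, 4 | 1, 4 => true
  | 5, 1 | 5, 2 | 1, 5 | 2, 5 => true
  | 6, 0 | 6, 2 | 0, 6 | 2, 6 => true
  | _, _ => false

/-- Core for the net-like case. -/
def matN (b03 b13 b23 : Bool) (i j : Fin 7) : Bool :=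
  match i.val, j.val with
  | 0, 1 | 1, 0 | 1, 2 | 2, 1 | 0, 2 | 2, 0 => true
  | 0, 3 | 3, 0 => b03
  | 1, 3 | 3, 1 => b13
  | 2, 3 | 3, 2 => b23
  | 4, 0 | 4, 3 | 0, 4 | 3, 4 => true
  | 5, 1 | 5, 3 | 1, 5 | 3, 5 => true
  | 6, 2 | 6, 3 | 2, 6 | 3, 6 => true
  | _, _ => false

theorem okS : ∀ a b c, (∃ l ∈ ([[0, 1, 2, 3, 4, 5, 6], [0, 1, 2, 4, 5, 6, 3], [0, 1, 6, 2, 3, 5, 4]] : List (List ℤ)),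
    okL (matS a b c) (posL l)) ∨ okP (matS a b c) (posL [0, 1, 6, 3, 4, 2, 5]) := by decide +kernel

theorem okN : ∀ a b c, (∃ l ∈ ([[0, 1, 4, 2, 3, 5, 6], [0, 1, 4, 6, 2, 5, 3], [0, 4, 1, 2, 3, 5, 6]] : List (List ℤ)),
    okL (matN a b c) (posL l)) ∨ okP (matN a b c) (posL [0, 1, 4, 5, 3, 2, 6]) := by decide +kernel

theorem core7 [Finite V] (M : Fin 7 → Fin 7 → Bool) (l : List (List ℤ)) (l' : List ℤ)
    (hok : (∃ k ∈ l, okL M (posL k)) ∨ okP M (posL l')) (h0 : posL (n := 7) l' 0 = 0) (h1 : posL (n := 7) l' 1 = 1)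
    (τ : V → Fin 7) (hadj : ∀ u ∈ S, ∀ v ∈ S, G.Adj u v ↔ M (τ u) (τ v) = true) {a b : V} (ha : a ∈ S) (hb : b ∈ S)
    (ha0 : τ a = 0) (hb1 : τ b = 1) (hau : ∀ x, τ x = 0 → x = a) (hbu : ∀ x, τ x = 1 → x = b) {r : V}
    (hr : r ∈ S) (hrb : r ≠ b) : ∃ f, GoodOn G S r f := by
  rcases hok with ⟨l, _, hok⟩ | hok
  · exact coreL M _ hok τ hadj hr
  · refine corePush M _ hok τ hadj (z := b) (e := a) hb ha (by rw [hb1]; exact h1) (by rw [ha0]; exact h0) ?_ ?_ hr hrb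
    · intro x hx h
      exact hbu x (hok.1 _ _ (h.trans h1.symm))
    · intro x hx h
      exact hau x (hok.1 _ _ (h.trans h0.symm))

/-- All vertices outside a triple are independent and see at least two of the triple. -/
theorem caseS [Finite V] {a b c : V} (ha : a ∈ S) (hb : b ∈ S) (hc : c ∈ S) (hab : a ≠ b) (hbc : b ≠ c) (hac : a ≠ c)
    (hN : ∀ v ∈ S, v ≠ a → v ≠ b → v ≠ c → (∀ x ∈ S, G.Adj v x → x = a ∨ x = b ∨ x = c) ∧
      ((G.Adj v a ∧ G.Adj v b) ∨ (G.Adj v b ∧ G.Adj v c) ∨ (G.Adj v a ∧ G.Adj v c)))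
    {r : V} (hr : r ∈ S) : ∃ f, GoodOn G S r f := by
  classical
  wlog hrb : r ≠ b generalizing a b
  · push Not at hrb
    subst hrb
    refine this hb ha hab.symm hac hbc ?_ hab.symm
    intro v hv h1 h2 h3
    have := hN v hv h2 h1 h3
    refine ⟨fun x hx hvx => ?_, ?_⟩
    · have := this.1 x hx hvx; tauto
    · tauto
  set τ : V → Fin 7 := fun v => if v = a then 0 else if v = b then 1 else if v = c then 2 else
    if G.Adj v a then (if G.Adj v b then (if G.Adj v c then 3 else 4) else 6) else 5 with hτ
  have τa : τ a = 0 := by simp [hτ]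
  have τb : τ b = 1 := by simp [hτ, hab.symm]
  have τc : τ c = 2 := by simp [hτ, hbc.symm, hac.symm]
  have cls : ∀ v ∈ S, v = a ∨ v = b ∨ v = c ∨ ((∀ x ∈ S, G.Adj v x → x = a ∨ x = b ∨ x = c) ∧ v ≠ a ∧ v ≠ b ∧ v ≠ c ∧
     ((τ v = 3 ∧ G.Adj v a ∧ G.Adj v b ∧ G.Adj v c) ∨ (τ v = 4 ∧ G.Adj v a ∧ G.Adj v b ∧ ¬ G.Adj v c) ∨
      (τ v = 5 ∧ ¬ G.Adj v a ∧ G.Adj v b ∧ G.Adj v c) ∨ (τ v = 6 ∧ G.Adj v a ∧ ¬ G.Adj v b ∧ G.Adj v c))) := by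
    intro v hv
    by_cases h1 : v = a
    · exact Or.inl h1
    by_cases h2 : v = b
    · exact Or.inr (Or.inl h2)
    by_cases h3 : v = c
    · exact Or.inr (Or.inr (Or.inl h3))
    obtain ⟨h4, h5⟩ := hN v hv h1 h2 h3
    refine Or.inr (Or.inr (Or.inr ⟨h4, h1, h2, h3, ?_⟩))
    by_cases g1 : G.Adj v a <;> by_cases g2 : G.Adj v b <;> by_cases g3 : G.Adj v c <;>
      simp only [g1, g2, g3, hτ, h1, h2, h3, if_true, if_false] at h5 ⊢ <;> simp at h5 ⊢
  refine core7 (matS (decide (G.Adj a b)) (decide (G.Adj b c)) (decide (G.Adj a c))) _ _ (okS _ _ _)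
    (by decide) (by decide) τ ?_ ha hb τa τb ?_ ?_ hr hrb
  · intro u hu v hv
    rcases cls u hu with rfl | rfl | rfl | ⟨hu1, hu2, hu3, hu4, hu5⟩ <;>
    rcases cls v hv with rfl | rfl | rfl | ⟨hv1, hv2, hv3, hv4, hv5⟩
    all_goals first
      | (rcases hu5 with hu5 | hu5 | hu5 | hu5 <;> rcases hv5 with hv5 | hv5 | hv5 | hv5 <;>
          (rw [hu5.1, hv5.1]; simp only [matS]; simp only [Bool.false_eq_true, iff_false];
           intro h; rcases hu1 _ hv h with h | h | h <;> contradiction))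
      | (rcases hu5 with hu5 | hu5 | hu5 | hu5 <;> (rw [hu5.1]; simp [τa, τb, τc, matS, hu5]))
      | (rcases hv5 with hv5 | hv5 | hv5 | hv5 <;> (rw [hv5.1, G.adj_comm]; simp [τa, τb, τc, matS, hv5]))
      | (simp [τa, τb, τc, matS, G.adj_comm]; done)
  · intro x hx
    by_contra h
    simp only [hτ, h, if_false] at hx
    split_ifs at hx <;> revert hx <;> decide
  · intro x hx
    by_contra h
    simp only [hτ, h, if_false] at hx
    split_ifs at hx <;> revert hx <;> decide

/-- A triangle, a further vertex `z`, and all other vertices see exactly `z` and one triangle vertex. -/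
theorem caseN [Finite V] {a b c z : V} (ha : a ∈ S) (hb : b ∈ S) (hc : c ∈ S) (hz : z ∈ S) (hab : G.Adj a b) (hbc : G.Adj b c)
    (hac : G.Adj a c) (haz : a ≠ z) (hbz : b ≠ z) (hcz : c ≠ z)
    (hN : ∀ v ∈ S, v ≠ a → v ≠ b → v ≠ c → v ≠ z → (∀ x ∈ S, G.Adj v x ↔ x = a ∨ x = z) ∨
      (∀ x ∈ S, G.Adj v x ↔ x = b ∨ x = z) ∨ (∀ x ∈ S, G.Adj v x ↔ x = c ∨ x = z))
    {r : V} (hr : r ∈ S) : ∃ f, GoodOn G S r f := by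
  classical
  wlog hrb : r ≠ b generalizing a b
  · push Not at hrb
    subst hrb
    refine this hb ha hab.symm hac hbc hbz haz ?_ hab.ne.symm
    intro v hv h1 h2 h3 h4
    have := hN v hv h2 h1 h3 h4
    tauto
  have nab := hab.ne
  have nbc := hbc.ne
  have nac := hac.ne
  set τ : V → Fin 7 := fun v => if v = a then 0 else if v = b then 1 else if v = c then 2 else if v = z then 3 else
    if G.Adj v a then 4 else if G.Adj v b then 5 else 6 with hτ
  have τa : τ a = 0 := by simp [hτ]
  have τb : τ b = 1 := by simp [hτ, nab.symm]
  have τc : τ c = 2 := by simp [hτ, nbc.symm, nac.symm]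
  have τz : τ z = 3 := by simp [hτ, haz.symm, hbz.symm, hcz.symm]
  have cls : ∀ v ∈ S, v = a ∨ v = b ∨ v = c ∨ v = z ∨ (v ≠ a ∧ v ≠ b ∧ v ≠ c ∧ v ≠ z ∧
     ((τ v = 4 ∧ ∀ x ∈ S, G.Adj v x ↔ x = a ∨ x = z) ∨
      (τ v = 5 ∧ ∀ x ∈ S, G.Adj v x ↔ x = b ∨ x = z) ∨ (τ v = 6 ∧ ∀ x ∈ S, G.Adj v x ↔ x = c ∨ x = z))) := by
    intro v hv
    by_cases h1 : v = a
    · exact Or.inl h1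
    by_cases h2 : v = b
    · exact Or.inr (Or.inl h2)
    by_cases h3 : v = c
    · exact Or.inr (Or.inr (Or.inl h3))
    by_cases h4 : v = z
    · exact Or.inr (Or.inr (Or.inr (Or.inl h4)))
    refine Or.inr (Or.inr (Or.inr (Or.inr ⟨h1, h2, h3, h4, ?_⟩)))
    rcases hN v hv h1 h2 h3 h4 with h | h | h
    · refine Or.inl ⟨?_, h⟩
      simp [hτ, h1, h2, h3, h4, h a ha]
    · refine Or.inr (Or.inl ⟨?_, h⟩)
      simp [hτ, h1, h2, h3, h4, h a ha, h b hb, nab, haz]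
    · refine Or.inr (Or.inr ⟨?_, h⟩)
      simp [hτ, h1, h2, h3, h4, h a ha, h b hb, nab, haz, hbz, nac, nbc]
  refine core7 (matN (decide (G.Adj a z)) (decide (G.Adj b z)) (decide (G.Adj c z))) _ _ (okN _ _ _)
    (by decide) (by decide) τ ?_ ha hb τa τb ?_ ?_ hr hrb
  · intro u hu v hv
    rcases cls u hu with rfl | rfl | rfl | rfl | ⟨hu2, hu3, hu4, hu6, hu5⟩ <;>
    rcases cls v hv with rfl | rfl | rfl | rfl | ⟨hv2, hv3, hv4, hv6, hv5⟩
    all_goals first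
      | (rcases hu5 with hu5 | hu5 | hu5 <;> rcases hv5 with hv5 | hv5 | hv5 <;>
          (rw [hu5.1, hv5.1, hu5.2 _ hv]; simp [matN, *]; done))
      | (rcases hu5 with hu5 | hu5 | hu5 <;> (rw [hu5.1, hu5.2 _ hv]; simp [τa, τb, τc, τz, matN, nab, nbc, nac, haz, hbz, hcz, nab.symm, nbc.symm, nac.symm, haz.symm, hbz.symm, hcz.symm]; done))
      | (rcases hv5 with hv5 | hv5 | hv5 <;> (rw [hv5.1, G.adj_comm, hv5.2 _ hu]; simp [τa, τb, τc, τz, matN, nab, nbc, nac, haz, hbz, hcz, nab.symm, nbc.symm, nac.symm, haz.symm, hbz.symm, hcz.symm]; done))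
      | (simp [τa, τb, τc, τz, matN, hab, hbc, hac, hab.symm, hbc.symm, hac.symm]; done)
      | (rw [G.adj_comm]; simp [τa, τb, τc, τz, matN]; done)
  · intro x hx
    by_contra h
    simp only [hτ, h, if_false] at hx
    split_ifs at hx <;> revert hx <;> decide
  · intro x hx
    by_contra h
    simp only [hτ, h, if_false] at hx
    split_ifs at hx <;> revert hx <;> decide

end

end

section
set_option linter.unusedSectionVars false
set_option linter.unusedVariables false
open Set Filter Topology

section
variable {V : Type} {G : SimpleGraph V} {S C O : Set V}

theorem acc_of_pos {θ : V → ℝ} {u v : V} (h : θ u ≠ θ v)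
    (hw : ∀ w ∈ S, G.Adj u w → 0 < (θ w - θ u) * (θ w - θ v)) :
    ∃ σ : ℝ, σ ≠ 0 ∧ ∀ w ∈ S, G.Adj u w → 0 < σ * ((θ v - θ u) * (θ w - θ u) * (θ w - θ v)) := by
  have h0 : θ v - θ u ≠ 0 := sub_ne_zero.2 (Ne.symm h)
  refine ⟨θ v - θ u, h0, fun w hwS hadj => ?_⟩
  have := mul_pos (sq_pos_of_ne_zero h0) (hw w hwS hadj)
  nlinarith

theorem acc_of_neg {θ : V → ℝ} {u v : V} (h : θ u ≠ θ v)
    (hw : ∀ w ∈ S, G.Adj u w → (θ w - θ u) * (θ w - θ v) < 0) :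
    ∃ σ : ℝ, σ ≠ 0 ∧ ∀ w ∈ S, G.Adj u w → 0 < σ * ((θ v - θ u) * (θ w - θ u) * (θ w - θ v)) := by
  have h0 : θ v - θ u ≠ 0 := sub_ne_zero.2 (Ne.symm h)
  refine ⟨-(θ v - θ u), neg_ne_zero.2 h0, fun w hwS hadj => ?_⟩
  have := mul_neg_of_pos_of_neg (sq_pos_of_ne_zero h0) (hw w hwS hadj)
  nlinarith

/-- The geometric part of the two-separator case. -/
theorem caseP_geo [Finite V] {a b : V} (hab : a ≠ b) (ha : a ∈ S) (hb : b ∈ S) (X Y : Set V)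
    (hS : ∀ v ∈ S, v = a ∨ v = b ∨ v ∈ X ∨ v ∈ Y) (haX : a ∉ X) (haY : a ∉ Y) (hbX : b ∉ X) (hbY : b ∉ Y)
    (hXY : ∀ v ∈ X, v ∉ Y) (hXa : ∀ v ∈ X, G.Adj v a) (hYb : ∀ v ∈ Y, G.Adj v b)
    (hXi : ∀ v ∈ X, ∀ w ∈ X, ¬ G.Adj v w) (hYi : ∀ v ∈ Y, ∀ w ∈ Y, ¬ G.Adj v w) (k : V → ℕ)
    (hk : ∀ v ∈ X, ∀ w ∈ Y, G.Adj v w ↔ k v = k w) {r : V} (hr : r ∈ S) : ∃ f, GoodOn G S r f := by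
  classical
  obtain ⟨e, hei, he⟩ := exists_tie V
  obtain ⟨N, hN⟩ : ∃ N : ℕ, ∀ v, k v ≤ N := by
    obtain ⟨N, hN⟩ := (Set.finite_range k).bddAbove
    exact ⟨N, fun v => hN ⟨v, rfl⟩⟩
  set θ : V → ℝ := fun v => if v = a then 3 * N + 10 else if v = b then 3 * N + 11 else
    if v ∈ X then k v + e v else 2 * N + 4 - k v - e v with hθ
  have θa : θ a = 3 * N + 10 := by simp [hθ]
  have θb : θ b = 3 * N + 11 := by simp [hθ, hab.symm]
  have θX : ∀ v ∈ X, θ v = k v + e v := by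
    intro v hv
    have h1 : v ≠ a := fun h => haX (h ▸ hv)
    have h2 : v ≠ b := fun h => hbX (h ▸ hv)
    simp [hθ, h1, h2, hv]
  have θY : ∀ v ∈ Y, θ v = 2 * N + 4 - k v - e v := by
    intro v hv
    have h1 : v ≠ a := fun h => haY (h ▸ hv)
    have h2 : v ≠ b := fun h => hbY (h ▸ hv)
    have h3 : v ∉ X := fun h => hXY v h hv
    simp [hθ, h1, h2, h3]
  have hN0 : (0 : ℝ) ≤ N := Nat.cast_nonneg N
  have bX : ∀ v ∈ X, 0 ≤ θ v ∧ θ v < N + 1 := by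
    intro v hv
    have h1 : (k v : ℝ) ≤ N := by exact_mod_cast hN v
    have h2 : (0 : ℝ) ≤ k v := Nat.cast_nonneg _
    rw [θX v hv]; constructor <;> linarith [(he v).1, (he v).2]
  have bY : ∀ v ∈ Y, N + 3 < θ v ∧ θ v ≤ 2 * N + 4 := by
    intro v hv
    have h1 : (k v : ℝ) ≤ N := by exact_mod_cast hN v
    have h2 : (0 : ℝ) ≤ k v := Nat.cast_nonneg _
    rw [θY v hv]; constructor <;> linarith [(he v).1, (he v).2]
  have klt : ∀ v w, k v < k w → (k v : ℝ) + e v < k w + e w := by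
    intro v w h
    have : (k v : ℝ) + 1 ≤ k w := by exact_mod_cast h
    linarith [(he v).2, (he w).1]
  have kinj : ∀ v w, (k v : ℝ) + e v = k w + e w → v = w := by
    intro v w h
    rcases lt_trichotomy (k v) (k w) with h1 | h1 | h1
    · exact absurd h (klt v w h1).ne
    · rw [h1] at h; exact hei (by linarith)
    · exact absurd h (klt w v h1).ne'
  have hinj : InjOn θ S := by
    intro u hu v hv huv
    rcases hS u hu with rfl | rfl | hu | hu <;> rcases hS v hv with rfl | rfl | hv | hv
    all_goals try rfl
    all_goals try (exfalso; linarith)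
    · have := bX v hv; linarith
    · have := bY v hv; linarith
    · have := bX v hv; linarith
    · have := bY v hv; linarith
    · have := bX u hu; linarith
    · have := bX u hu; linarith
    · rw [θX u hu, θX v hv] at huv; exact kinj _ _ huv
    · have := bX u hu; have := bY v hv; linarith
    · have := bY u hu; linarith
    · have := bY u hu; linarith
    · have := bX v hv; have := bY u hu; linarith
    · rw [θY u hu, θY v hv] at huv; exact kinj _ _ (by linarith)
  have big : ∀ w, w = a ∨ w = b → 3 * N + 10 ≤ θ w := by
    rintro w (rfl | rfl) <;> linarith
  -- neighbours
  have nX : ∀ x ∈ X, ∀ w ∈ S, G.Adj x w → (w = a ∨ w = b) ∨ (w ∈ Y ∧ k w = k x) := by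
    intro x hx w hw h
    rcases hS w hw with h1 | h1 | h1 | h1
    · exact Or.inl (Or.inl h1)
    · exact Or.inl (Or.inr h1)
    · exact absurd h (hXi x hx w h1)
    · exact Or.inr ⟨h1, ((hk x hx w h1).1 h).symm⟩
  have nY : ∀ x ∈ Y, ∀ w ∈ S, G.Adj x w → (w = a ∨ w = b) ∨ (w ∈ X ∧ k w = k x) := by
    intro x hx w hw h
    rcases hS w hw with h1 | h1 | h1 | h1
    · exact Or.inl (Or.inl h1)
    · exact Or.inl (Or.inr h1)
    · exact Or.inr ⟨h1, ((hk w h1 x hx).1 h.symm)⟩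
    · exact absurd h (hYi x hx w h1)
  have hxx : ∀ x ∈ X, ∀ x' ∈ X, ∀ w ∈ S, G.Adj x w → 0 < (θ w - θ x) * (θ w - θ x') := by
    intro x hx x' hx' w hw h
    have b1 := bX x hx; have b2 := bX x' hx'
    rcases nX x hx w hw h with h | h
    · have := big w h; apply mul_pos <;> linarith
    · have := bY w h.1; apply mul_pos <;> linarith
  have hyy : ∀ x ∈ Y, ∀ x' ∈ Y, ∀ w ∈ S, G.Adj x w → 0 < (θ w - θ x) * (θ w - θ x') := by
    intro x hx x' hx' w hw h
    have b1 := bY x hx; have b2 := bY x' hx'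
    rcases nY x hx w hw h with h | h
    · have := big w h; apply mul_pos <;> linarith
    · have := bX w h.1; apply mul_pos_of_neg_of_neg <;> linarith
  have hxy1 : ∀ x ∈ X, ∀ y ∈ Y, k x < k y → ∀ w ∈ S, G.Adj x w → 0 < (θ w - θ x) * (θ w - θ y) := by
    intro x hx y hy hlt w hw h
    have b1 := bX x hx; have b2 := bY y hy
    rcases nX x hx w hw h with h | h
    · have := big w h; apply mul_pos <;> linarith
    · have b3 := bY w h.1
      have := klt w y (by omega)
      apply mul_pos
      · linarith
      · rw [θY w h.1, θY y hy]; linarith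
  have hxy2 : ∀ x ∈ X, ∀ y ∈ Y, k y < k x → ∀ w ∈ S, G.Adj y w → 0 < (θ w - θ y) * (θ w - θ x) := by
    intro x hx y hy hlt w hw h
    have b1 := bX x hx; have b2 := bY y hy
    rcases nY y hy w hw h with h | h
    · have := big w h; apply mul_pos <;> linarith
    · have b3 := bX w h.1
      have := klt w x (by omega)
      apply mul_pos_of_neg_of_neg
      · linarith
      · rw [θX w h.1, θX x hx]; linarith
  have hya : ∀ y ∈ Y, ¬ G.Adj y a → ∀ w ∈ S, G.Adj y w → 0 < (θ w - θ y) * (θ w - θ a) := by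
    intro y hy hna w hw h
    have b2 := bY y hy
    rcases nY y hy w hw h with (h1 | h1) | h1
    · exact absurd (h1 ▸ h) hna
    · subst h1; apply mul_pos <;> linarith
    · have b3 := bX w h1.1; apply mul_pos_of_neg_of_neg <;> linarith
  have hxb : ∀ x ∈ X, ¬ G.Adj x b → ∀ w ∈ S, G.Adj x w → (θ w - θ x) * (θ w - θ b) < 0 := by
    intro x hx hna w hw h
    have b2 := bX x hx
    rcases nX x hx w hw h with (h1 | h1) | h1
    · subst h1; apply mul_neg_of_pos_of_neg <;> linarith
    · exact absurd (h1 ▸ h) hna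
    · have b3 := bY w h1.1; apply mul_neg_of_pos_of_neg <;> linarith
  have hab' : ¬ G.Adj a b → ∀ w ∈ S, G.Adj a w → 0 < (θ w - θ a) * (θ w - θ b) := by
    intro hna w hw h
    rcases hS w hw with h1 | h1 | h1 | h1
    · exact absurd (h1 ▸ h) (G.loopless.irrefl _)
    · exact absurd (h1 ▸ h) hna
    · have b3 := bX w h1; apply mul_pos_of_neg_of_neg <;> linarith
    · have b3 := bY w h1; apply mul_pos_of_neg_of_neg <;> linarith
  have sym : ∀ {u v : V}, ¬ G.Adj u v → ¬ G.Adj v u := fun h h' => h h'.symm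
  refine goodOn_parabola (θ := θ) hinj ?_ hr
  intro u hu v hv huv hnadj
  have hθne : θ u ≠ θ v := fun h => huv (hinj hu hv h)
  rcases hS u hu with rfl | rfl | hu | hu <;> rcases hS v hv with rfl | rfl | hv | hv
  · exact absurd rfl huv
  · exact Or.inl (acc_of_pos hθne (hab' hnadj))
  · exact absurd (hXa v hv).symm hnadj
  · exact Or.inr (acc_of_pos hθne.symm (hya v hv (sym hnadj)))
  · exact Or.inr (acc_of_pos hθne.symm (hab' (sym hnadj)))
  · exact absurd rfl huv
  · exact Or.inr (acc_of_neg hθne.symm (hxb v hv (sym hnadj)))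
  · exact absurd (hYb v hv).symm hnadj
  · exact absurd (hXa u hu) hnadj
  · exact Or.inl (acc_of_neg hθne (hxb u hu hnadj))
  · exact Or.inl (acc_of_pos hθne (hxx u hu v hv))
  · rcases lt_trichotomy (k u) (k v) with h | h | h
    · exact Or.inl (acc_of_pos hθne (hxy1 u hu v hv h))
    · exact absurd ((hk u hu v hv).2 h) hnadj
    · exact Or.inr (acc_of_pos hθne.symm (hxy2 u hu v hv h))
  · exact Or.inl (acc_of_pos hθne (hya u hu hnadj))
  · exact absurd (hYb u hu) hnadj
  · rcases lt_trichotomy (k u) (k v) with h | h | h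
    · exact Or.inl (acc_of_pos hθne (hxy2 v hv u hu h))
    · exact absurd ((hk v hv u hu).2 h.symm).symm hnadj
    · exact Or.inr (acc_of_pos hθne.symm (hxy1 v hv u hu h))
  · exact Or.inl (acc_of_pos hθne (hyy u hu v hv))

/-- The two-separator case. -/
theorem caseP [Finite V] (h2 : TwoC G S) {a b : V} (hab : a ≠ b) (ha : a ∈ S) (hb : b ∈ S)
    (he : EarTwo G S {a, b}) {r : V} (hr : r ∈ S) : ∃ f, GoodOn G S r f := by
  classical
  obtain ⟨e, hei, -⟩ := exists_tie V
  set W : Set V := S \ {a, b} with hW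
  have hCS : ({a, b} : Set V) ⊆ S := by rintro x (rfl | rfl) <;> assumption
  have hCn : ({a, b} : Set V).Nontrivial := ⟨a, by simp, b, by simp, hab⟩
  have e1 : ∀ v ∈ W, G.Adj v a ∨ G.Adj v b := by
    intro v hv
    obtain ⟨c, hc | hc, h⟩ := E1 h2 hCS hCn he hv.1 hv.2
    · exact Or.inl (hc ▸ h)
    · exact Or.inr (hc ▸ h)
  have e2 : ∀ v ∈ W, G.Adj v a → G.Adj v b ∨ ∃ v' ∈ W, G.Adj v v' ∧ G.Adj v' b := by
    intro v hv hva
    obtain ⟨c, hc | hc, hne, h⟩ := E2 h2 hCS hCn he hv.1 hv.2 (c := a) (by simp) hva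
    · exact absurd hc hne
    · obtain rfl : c = b := hc
      rcases h with h | ⟨v', h1, h3, h4, h5⟩
      · exact Or.inl h
      · exact Or.inr ⟨v', ⟨h1, h3⟩, h4, h5⟩
  have e2' : ∀ v ∈ W, G.Adj v b → G.Adj v a ∨ ∃ v' ∈ W, G.Adj v v' ∧ G.Adj v' a := by
    intro v hv hva
    obtain ⟨c, hc | hc, hne, h⟩ := E2 h2 hCS hCn he hv.1 hv.2 (c := b) (by simp) hva
    · obtain rfl : c = a := hc
      rcases h with h | ⟨v', h1, h3, h4, h5⟩
      · exact Or.inl h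
      · exact Or.inr ⟨v', ⟨h1, h3⟩, h4, h5⟩
    · exact absurd hc hne
  have three : ∀ u ∈ W, ∀ v ∈ W, ∀ w ∈ W, G.Adj u v → G.Adj v w → u ≠ w → G.Adj u a → ¬ G.Adj w b := by
    intro u hu v hv w hw huv hvw huw hua hwb
    have := he [u, v, w] ⟨by simp [huv.ne, hvw.ne, huw], by simp [huv, hvw], by
      intro x hx; simp at hx; rcases hx with rfl | rfl | rfl <;> assumption⟩ u w (by simp) (by simp) a (by simp) b
      (by simp) hab hua hwb
    simp at this
  have F1 : ∀ v ∈ W, ∀ v' ∈ W, G.Adj v v' → (G.Adj v a ∧ G.Adj v' b) ∨ (G.Adj v b ∧ G.Adj v' a) := by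
    intro v hv v' hv' hvv
    by_contra hcon
    push Not at hcon
    rcases e1 v hv with h | h
    · have h3 := hcon.1 h
      have h4 := (e1 v' hv').resolve_right h3
      have h5 : ¬ G.Adj v b := fun h => hcon.2 h h4
      rcases e2 v hv h with h6 | ⟨w, hw, hvw, hwb⟩
      · exact h5 h6
      · exact three v' hv' v hv w hw hvv.symm hvw (fun e => h3 (e ▸ hwb)) h4 hwb
    · have h3 := hcon.2 h
      have h4 := (e1 v' hv').resolve_left h3
      have h5 : ¬ G.Adj v a := fun h => hcon.1 h h4
      rcases e2' v hv h with h6 | ⟨w, hw, hvw, hwb⟩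
      · exact h5 h6
      · exact three w hw v hv v' hv' hvw.symm hvv (fun e => h3 (e ▸ hwb)) hwb h4
  set Y : Set V := {v | v ∈ W ∧ G.Adj v b ∧ (¬ G.Adj v a ∨ ∃ v' ∈ W, G.Adj v v' ∧ G.Adj v' a ∧
    (¬ G.Adj v' b ∨ e v' < e v))} with hY
  set X : Set V := W \ Y with hX
  have YW : ∀ v ∈ Y, v ∈ W := fun v h => h.1
  have XW : ∀ v ∈ X, v ∈ W := fun v h => h.1
  have Yb : ∀ v ∈ Y, G.Adj v b := fun v h => h.2.1
  have Ydef : ∀ v ∈ Y, G.Adj v a → ∃ v' ∈ W, G.Adj v v' ∧ G.Adj v' a ∧ (¬ G.Adj v' b ∨ e v' < e v) :=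
    fun v h h1 => h.2.2.resolve_left (fun h3 => h3 h1)
  have Xdef : ∀ v ∈ X, G.Adj v b → G.Adj v a ∧ ∀ v' ∈ W, G.Adj v v' → G.Adj v' a → (G.Adj v' b ∧ ¬ e v' < e v) := by
    intro v hv hvb
    constructor
    · by_contra h
      exact hv.2 ⟨hv.1, hvb, Or.inl h⟩
    · intro v' hv' h1 h3
      by_contra h4
      refine hv.2 ⟨hv.1, hvb, Or.inr ⟨v', hv', h1, h3, ?_⟩⟩
      by_cases h5 : G.Adj v' b
      · right; by_contra h6; exact h4 ⟨h5, h6⟩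
      · exact Or.inl h5
  have Xa : ∀ v ∈ X, G.Adj v a := by
    intro v hv
    rcases e1 v hv.1 with h | h
    · exact h
    · exact (Xdef v hv h).1
  have Xi0 : ∀ v ∈ X, ∀ w ∈ X, G.Adj v b → ¬ G.Adj v w := by
    intro v hv w hw hvb hvw
    obtain ⟨h1, h3⟩ := (Xdef v hv hvb).2 w hw.1 hvw (Xa w hw)
    obtain ⟨h4, h5⟩ := (Xdef w hw h1).2 v hv.1 hvw.symm (Xa v hv)
    exact hvw.ne (hei (le_antisymm (not_lt.1 h3) (not_lt.1 h5)))
  have Xi : ∀ v ∈ X, ∀ w ∈ X, ¬ G.Adj v w := by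
    intro v hv w hw hvw
    rcases F1 v hv.1 w hw.1 hvw with h | h
    · exact Xi0 w hw v hv h.2 hvw.symm
    · exact Xi0 v hv w hw h.1 hvw
  have Yi0 : ∀ v ∈ Y, ∀ w ∈ Y, G.Adj v a → ¬ G.Adj v w := by
    intro v hv w hw hva hvw
    obtain ⟨v1, hv1, h1, h3, h4⟩ := Ydef v hv hva
    have e1 : v1 = w := by
      by_contra hne
      exact three v1 hv1 v hv.1 w hw.1 h1.symm hvw hne h3 (Yb w hw)
    subst e1
    have h5 := h4.resolve_left (fun h => h (Yb v1 hw))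
    obtain ⟨v2, hv2, g1, g3, g4⟩ := Ydef v1 hw h3
    have e2 : v2 = v := by
      by_contra hne
      exact three v2 hv2 v1 hw.1 v hv.1 g1.symm hvw.symm hne g3 (Yb v hv)
    subst e2
    have h6 := g4.resolve_left (fun h => h (Yb v2 hv))
    exact lt_asymm h5 h6
  have Yi : ∀ v ∈ Y, ∀ w ∈ Y, ¬ G.Adj v w := by
    intro v hv w hw hvw
    rcases F1 v hv.1 w hw.1 hvw with h | h
    · exact Yi0 v hv w hw h.1 hvw
    · exact Yi0 w hw v hv h.2 hvw.symm
  obtain ⟨n, ⟨q⟩⟩ := Finite.exists_equiv_fin (Set V)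
  refine caseP_geo hab ha hb X Y ?_ ?_ ?_ ?_ ?_ ?_ Xa Yb Xi Yi (fun v => (q {m | Rch G W v m}).val) ?_ hr
  · intro v hv
    by_cases h1 : v = a
    · exact Or.inl h1
    by_cases h3 : v = b
    · exact Or.inr (Or.inl h3)
    have : v ∈ W := ⟨hv, by simp [h1, h3]⟩
    by_cases h4 : v ∈ Y
    · exact Or.inr (Or.inr (Or.inr h4))
    · exact Or.inr (Or.inr (Or.inl ⟨this, h4⟩))
  · intro h; exact (XW a h).2 (by simp)
  · intro h; exact (YW a h).2 (by simp)
  · intro h; exact (XW b h).2 (by simp)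
  · intro h; exact (YW b h).2 (by simp)
  · intro v hv; exact hv.2
  · intro v hv w hw
    constructor
    · intro hvw
      have hv1 : v ∈ W := XW v hv
      have hw1 : w ∈ W := YW w hw
      have r1 : Rch G W v w := Relation.ReflTransGen.single ⟨hvw, hw1⟩
      have r2 : Rch G W w v := Relation.ReflTransGen.single ⟨hvw.symm, hv1⟩
      have : {m | Rch G W v m} = {m | Rch G W w m} := by
        ext m
        exact ⟨fun h => Relation.ReflTransGen.trans r2 h, fun h => Relation.ReflTransGen.trans r1 h⟩
      simp only [this]
    · intro h
      have hs : {m | Rch G W v m} = {m | Rch G W w m} := q.injective (Fin.ext h)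
      have hR : w ∈ {m | Rch G W v m} := by
        rw [hs]; exact Relation.ReflTransGen.refl
      obtain ⟨l, hl, hl1, hl2⟩ := Rch.path (XW v hv) hR
      have hlen := he l hl v w hl1 hl2 a (by simp) b (by simp) hab (Xa v hv) (Yb w hw)
      match l, hl, hl1, hl2, hlen with
      | [p], hl, hl1, hl2, _ =>
        simp at hl1 hl2
        exact absurd hw (by rw [← hl2, hl1]; exact hv.2)
      | [p, p'], hl, hl1, hl2, _ =>
        simp at hl1 hl2; subst hl1; subst hl2
        simpa using hl.2.1

end

end

section
set_option linter.unusedSectionVars false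
set_option linter.unusedVariables false
open Set Filter Topology

section
variable {V : Type} {G : SimpleGraph V} {S C O : Set V}
open scoped Fin.NatCast Fin.CommRing

/-- No cycle inside `S` is longer than six. -/
def Max6 (G : SimpleGraph V) (S : Set V) : Prop := ∀ l, CycL G S l → l.length ≤ 6

theorem no7 (hm : Max6 G S) (a b c d e f g : V)
    (h : (a ≠ b ∧ a ≠ c ∧ a ≠ d ∧ a ≠ e ∧ a ≠ f ∧ a ≠ g ∧ b ≠ c ∧ b ≠ d ∧ b ≠ e ∧ b ≠ f ∧ b ≠ g ∧ c ≠ d ∧ c ≠ e ∧ c ≠ f ∧ c ≠ g ∧ d ≠ e ∧ d ≠ f ∧ d ≠ g ∧ e ≠ f ∧ e ≠ g ∧ f ≠ g) ∧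
      (a ∈ S ∧ b ∈ S ∧ c ∈ S ∧ d ∈ S ∧ e ∈ S ∧ f ∈ S ∧ g ∈ S) ∧
      (G.Adj a b ∧ G.Adj b c ∧ G.Adj c d ∧ G.Adj d e ∧ G.Adj e f ∧ G.Adj f g ∧ G.Adj g a)) : False := by
  obtain ⟨h1, h2, h3⟩ := h
  have h : CycL G S [a, b, c, d, e, f, g] := by
    refine ⟨by simp, ⟨by simp only [List.nodup_cons, List.mem_cons, List.not_mem_nil, not_or, List.nodup_nil, not_false_eq_true, and_true]; tauto, by simp only [List.isChain_cons_cons, List.isChain_singleton, and_true]; tauto, by simpa using h2⟩, ?_⟩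
    intro x y hx hy
    simp at hx hy
    subst hx hy
    tauto
  have := hm _ h
  simp at this

theorem no8 (hm : Max6 G S) (a b c d e f g i : V)
    (h : (a ≠ b ∧ a ≠ c ∧ a ≠ d ∧ a ≠ e ∧ a ≠ f ∧ a ≠ g ∧ a ≠ i ∧ b ≠ c ∧ b ≠ d ∧ b ≠ e ∧ b ≠ f ∧ b ≠ g ∧ b ≠ i ∧ c ≠ d ∧ c ≠ e ∧ c ≠ f ∧ c ≠ g ∧ c ≠ i ∧ d ≠ e ∧ d ≠ f ∧ d ≠ g ∧ d ≠ i ∧ e ≠ f ∧ e ≠ g ∧ e ≠ i ∧ f ≠ g ∧ f ≠ i ∧ g ≠ i) ∧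
      (a ∈ S ∧ b ∈ S ∧ c ∈ S ∧ d ∈ S ∧ e ∈ S ∧ f ∈ S ∧ g ∈ S ∧ i ∈ S) ∧
      (G.Adj a b ∧ G.Adj b c ∧ G.Adj c d ∧ G.Adj d e ∧ G.Adj e f ∧ G.Adj f g ∧ G.Adj g i ∧ G.Adj i a)) : False := by
  obtain ⟨h1, h2, h3⟩ := h
  have h : CycL G S [a, b, c, d, e, f, g, i] := by
    refine ⟨by simp, ⟨by simp only [List.nodup_cons, List.mem_cons, List.not_mem_nil, not_or, List.nodup_nil, not_false_eq_true, and_true]; tauto, by simp only [List.isChain_cons_cons, List.isChain_singleton, and_true]; tauto, by simpa using h2⟩, ?_⟩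
    intro x y hx hy
    simp at hx hy
    subst hx hy
    tauto
  have := hm _ h
  simp at this

theorem no9 (hm : Max6 G S) (a b c d e f g i j : V)
    (h : (a ≠ b ∧ a ≠ c ∧ a ≠ d ∧ a ≠ e ∧ a ≠ f ∧ a ≠ g ∧ a ≠ i ∧ a ≠ j ∧ b ≠ c ∧ b ≠ d ∧ b ≠ e ∧ b ≠ f ∧ b ≠ g ∧ b ≠ i ∧ b ≠ j ∧ c ≠ d ∧ c ≠ e ∧ c ≠ f ∧ c ≠ g ∧ c ≠ i ∧ c ≠ j ∧ d ≠ e ∧ d ≠ f ∧ d ≠ g ∧ d ≠ i ∧ d ≠ j ∧ e ≠ f ∧ e ≠ g ∧ e ≠ i ∧ e ≠ j ∧ f ≠ g ∧ f ≠ i ∧ f ≠ j ∧ g ≠ i ∧ g ≠ j ∧ i ≠ j) ∧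
      (a ∈ S ∧ b ∈ S ∧ c ∈ S ∧ d ∈ S ∧ e ∈ S ∧ f ∈ S ∧ g ∈ S ∧ i ∈ S ∧ j ∈ S) ∧
      (G.Adj a b ∧ G.Adj b c ∧ G.Adj c d ∧ G.Adj d e ∧ G.Adj e f ∧ G.Adj f g ∧ G.Adj g i ∧ G.Adj i j ∧ G.Adj j a)) : False := by
  obtain ⟨h1, h2, h3⟩ := h
  have h : CycL G S [a, b, c, d, e, f, g, i, j] := by
    refine ⟨by simp, ⟨by simp only [List.nodup_cons, List.mem_cons, List.not_mem_nil, not_or, List.nodup_nil, not_false_eq_true, and_true]; tauto, by simp only [List.isChain_cons_cons, List.isChain_singleton, and_true]; tauto, by simpa using h2⟩, ?_⟩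
    intro x y hx hy
    simp at hx hy
    subst hx hy
    tauto
  have := hm _ h
  simp at this

/-- Six-cycles. -/
def Hex (G : SimpleGraph V) (S : Set V) (a b c d e f : V) : Prop :=
  (a ≠ b ∧ a ≠ c ∧ a ≠ d ∧ a ≠ e ∧ a ≠ f ∧ b ≠ c ∧ b ≠ d ∧ b ≠ e ∧ b ≠ f ∧ c ≠ d ∧ c ≠ e ∧ c ≠ f ∧ d ≠ e ∧ d ≠ f ∧ e ≠ f) ∧
  (a ∈ S ∧ b ∈ S ∧ c ∈ S ∧ d ∈ S ∧ e ∈ S ∧ f ∈ S) ∧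
  (G.Adj a b ∧ G.Adj b c ∧ G.Adj c d ∧ G.Adj d e ∧ G.Adj e f ∧ G.Adj f a)

/-- Vertices of `S` off the hexagon. -/
def Off (S : Set V) (a b c d e f y : V) : Prop :=
  y ∈ S ∧ y ≠ a ∧ y ≠ b ∧ y ≠ c ∧ y ≠ d ∧ y ≠ e ∧ y ≠ f

theorem Hex.rot {a b c d e f : V} (h : Hex G S a b c d e f) : Hex G S b c d e f a := by
  unfold Hex at *
  have sy : ∀ x y, G.Adj x y → G.Adj y x := fun _ _ h => h.symm
  grind

theorem Hex.refl {a b c d e f : V} (h : Hex G S a b c d e f) : Hex G S a f e d c b := by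
  unfold Hex at *
  have sy : ∀ x y, G.Adj x y → G.Adj y x := fun _ _ h => h.symm
  grind

theorem Off.rot {a b c d e f y : V} (h : Off S a b c d e f y) : Off S b c d e f a y := by
  unfold Off at *; tauto

theorem Off.refl {a b c d e f y : V} (h : Off S a b c d e f y) : Off S a f e d c b y := by
  unfold Off at *; tauto

theorem Hex.cycF {a b c d e f : V} (h : Hex G S a b c d e f) : CycF G S 6 ![a, b, c, d, e, f] := by
  unfold Hex at h
  refine ⟨by norm_num, ?_, ?_, ?_⟩
  · intro i j hij
    fin_cases i <;> fin_cases j <;> first | rfl | (exfalso; simp at hij; grind)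
  · intro i; fin_cases i <;> simp <;> tauto
  · intro i; fin_cases i <;> simp <;> tauto

theorem hex_range {a b c d e f y : V} : y ∈ range ![a, b, c, d, e, f] ↔ y = a ∨ y = b ∨ y = c ∨ y = d ∨ y = e ∨ y = f := by
  simp; tauto

theorem hex_off {a b c d e f y : V} : Off S a b c d e f y ↔ y ∈ S ∧ y ∉ range ![a, b, c, d, e, f] := by
  rw [hex_range]; unfold Off; tauto

theorem CycF.hex {c : Fin 6 → V} (h : CycF G S 6 c) (k : Fin 6) :
    Hex G S (c k) (c (k+1)) (c (k+2)) (c (k+3)) (c (k+4)) (c (k+5)) := by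
  have hi := h.inj
  have ne : ∀ i j : Fin 6, i ≠ j → c (k+i) ≠ c (k+j) := fun i j hij h => hij (add_left_cancel (hi h))
  have ne0 : ∀ j : Fin 6, 0 ≠ j → c k ≠ c (k+j) := fun j hij => by simpa using ne 0 j hij
  have ad := h.adj
  have e : k + 5 + 1 = k := by clear * -; revert k; decide
  have a1 := ad (k+1); have a2 := ad (k+2); have a3 := ad (k+3); have a4 := ad (k+4); have a5 := ad (k+5)
  rw [e] at a5
  rw [add_assoc] at a1 a2 a3 a4
  refine ⟨⟨ne0 _ (by decide), ne0 _ (by decide), ne0 _ (by decide), ne0 _ (by decide), ne0 _ (by decide),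
    ne _ _ (by decide), ne _ _ (by decide), ne _ _ (by decide), ne _ _ (by decide), ne _ _ (by decide),
    ne _ _ (by decide), ne _ _ (by decide), ne _ _ (by decide), ne _ _ (by decide), ne _ _ (by decide)⟩,
    ⟨h.mem _, h.mem _, h.mem _, h.mem _, h.mem _, h.mem _⟩, ad k, a1, a2, a3, a4, a5⟩

theorem CycF.off {c : Fin 6 → V} (k : Fin 6) {y : V} (hy : y ∈ S \ range c) :
    Off S (c k) (c (k+1)) (c (k+2)) (c (k+3)) (c (k+4)) (c (k+5)) y := by
  have : ∀ i, y ≠ c i := fun i h => hy.2 ⟨i, h.symm⟩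
  exact ⟨hy.1, this _, this _, this _, this _, this _, this _⟩

theorem Hex.E2 {a b c d e f y p : V} (h2 : TwoC G S) (hm : Max6 G S) (h : Hex G S a b c d e f)
    (hy : Off S a b c d e f y) (hp : p = a ∨ p = b ∨ p = c ∨ p = d ∨ p = e ∨ p = f) (hadj : G.Adj y p) :
    ∃ q, (q = a ∨ q = b ∨ q = c ∨ q = d ∨ q = e ∨ q = f) ∧ q ≠ p ∧
      (G.Adj y q ∨ ∃ y', Off S a b c d e f y' ∧ G.Adj y y' ∧ G.Adj y' q) := by
  have hc := h.cycF
  rw [hex_off] at hy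
  obtain ⟨q, hq, hqp, hh⟩ := _root_.E2 h2 hc.sub hc.nontriv (hc.earTwo le_rfl hm) hy.1 hy.2 (hex_range.2 hp) hadj
  refine ⟨q, hex_range.1 hq, hqp, ?_⟩
  rcases hh with hh | ⟨y', h1, h2, h3, h4⟩
  · exact Or.inl hh
  · exact Or.inr ⟨y', hex_off.2 ⟨h1, h2⟩, h3, h4⟩

theorem Hex.E1 {a b c d e f y : V} (h2 : TwoC G S) (hm : Max6 G S) (h : Hex G S a b c d e f)
    (hy : Off S a b c d e f y) :
    ∃ q, (q = a ∨ q = b ∨ q = c ∨ q = d ∨ q = e ∨ q = f) ∧ G.Adj y q := by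
  have hc := h.cycF
  rw [hex_off] at hy
  obtain ⟨q, hq, hqp⟩ := _root_.E1 h2 hc.sub hc.nontriv (hc.earTwo le_rfl hm) hy.1 hy.2
  exact ⟨q, hex_range.1 hq, hqp⟩

end

end

section
set_option linter.unusedSectionVars false
set_option linter.unusedVariables false
open Set Filter Topology

section
variable {V : Type} {G : SimpleGraph V} {S C O : Set V}

theorem caseA_b {a b c d e f w y : V} (h2 : TwoC G S) (hm : Max6 G S) (h : Hex G S a b c d e f)
    (hw : Off S a b c d e f w) (wa : G.Adj w a) (wc : G.Adj w c) (we : G.Adj w e)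
    (hy : Off S a b c d e f y) : ¬ G.Adj y b := by
  intro yb
  have sy : ∀ x y, G.Adj x y → G.Adj y x := fun _ _ h => h.symm
  have ne : ∀ x y, G.Adj x y → x ≠ y := fun _ _ h => h.ne
  have hE := h.E2 h2 hm hy (p := b) (by tauto) yb
  unfold Hex Off at *
  have hyw : y ≠ w := by
    intro hyw
    exact no7 hm a w b c d e f (by grind)
  obtain ⟨q, hq, hqb, hh | ⟨z, hz, yz, zq⟩⟩ := hE
  · rcases hq with hq | hq | hq | hq | hq | hq
    · exact no7 hm a y b c d e f (by grind)
    · exact hqb hq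
    · exact no7 hm a b y c d e f (by grind)
    · exact no8 hm a b y d c w e f (by grind)
    · exact no7 hm a b y e d c w (by grind)
    · exact no8 hm c b y f a w e d (by grind)
  · by_cases hzw : z = w
    · exact no8 hm w y b c d e f a (by grind)
    rcases hq with hq | hq | hq | hq | hq | hq
    · exact no8 hm y z a f e d c b (by grind)
    · exact hqb hq
    · exact no8 hm b y z c d e f a (by grind)
    · exact no7 hm b y z d e f a (by grind)
    · exact no8 hm a b y z e d c w (by grind)
    · exact no7 hm b y z f e d c (by grind)

theorem caseA [Finite V] {a b c d e f w r : V} (h2 : TwoC G S) (hm : Max6 G S) (h : Hex G S a b c d e f)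
    (hw : Off S a b c d e f w) (wa : G.Adj w a) (wc : G.Adj w c) (we : G.Adj w e) (hr : r ∈ S) :
    ∃ f, GoodOn G S r f := by
  have sy : ∀ x y, G.Adj x y → G.Adj y x := fun _ _ h => h.symm
  have ne : ∀ x y, G.Adj x y → x ≠ y := fun _ _ h => h.ne
  have yb : ∀ y, Off S a b c d e f y → ¬ G.Adj y b := fun y hy => caseA_b h2 hm h hw wa wc we hy
  have yd : ∀ y, Off S a b c d e f y → ¬ G.Adj y d := fun y hy =>
    caseA_b h2 hm h.rot.rot hw.rot.rot wc we wa hy.rot.rot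
  have yf : ∀ y, Off S a b c d e f y → ¬ G.Adj y f := fun y hy =>
    caseA_b h2 hm h.rot.rot.rot.rot hw.rot.rot.rot.rot we wa wc hy.rot.rot.rot.rot
  have hE1 := fun y (hy : Off S a b c d e f y) => h.E1 h2 hm hy
  have hE2 := fun y (hy : Off S a b c d e f y) p hp hadj => h.E2 h2 hm (p := p) hy hp hadj
  have hh := h
  unfold Hex at h
  have bd : ¬ G.Adj b d := fun hbd => by
    unfold Off at hw
    exact no7 hm a b d c w e f (by grind)
  have df : ¬ G.Adj d f := fun hbd => by
    unfold Off at hw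
    exact no7 hm c d f e w a b (by grind)
  have fb : ¬ G.Adj f b := fun hbd => by
    unfold Off at hw
    exact no7 hm e f b a w c d (by grind)
  have three : ∀ y, Off S a b c d e f y → ∀ q, (q = a ∨ q = b ∨ q = c ∨ q = d ∨ q = e ∨ q = f) → G.Adj y q →
      q = a ∨ q = c ∨ q = e := by
    intro y hy q hq hyq
    have := yb y hy
    have := yd y hy
    have := yf y hy
    grind
  have key : ∀ y z, Off S a b c d e f y → Off S a b c d e f z → G.Adj y z → ∀ p q, (p = a ∨ p = c ∨ p = e) →
      (q = a ∨ q = c ∨ q = e) → p ≠ q → G.Adj y p → G.Adj z q → False := by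
    intro y z hy hz hyz p q hp hq hpq hyp hzq
    unfold Off at hy hz
    rcases hp with hp | hp | hp <;> rcases hq with hq | hq | hq
    · grind
    · exact no7 hm a y z c d e f (by grind)
    · exact no7 hm a y z e d c b (by grind)
    · exact no7 hm a z y c d e f (by grind)
    · grind
    · exact no7 hm c y z e f a b (by grind)
    · exact no7 hm a z y e d c b (by grind)
    · exact no7 hm c z y e f a b (by grind)
    · grind
  have indep : ∀ y z, Off S a b c d e f y → Off S a b c d e f z → ¬ G.Adj y z := by
    intro y z hy hz hyz
    obtain ⟨p, hp, hyp⟩ := hE1 y hy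
    obtain ⟨q, hq, hzq⟩ := hE1 z hz
    have hp' := three y hy p hp hyp
    have hq' := three z hz q hq hzq
    by_cases hpq : p = q
    · subst hpq
      obtain ⟨p', h1, h2, h3 | ⟨y', h3, h4, h5⟩⟩ := hE2 y hy p hp hyp
      · exact key y z hy hz hyz p' p (three y hy p' h1 h3) hq' h2 h3 hzq
      · exact key y y' hy h3 h4 p p' hp' (three y' h3 p' h1 h5) (Ne.symm h2) hyp h5
    · exact key y z hy hz hyz p q hp' hq' hpq hyp hzq
  have two : ∀ y, Off S a b c d e f y →
      ((G.Adj y a ∧ G.Adj y c) ∨ (G.Adj y c ∧ G.Adj y e) ∨ (G.Adj y a ∧ G.Adj y e)) := by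
    intro y hy
    obtain ⟨p, hp, hyp⟩ := hE1 y hy
    have hp' := three y hy p hp hyp
    obtain ⟨p', h1, h2, h3 | ⟨y', h3, h4, h5⟩⟩ := hE2 y hy p hp hyp
    · have := three y hy p' h1 h3
      clear hE1 hE2 three key indep yb yd yf
      grind
    · exact absurd h4 (indep _ _ hy h3)
  refine caseS (a := a) (b := c) (c := e) (by grind) (by grind) (by grind) (by grind) (by grind) (by grind) ?_ hr
  intro v hv va vc ve
  by_cases hvb : v = b
  · subst hvb
    refine ⟨fun x hx hvx => ?_, Or.inl (by grind)⟩
    by_contra hcon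
    have hbe : ∀ x, Off S a v c d e f x → ¬ G.Adj x v := yb
    have := hbe x
    unfold Off at this
    grind
  by_cases hvd : v = d
  · subst hvd
    refine ⟨fun x hx hvx => ?_, Or.inr (Or.inl (by grind))⟩
    by_contra hcon
    have := yd x
    unfold Off at this
    grind
  by_cases hvf : v = f
  · subst hvf
    refine ⟨fun x hx hvx => ?_, Or.inr (Or.inr (by grind))⟩
    by_contra hcon
    have := yf x
    unfold Off at this
    grind
  have hvo : Off S a b c d e f v := ⟨hv, va, hvb, vc, hvd, ve, hvf⟩
  refine ⟨fun x hx hvx => ?_, two v hvo⟩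
  have i := indep v x hvo
  have t := three v hvo x
  clear yb yd yf hE1 hE2 three key indep two
  unfold Off at i
  grind

end

end

section
set_option linter.unusedSectionVars false
set_option linter.unusedVariables false
open Set Filter Topology

section
variable {V : Type} {G : SimpleGraph V} {S C O : Set V}

/-- A triangle together with an apex joined to it by three paths of length two. -/
def NS (G : SimpleGraph V) (S : Set V) (z a b c x y t : V) : Prop :=
  (z ≠ a ∧ z ≠ b ∧ z ≠ c ∧ z ≠ x ∧ z ≠ y ∧ z ≠ t ∧ a ≠ b ∧ a ≠ c ∧ a ≠ x ∧ a ≠ y ∧ a ≠ t ∧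
    b ≠ c ∧ b ≠ x ∧ b ≠ y ∧ b ≠ t ∧ c ≠ x ∧ c ≠ y ∧ c ≠ t ∧ x ≠ y ∧ x ≠ t ∧ y ≠ t) ∧
  (z ∈ S ∧ a ∈ S ∧ b ∈ S ∧ c ∈ S ∧ x ∈ S ∧ y ∈ S ∧ t ∈ S) ∧
  (G.Adj a b ∧ G.Adj b c ∧ G.Adj a c ∧ G.Adj a x ∧ G.Adj b y ∧ G.Adj c t ∧ G.Adj x z ∧ G.Adj y z ∧ G.Adj t z)

/-- Vertices off the structure. -/
def NOff (S : Set V) (z a b c x y t v : V) : Prop :=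
  v ∈ S ∧ v ≠ z ∧ v ≠ a ∧ v ≠ b ∧ v ≠ c ∧ v ≠ x ∧ v ≠ y ∧ v ≠ t

theorem NS.swap {z a b c x y t : V} (h : NS G S z a b c x y t) : NS G S z b a c y x t := by
  unfold NS at *
  have sy : ∀ x y, G.Adj x y → G.Adj y x := fun _ _ h => h.symm
  grind

theorem NS.cyc {z a b c x y t : V} (h : NS G S z a b c x y t) : NS G S z b c a y t x := by
  unfold NS at *
  have sy : ∀ x y, G.Adj x y → G.Adj y x := fun _ _ h => h.symm
  grind

theorem NOff.swap {z a b c x y t v : V} (h : NOff S z a b c x y t v) : NOff S z b a c y x t v := by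
  unfold NOff at *; tauto

theorem NOff.cyc {z a b c x y t v : V} (h : NOff S z a b c x y t v) : NOff S z b c a y t x v := by
  unfold NOff at *; tauto

theorem NS.hex {z a b c x y t : V} (h : NS G S z a b c x y t) : Hex G S z x a c b y := by
  unfold NS at h; unfold Hex
  have sy : ∀ x y, G.Adj x y → G.Adj y x := fun _ _ h => h.symm
  grind

theorem NS.xy {z a b c x y t : V} (hm : Max6 G S) (h : NS G S z a b c x y t) : ¬ G.Adj x y := by
  intro hxy
  unfold NS at h
  have sy : ∀ x y, G.Adj x y → G.Adj y x := fun _ _ h => h.symm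
  exact no7 hm z t c b a x y (by grind)

theorem NS.xb {z a b c x y t : V} (hm : Max6 G S) (h : NS G S z a b c x y t) : ¬ G.Adj x b := by
  intro hxy
  unfold NS at h
  have sy : ∀ x y, G.Adj x y → G.Adj y x := fun _ _ h => h.symm
  exact no7 hm z t c a x b y (by grind)

theorem NS.vx {z a b c x y t v : V} (h2 : TwoC G S) (hm : Max6 G S) (h : NS G S z a b c x y t)
    (hv : NOff S z a b c x y t v) : ¬ G.Adj v x := by
  intro hvx
  have sy : ∀ x y, G.Adj x y → G.Adj y x := fun _ _ h => h.symm
  have ne : ∀ x y, G.Adj x y → x ≠ y := fun _ _ h => h.ne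
  have ho : Off S z x a c b y v := by unfold NOff at hv; unfold Off; tauto
  have hE := h.hex.E2 h2 hm ho (p := x) (by tauto) hvx
  unfold NS NOff Off at *
  obtain ⟨q, hq, hqb, hh | ⟨w, hz, vw, wq⟩⟩ := hE
  · rcases hq with hq | hq | hq | hq | hq | hq
    · exact no7 hm z v x a c b y (by grind)
    · exact hqb hq
    · exact no7 hm x v a c b y z (by grind)
    · exact no8 hm z t c v x a b y (by grind)
    · exact no8 hm z t c a x v b y (by grind)
    · exact no7 hm z t c a x v y (by grind)
  · by_cases hwt : w = t
    · exact no7 hm z y b a x v t (by grind)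
    rcases hq with hq | hq | hq | hq | hq | hq
    · exact no7 hm x v w z y b a (by grind)
    · exact hqb hq
    · exact no7 hm x v w a b y z (by grind)
    · exact no7 hm x v w c b y z (by grind)
    · exact no7 hm x v w b c t z (by grind)
    · exact no7 hm x v w y b c a (by grind)

theorem NS.vab {z a b c x y t v : V} (hm : Max6 G S) (h : NS G S z a b c x y t)
    (hv : NOff S z a b c x y t v) (hva : G.Adj v a) : ¬ G.Adj v b := by
  intro hxy
  unfold NS NOff at *
  have sy : ∀ x y, G.Adj x y → G.Adj y x := fun _ _ h => h.symm
  exact no7 hm z x a v b c t (by grind)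

theorem NS.vwc {z a b c x y t v w : V} (hm : Max6 G S) (h : NS G S z a b c x y t)
    (hv : NOff S z a b c x y t v) (hw : NOff S z a b c x y t w) (hvw : G.Adj v w) (hva : G.Adj v z) : ¬ G.Adj w c := by
  intro hxy
  unfold NS NOff at *
  have sy : ∀ x y, G.Adj x y → G.Adj y x := fun _ _ h => h.symm
  have ne : ∀ x y, G.Adj x y → x ≠ y := fun _ _ h => h.ne
  exact no7 hm z v w c a b y (by grind)

theorem NS.vwb {z a b c x y t v w : V} (hm : Max6 G S) (h : NS G S z a b c x y t)
    (hv : NOff S z a b c x y t v) (hw : NOff S z a b c x y t w) (hvw : G.Adj v w) (hva : G.Adj v a) : ¬ G.Adj w b := by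
  intro hxy
  unfold NS NOff at *
  have sy : ∀ x y, G.Adj x y → G.Adj y x := fun _ _ h => h.symm
  have ne : ∀ x y, G.Adj x y → x ≠ y := fun _ _ h => h.ne
  exact no7 hm a v w b y z x (by grind)

theorem NS.nbx {z a b c x y t : V} (h2 : TwoC G S) (hm : Max6 G S) (h : NS G S z a b c x y t) :
    ∀ u ∈ S, G.Adj x u ↔ u = a ∨ u = z := by
  intro u hu
  have sy : ∀ x y, G.Adj x y → G.Adj y x := fun _ _ h => h.symm
  have f1 := h.xy hm
  have f2 := h.swap.cyc.xy hm
  have f3 := h.xb hm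
  have f4 := h.swap.cyc.xb hm
  have f5 := fun hv => h.vx (v := u) h2 hm hv
  have ne : ∀ x y, G.Adj x y → x ≠ y := fun _ _ h => h.ne
  unfold NS NOff at *
  constructor
  · intro hxu
    by_contra hcon
    grind
  · grind

theorem NS.good [Finite V] {z a b c x y t r : V} (h2 : TwoC G S) (hm : Max6 G S) (h : NS G S z a b c x y t)
    (hr : r ∈ S) : ∃ f, GoodOn G S r f := by
  have sy : ∀ x y, G.Adj x y → G.Adj y x := fun _ _ h => h.symm
  have vx : ∀ v, NOff S z a b c x y t v → ¬ G.Adj v x := fun v hv => h.vx h2 hm hv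
  have vy : ∀ v, NOff S z a b c x y t v → ¬ G.Adj v y := fun v hv => h.cyc.vx h2 hm hv.cyc
  have vt : ∀ v, NOff S z a b c x y t v → ¬ G.Adj v t := fun v hv => h.cyc.cyc.vx h2 hm hv.cyc.cyc
  have off : ∀ v, NOff S z a b c x y t v → Off S z x a c b y v := by
    intro v hv; unfold NOff at hv; unfold Off; tauto
  have nof : ∀ v, Off S z x a c b y v → v ≠ t → NOff S z a b c x y t v := by
    intro v hv; unfold Off at hv; unfold NOff; tauto
  have hE1 : ∀ v, NOff S z a b c x y t v → ∃ q, (q = z ∨ q = a ∨ q = b ∨ q = c) ∧ G.Adj v q := by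
    intro v hv
    obtain ⟨q, hq, hvq⟩ := h.hex.E1 h2 hm (off v hv)
    have := vx v hv
    have := vy v hv
    refine ⟨q, ?_, hvq⟩
    rcases hq with hq | hq | hq | hq | hq | hq
    · tauto
    · subst hq; contradiction
    · tauto
    · tauto
    · tauto
    · subst hq; contradiction
  have hE2 : ∀ v, NOff S z a b c x y t v → ∀ p, (p = z ∨ p = a ∨ p = b ∨ p = c) → G.Adj v p →
      ∃ q, (q = z ∨ q = a ∨ q = b ∨ q = c) ∧ q ≠ p ∧ (G.Adj v q ∨
        ∃ w, NOff S z a b c x y t w ∧ G.Adj v w ∧ G.Adj w q) := by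
    intro v hv p hp hvp
    obtain ⟨q, hq, hqp, hh⟩ := h.hex.E2 h2 hm (off v hv) (p := p) (by tauto) hvp
    have hx := vx v hv
    have hy := vy v hv
    have hh' : (G.Adj v q ∨ ∃ w, NOff S z a b c x y t w ∧ G.Adj v w ∧ G.Adj w q) := by
      rcases hh with hh | ⟨w, h1, h2, h3⟩
      · exact Or.inl hh
      · refine Or.inr ⟨w, nof w h1 ?_, h2, h3⟩
        rintro rfl
        exact vt v hv h2
    refine ⟨q, ?_, hqp, hh'⟩
    have hqx : q ≠ x := by
      rintro rfl
      rcases hh' with hh | ⟨w, h1, h2, h3⟩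
      · exact hx hh
      · exact vx w h1 h3
    have hqy : q ≠ y := by
      rintro rfl
      rcases hh' with hh | ⟨w, h1, h2, h3⟩
      · exact hy hh
      · exact vy w h1 h3
    tauto
  have key : ∀ v w, NOff S z a b c x y t v → NOff S z a b c x y t w → G.Adj v w → ∀ p q,
      (p = z ∨ p = a ∨ p = b ∨ p = c) → (q = z ∨ q = a ∨ q = b ∨ q = c) → p ≠ q →
      G.Adj v p → G.Adj w q → False := by
    intro v w hv hw hvw p q hp hq hpq hvp hwq
    rcases hp with hp | hp | hp | hp <;> rcases hq with hq | hq | hq | hq <;>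
      rw [hp] at hvp <;> rw [hq] at hwq
    · exact hpq (hp.trans hq.symm)
    · exact h.cyc.vwc hm hv.cyc hw.cyc hvw hvp hwq
    · exact h.cyc.cyc.vwc hm hv.cyc.cyc hw.cyc.cyc hvw hvp hwq
    · exact h.vwc hm hv hw hvw hvp hwq
    · exact h.cyc.vwc hm hw.cyc hv.cyc hvw.symm hwq hvp
    · exact hpq (hp.trans hq.symm)
    · exact h.vwb hm hv hw hvw hvp hwq
    · exact h.cyc.cyc.vwb hm hw.cyc.cyc hv.cyc.cyc hvw.symm hwq hvp
    · exact h.cyc.cyc.vwc hm hw.cyc.cyc hv.cyc.cyc hvw.symm hwq hvp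
    · exact h.vwb hm hw hv hvw.symm hwq hvp
    · exact hpq (hp.trans hq.symm)
    · exact h.cyc.vwb hm hv.cyc hw.cyc hvw hvp hwq
    · exact h.vwc hm hw hv hvw.symm hwq hvp
    · exact h.cyc.cyc.vwb hm hv.cyc.cyc hw.cyc.cyc hvw hvp hwq
    · exact h.cyc.vwb hm hw.cyc hv.cyc hvw.symm hwq hvp
    · exact hpq (hp.trans hq.symm)
  have indep : ∀ v w, NOff S z a b c x y t v → NOff S z a b c x y t w → ¬ G.Adj v w := by
    intro v w hv hw hvw
    obtain ⟨p, hp, hvp⟩ := hE1 v hv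
    obtain ⟨q, hq, hwq⟩ := hE1 w hw
    by_cases hpq : p = q
    · subst hpq
      obtain ⟨p', h1, h2, h3 | ⟨y', h3, h4, h5⟩⟩ := hE2 v hv p hp hvp
      · exact key v w hv hw hvw p' p h1 hq h2 h3 hwq
      · exact key v y' hv h3 h4 p p' hp h1 (Ne.symm h2) hvp h5
    · exact key v w hv hw hvw p q hp hq hpq hvp hwq
  have nx := h.nbx h2 hm
  have ny := h.cyc.nbx h2 hm
  have nt := h.cyc.cyc.nbx h2 hm
  have hNS := h
  unfold NS at h
  refine caseN (a := a) (b := b) (c := c) (z := z) (by tauto) (by tauto) (by tauto) (by tauto) (by tauto) (by tauto)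
    (by tauto) (by grind) (by grind) (by grind) ?_ hr
  intro v hv va vb vc vz
  by_cases hvx : v = x
  · left; rw [hvx]; exact nx
  by_cases hvy : v = y
  · right; left; rw [hvy]; exact ny
  by_cases hvt : v = t
  · right; right; rw [hvt]; exact nt
  have ho : NOff S z a b c x y t v := ⟨hv, vz, va, vb, vc, hvx, hvy, hvt⟩
  obtain ⟨p, hp, hvp⟩ := hE1 v ho
  obtain ⟨q, hq, hqp, hvq | ⟨w, hw, hvw, _⟩⟩ := hE2 v ho p hp hvp
  swap
  · exact absurd hvw (indep v w ho hw)
  have g1 := fun h => hNS.vab hm ho h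
  have g2 := fun h => hNS.cyc.vab hm ho.cyc h
  have g3 := fun h => hNS.cyc.cyc.vab hm ho.cyc.cyc h
  have gx := vx v ho
  have gy := vy v ho
  have gt := vt v ho
  have gi := fun w => indep v w ho
  clear hE1 hE2 key indep nx ny nt vx vy vt off nof hNS
  have hnb : ∀ u ∈ S, G.Adj v u → u = a ∨ u = b ∨ u = c ∨ u = z := by
    intro u hu hvu
    by_contra hcon
    have := gi u
    unfold NOff at this
    grind
  clear gi
  have hz : G.Adj v z := by grind
  have : G.Adj v a ∨ G.Adj v b ∨ G.Adj v c := by grind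
  rcases this with h' | h' | h'
  · left; intro u hu
    have := hnb u hu
    grind
  · right; left; intro u hu
    have := hnb u hu
    grind
  · right; right; intro u hu
    have := hnb u hu
    grind

end

end

section
set_option linter.unusedSectionVars false
set_option linter.unusedVariables false
open Set Filter Topology

section
variable {V : Type} {G : SimpleGraph V} {S C O : Set V}

/-- A hexagon together with an ear of length two or three between antipodal vertices. -/
def CC (G : SimpleGraph V) (S : Set V) (a b c d e f u u' : V) : Prop :=
  Hex G S a b c d e f ∧ Off S a b c d e f u ∧ Off S a b c d e f u' ∧ G.Adj u a ∧ G.Adj u' d ∧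
    (u = u' ∨ G.Adj u u')

theorem CC.refl {a b c d e f u u' : V} (h : CC G S a b c d e f u u') : CC G S a f e d c b u u' :=
  ⟨h.1.refl, h.2.1.refl, h.2.2.1.refl, h.2.2.2⟩

theorem CC.flip {a b c d e f u u' : V} (h : CC G S a b c d e f u u') : CC G S d c b a f e u' u := by
  obtain ⟨h1, h2, h3, h4, h5, h6⟩ := h
  refine ⟨h1.refl.rot.rot.rot, h3.refl.rot.rot.rot, h2.refl.rot.rot.rot, h5, h4, ?_⟩
  rcases h6 with h | h
  · exact Or.inl h.symm
  · exact Or.inr h.symm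

theorem CC.ub {a b c d e f u u' : V} (hm : Max6 G S) (h : CC G S a b c d e f u u') :
    ¬ G.Adj u b ∧ ¬ G.Adj u' b := by
  have sy : ∀ x y, G.Adj x y → G.Adj y x := fun _ _ h => h.symm
  have ne : ∀ x y, G.Adj x y → x ≠ y := fun _ _ h => h.ne
  unfold CC Hex Off at h
  constructor
  · intro hub
    exact no7 hm a u b c d e f (by grind)
  · intro hub
    obtain ⟨h1, h2, h3, h4, h5, huu | huu⟩ := h
    · exact no7 hm a u b c d e f (by grind)
    · exact no8 hm a u u' b c d e f (by grind)

theorem CC.be {a b c d e f u u' : V} (hm : Max6 G S) (h : CC G S a b c d e f u u') : ¬ G.Adj b e := by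
  have sy : ∀ x y, G.Adj x y → G.Adj y x := fun _ _ h => h.symm
  have ne : ∀ x y, G.Adj x y → x ≠ y := fun _ _ h => h.ne
  unfold CC Hex Off at h
  intro hbe
  obtain ⟨h1, h2, h3, h4, h5, huu | huu⟩ := h
  · exact no7 hm a u d c b e f (by grind)
  · exact no8 hm a u u' d c b e f (by grind)

theorem CC.bf [Finite V] {a b c d e f u u' r : V} (h2 : TwoC G S) (hm : Max6 G S)
    (h : CC G S a b c d e f u u') (hbf : G.Adj b f) (hr : r ∈ S) : ∃ f, GoodOn G S r f := by
  have sy : ∀ x y, G.Adj x y → G.Adj y x := fun _ _ h => h.symm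
  have ne : ∀ x y, G.Adj x y → x ≠ y := fun _ _ h => h.ne
  unfold CC Hex Off at h
  obtain ⟨h1, h2', h3, h4, h5, huu | huu⟩ := h
  · have hN : NS G S d b f a c e u := by
      unfold NS
      grind
    exact hN.good h2 hm hr
  · exfalso
    exact no7 hm a u u' d c b f (by grind)

theorem CC.yf {a b c d e f u u' y : V} (hm : Max6 G S) (h : CC G S a b c d e f u u')
    (hy : Off S a b c d e f y) (hyb : G.Adj y b) : ¬ G.Adj y f ∧ ¬ G.Adj y e := by
  have sy : ∀ x y, G.Adj x y → G.Adj y x := fun _ _ h => h.symm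
  have ne : ∀ x y, G.Adj x y → x ≠ y := fun _ _ h => h.ne
  have hub := h.ub hm
  have hyu : y ≠ u ∧ y ≠ u' := by
    constructor <;> rintro rfl <;> tauto
  unfold CC Hex Off at *
  obtain ⟨h1, h2, h3, h4, h5, huu | huu⟩ := h
  · constructor
    · intro hyf
      exact no7 hm a u d c b y f (by grind)
    · intro hyf
      exact no8 hm a u d c b y e f (by grind)
  · constructor
    · intro hyf
      exact no8 hm a u u' d c b y f (by grind)
    · intro hyf
      exact no9 hm a u u' d c b y e f (by grind)

theorem no10 (hm : Max6 G S) {l : List V} (hl : 7 ≤ l.length) (h : CycL G S l) : False := by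
  have := hm l h
  omega

theorem CC.yz {a b c d e f u u' y z : V} (h2 : TwoC G S) (hm : Max6 G S) (h : CC G S a b c d e f u u')
    (hy : Off S a b c d e f y) (hyb : G.Adj y b) (hz : Off S a b c d e f z) (hyz : G.Adj y z) :
    G.Adj z b ∨ G.Adj z c := by
  have sy : ∀ x y, G.Adj x y → G.Adj y x := fun _ _ h => h.symm
  have ne : ∀ x y, G.Adj x y → x ≠ y := fun _ _ h => h.ne
  have hub := h.ub hm
  have hyu : y ≠ u ∧ y ≠ u' := by
    constructor <;> rintro rfl <;> tauto
  obtain ⟨q, hq, hzq⟩ := h.1.E1 h2 hm hz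
  unfold CC Hex Off at *
  have hza : ¬ G.Adj z a := by
    intro hza
    exact no8 hm a z y b c d e f (by grind)
  have hzd : ¬ G.Adj z d := by
    intro hzd
    exact no7 hm b y z d e f a (by grind)
  have hzu : z ≠ u ∧ z ≠ u' := by grind
  rcases hq with hq | hq | hq | hq | hq | hq
  · grind
  · grind
  · grind
  · grind
  · exfalso
    obtain ⟨h1, h2, h3, h4, h5, huu | huu⟩ := h
    · exact no9 hm a u d c b y z e f (by grind)
    · exact no8 hm b y z e d u' u a (by grind)
  · exfalso
    exact no7 hm b y z f e d c (by grind)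

theorem chain_iff {D W : Set V} (hD : ∀ x ∈ W, ∀ y ∈ W, G.Adj x y → (x ∈ D → y ∈ D)) :
    ∀ l : List V, l.IsChain G.Adj → (∀ x ∈ l, x ∈ W) → ∀ x ∈ l, ∀ y ∈ l, x ∈ D → y ∈ D := by
  intro l
  induction l with
  | nil => simp
  | cons p l ih =>
    intro hch hW
    cases l with
    | nil => simp
    | cons q l =>
      rw [List.isChain_cons_cons] at hch
      have ih' := ih hch.2 (fun x hx => hW x (List.mem_cons_of_mem _ hx))
      have hpq := hD p (hW p (by simp)) q (hW q (by simp)) hch.1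
      have hqp := hD q (hW q (by simp)) p (hW p (by simp)) hch.1.symm
      intro x hx y hy hxD
      have hxx : q ∈ D := by
        rcases List.mem_cons.1 hx with rfl | hx
        · exact hpq hxD
        · exact ih' x hx q (by simp) hxD
      rcases List.mem_cons.1 hy with rfl | hy
      · exact hqp hxx
      · exact ih' q (by simp) y hy hxx

theorem close4 (hm : Max6 G S) {l : List V} {x y d p q a : V} (hl : IsPth G S l) (hx : l.head? = some x)
    (hy : l.getLast? = some y) (h3 : 3 ≤ l.length) (hxa : G.Adj x a) (hyd : G.Adj y d)
    (hdp : G.Adj d p) (hpq : G.Adj p q) (hqa : G.Adj q a) (hne : [d, p, q, a].Nodup)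
    (hS : ∀ v ∈ [d, p, q, a], v ∈ S) (hdis : ∀ v ∈ [d, p, q, a], v ∉ l) : False := by
  refine no10 hm (l := l ++ [d, p, q, a]) (by simp; omega) ⟨by simp, ⟨?_, ?_, ?_⟩, ?_⟩
  · rw [List.nodup_append]
    refine ⟨hl.1, hne, ?_⟩
    rintro v hv w hw rfl
    exact hdis v hw hv
  · rw [List.isChain_append]
    refine ⟨hl.2.1, by simp [hdp, hpq, hqa], ?_⟩
    intro v hv w hw
    rw [hy] at hv
    simp at hv hw
    subst hv hw
    exact hyd
  · intro v hv
    rcases List.mem_append.1 hv with hv | hv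
    · exact hl.2.2 v hv
    · exact hS v hv
  · intro v w hv hw
    have h1 : v = x := by
      cases l with
      | nil => simp at hx
      | cons t l => simp at hv hx; exact hv.symm.trans hx
    have h2 : w = a := by
      simp at hw; exact hw.symm
    rw [h1, h2]; exact hxa.symm

theorem CC.ear [Finite V] {a b c d e f u u' : V} (h2 : TwoC G S) (hm : Max6 G S)
    (h : CC G S a b c d e f u u') (bf : ¬ G.Adj b f) (ce : ¬ G.Adj c e) : EarTwo G S {a, d} := by
  have sy : ∀ x y, G.Adj x y → G.Adj y x := fun _ _ h => h.symm
  have ne : ∀ x y, G.Adj x y → x ≠ y := fun _ _ h => h.ne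
  set D : Set V := {y | y = b ∨ y = c ∨ (Off S a b c d e f y ∧ (G.Adj y b ∨ G.Adj y c))} with hD
  have fo : ∀ y, Off S a b c d e f y → Off S d c b a f e y := fun y h => h.refl.rot.rot.rot
  have be := h.be hm
  have cf := h.flip.be hm
  have g1 := fun y hy hyb => h.yf hm (y := y) hy hyb
  have g2 := fun y hy hyb => h.flip.yf hm (y := y) (fo y hy) hyb
  have g3 := fun y z hy hyb hz hyz => h.yz h2 hm (y := y) (z := z) hy hyb hz hyz
  have g4 := fun y z hy hyb hz hyz => h.flip.yz h2 hm (y := y) (z := z) (fo y hy) hyb (fo z hz) hyz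
  have hcl : ∀ x ∈ S \ {a, d}, ∀ y ∈ S \ {a, d}, G.Adj x y → (x ∈ D → y ∈ D) := by
    intro x hx y hy hxy hxD
    have hyo : y = b ∨ y = c ∨ y = e ∨ y = f ∨ Off S a b c d e f y := by
      have h1 := hy.1
      have h2 := hy.2
      simp only [mem_insert_iff, mem_singleton_iff, not_or] at h2
      unfold Off
      tauto
    rcases hyo with rfl | rfl | hye | hyf | hyo
    · exact Or.inl rfl
    · exact Or.inr (Or.inl rfl)
    · exfalso
      rw [hye] at hxy
      rcases hxD with rfl | rfl | ⟨ho, hb | hb⟩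
      · exact be hxy
      · exact ce hxy
      · exact (g1 x ho hb).2 hxy
      · exact (g2 x ho hb).1 hxy
    · exfalso
      rw [hyf] at hxy
      rcases hxD with rfl | rfl | ⟨ho, hb | hb⟩
      · exact bf hxy
      · exact cf hxy
      · exact (g1 x ho hb).1 hxy
      · exact (g2 x ho hb).2 hxy
    · refine Or.inr (Or.inr ⟨hyo, ?_⟩)
      rcases hxD with rfl | rfl | ⟨ho, hb | hb⟩
      · exact Or.inl hxy.symm
      · exact Or.inr hxy.symm
      · exact g3 x y ho hb hyo hxy
      · exact (g4 x y ho hb hyo hxy).symm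
  have heD : e ∉ D := by
    intro he
    have := h.1
    unfold Hex at this
    rcases he with he | he | he
    · grind
    · grind
    · unfold Off at he; grind
  have hfD : f ∉ D := by
    intro he
    have := h.1
    unfold Hex at this
    rcases he with he | he | he
    · grind
    · grind
    · unfold Off at he; grind
  have main : ∀ l, IsPth G (S \ {a, d}) l → ∀ x y, l.head? = some x → l.getLast? = some y →
      G.Adj x a → G.Adj y d → l.length ≤ 2 := by
    intro l hl x y hx hy hxa hyd
    by_contra hlen
    have hlS : IsPth G S l := ⟨hl.1, hl.2.1, fun v hv => (hl.2.2 v hv).1⟩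
    have hla : a ∉ l := fun h => (hl.2.2 a h).2 (by simp)
    have hld : d ∉ l := fun h => (hl.2.2 d h).2 (by simp)
    have hx6 := h.1
    unfold Hex at hx6
    by_cases hbc : b ∈ l ∨ c ∈ l
    · have hall : ∀ v ∈ l, v ∈ D := by
        intro v hv
        rcases hbc with hb | hb
        · exact chain_iff hcl l hl.2.1 hl.2.2 b hb v hv (Or.inl rfl)
        · exact chain_iff hcl l hl.2.1 hl.2.2 c hb v hv (Or.inr (Or.inl rfl))
      have hel : e ∉ l := fun h => heD (hall e h)
      have hfl : f ∉ l := fun h => hfD (hall f h)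
      refine close4 hm (p := e) (q := f) hlS hx hy (by omega) hxa hyd (by tauto) (by tauto) (by tauto) ?_ ?_ ?_
      · simp; grind
      · simp; tauto
      · simp; tauto
    · push Not at hbc
      refine close4 hm (p := c) (q := b) hlS hx hy (by omega) hxa hyd (by grind) (by grind) (by grind) ?_ ?_ ?_
      · simp; grind
      · simp; tauto
      · simp; tauto
  intro l hl x y hx hy p hp q hq hpq hxp hyq
  simp only [mem_insert_iff, mem_singleton_iff] at hp hq
  rcases hp with rfl | rfl <;> rcases hq with rfl | rfl
  · exact absurd rfl hpq
  · exact main l hl x y hx hy hxp hyq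
  · have := main l.reverse hl.reverse y x (by simpa using hy) (by simpa using hx) hyq hxp
    simpa using this
  · exact absurd rfl hpq

theorem CC.good [Finite V] {a b c d e f u u' r : V} (h2 : TwoC G S) (hm : Max6 G S)
    (h : CC G S a b c d e f u u') (hr : r ∈ S) : ∃ f, GoodOn G S r f := by
  by_cases bf : G.Adj b f
  · exact h.bf h2 hm bf hr
  by_cases ce : G.Adj c e
  · exact h.flip.bf h2 hm ce hr
  have he := h.ear h2 hm bf ce
  have hx6 := h.1
  unfold Hex at hx6
  exact caseP h2 (a := a) (b := d) (by tauto) (by tauto) (by tauto) he hr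

end

end

section
set_option linter.unusedSectionVars false
set_option linter.unusedVariables false
open Set Filter Topology

section
variable {V : Type} {G : SimpleGraph V} {S C O : Set V}
open scoped Fin.NatCast Fin.CommRing

theorem fin6_shift (i j : Fin 6) : j = i + (j - i) := by simp

theorem fin6_val (m : Fin 6) (h1 : 2 ≤ m.val) (h2 : m.val + 2 ≤ 6) : m = 2 ∨ m = 3 ∨ m = 4 := by
  revert m; decide

theorem fin6_val3 (m : Fin 6) (h1 : 3 ≤ m.val) (h2 : m.val + 3 ≤ 6) : m = 3 := by
  revert m; decide

theorem fin6_three : ∀ i j k : Fin 6, i ≠ j → i ≠ k → j ≠ k → (j = i + 2 ∨ i = j + 2) → (k = i + 2 ∨ i = k + 2) →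
    (k = j + 2 ∨ j = k + 2) → (j = i + 2 ∧ k = i + 4) ∨ (j = i + 4 ∧ k = i + 2) := by decide

theorem fin6_four : ∀ i : Fin 6, i = i + 4 + 2 := by decide

theorem case_six [Finite V] (h2 : TwoC G S) (hm : Max6 G S) {c : Fin 6 → V} (hc : CycF G S 6 c) {r : V}
    (hr : r ∈ S) : ∃ f, GoodOn G S r f := by
  by_cases hC : ∃ a b c d e f u u', CC G S a b c d e f u u'
  · obtain ⟨a, b, c, d, e, f, u, u', h⟩ := hC
    exact h.good h2 hm hr
  by_cases hA : ∃ a b c d e f w, Hex G S a b c d e f ∧ Off S a b c d e f w ∧ G.Adj w a ∧ G.Adj w c ∧ G.Adj w e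
  · obtain ⟨a, b, c, d, e, f, w, h, hw, wa, wc, we⟩ := hA
    exact caseA h2 hm h hw wa wc we hr
  refine finish le_rfl ?_ hc hr
  clear hc c
  intro c hc
  have H2 : ∀ h ∈ S \ range c, ∀ i j, i ≠ j → G.Adj h (c i) → G.Adj h (c j) → j = i + 2 ∨ i = j + 2 := by
    intro h hh i j hij hi hj
    obtain ⟨h3, h4⟩ := hc.ear1 hm hh hij hi hj
    rcases fin6_val _ h3 h4 with h5 | h5 | h5
    · left; rw [← h5]; simp
    · exfalso
      have e : j = i + 3 := by rw [← h5]; simp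
      rw [e] at hj
      exact hC ⟨_, _, _, _, _, _, h, h, hc.hex i, CycF.off i hh, CycF.off i hh, hi, hj, Or.inl rfl⟩
    · right
      have e : j = i + 4 := by rw [← h5]; simp
      rw [e]; exact fin6_four i
  refine hc.att h2 le_rfl hm ?_ H2 ?_
  · intro h hh h' hh' hhh i j hij hi hj
    obtain ⟨h3, h4⟩ := hc.ear2 hm hh hh' hhh hij hi hj
    have h5 := fin6_val3 _ h3 h4
    have e : j = i + 3 := by rw [← h5]; simp
    rw [e] at hj
    exact hC ⟨_, _, _, _, _, _, h, h', hc.hex i, CycF.off i hh, CycF.off i hh', hi, hj, Or.inr hhh⟩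
  · intro h hh i j k hij hik hjk hi hj hk
    rcases fin6_three i j k hij hik hjk (H2 h hh i j hij hi hj) (H2 h hh i k hik hi hk)
      (H2 h hh j k hjk hj hk) with ⟨e1, e2⟩ | ⟨e1, e2⟩
    · rw [e1] at hj; rw [e2] at hk
      exact hA ⟨_, _, _, _, _, _, h, hc.hex i, CycF.off i hh, hi, hj, hk⟩
    · rw [e1] at hj; rw [e2] at hk
      exact hA ⟨_, _, _, _, _, _, h, hc.hex i, CycF.off i hh, hi, hk, hj⟩

theorem case_base [Finite V] (hb : ∀ l, CycL G S l → l.length ≤ 6) {r : V} (hr : r ∈ S) (h2 : TwoC G S) :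
    ∃ f, GoodOn G S r f := by
  by_cases h3 : 3 ≤ S.ncard
  · obtain ⟨l0, hl0⟩ := h2.cyc h3
    obtain ⟨l, hl, hmax⟩ : ∃ l, CycL G S l ∧ ∀ l', CycL G S l' → l'.length ≤ l.length := by
      have hne : ({n | ∃ l, CycL G S l ∧ l.length = n} : Set ℕ).Nonempty := ⟨_, l0, hl0, rfl⟩
      have hbd : BddAbove ({n | ∃ l, CycL G S l ∧ l.length = n} : Set ℕ) :=
        ⟨6, by rintro _ ⟨l, hl, rfl⟩; exact hb l hl⟩
      obtain ⟨l, hl, hn⟩ := Nat.sSup_mem hne hbd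
      refine ⟨l, hl, fun l' hl' => ?_⟩
      rw [hn]
      exact le_csSup hbd ⟨l', hl', rfl⟩
    obtain ⟨n, hz, c, hn, hc⟩ := hl.toF
    have hle := hb l hl
    rw [← hn] at hmax hle
    rcases Nat.lt_or_ge n 6 with h6 | h6
    · exact case_small h2 (by omega) hmax hc hr
    · obtain rfl : n = 6 := by omega
      exact case_six h2 hb hc hr
  · obtain ⟨t, ht, -⟩ := exists_tie V
    refine goodOn_parabola (ht.injOn (s := S)) ?_ hr
    intro u hu v hv huv hnad
    refine Or.inl ⟨1, one_ne_zero, fun w hw huw => ?_⟩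
    exfalso
    refine h3 ((Set.two_lt_ncard_iff (Set.toFinite S)).2 ⟨u, v, w, hu, hv, hw, huv, huw.ne, ?_⟩)
    rintro rfl
    exact hnad huw

theorem main_thm {V : Type} [Fintype V] (G : SimpleGraph V)
    (hcirc : ∀ (v : V) (w : G.Walk v v), w.IsCycle → w.length ≤ 6) :
    ∃ (f : V → Plane) (C : Set Plane), IsOutsideObstacleRep G f C := by
  rcases isEmpty_or_nonempty V with hV | ⟨⟨r⟩⟩
  · refine outside_of_good_gen G (g := fun _ => 0) (fun u => isEmptyElim u) (fun u => isEmptyElim u)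
      (fun u => isEmptyElim u)
  · obtain ⟨f, hf⟩ := main_ind (G := G) (fun S r hr h2 => case_base (fun l hl => by
      obtain ⟨v, w, hw, hlen⟩ := hl.walk
      rw [← hlen]; exact hcirc v w hw) hr h2) _ univ rfl r (mem_univ r)
    exact outside_of_good G hf

end

end

/-- Every finite simple graph with circumference at most 6 (no cycle of
length greater than 6) has an outside-obstacle representation. -/
theorem circumference_le_six_hasOutsideObstacleRep
    {V : Type} [Fintype V] (G : SimpleGraph V)
    (hcirc : ∀ (v : V) (w : G.Walk v v), w.IsCycle → w.length ≤ 6) :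
    ∃ (f : V → Plane) (C : Set Plane), IsOutsideObstacleRep G f C := by
  exact main_thm G hcirc

end
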